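/- The double coinvariant algebra DR_n is a finite-dimensional ℚ-vector space of dimension (n+1)^{n−1}. -/

import Mathlib

noncomputable section
open MvPolynomial
abbrev PolyXY (n : ℕ) := MvPolynomial (Fin n ⊕ Fin n) ℚ

def Xv (n : ℕ) (i : Fin n) : PolyXY n := MvPolynomial.X (Sum.inl i)
def Yv (n : ℕ) (i : Fin n) : PolyXY n := MvPolynomial.X (Sum.inr i)

def polarPow (n : ℕ) (i j : ℕ) : PolyXY n := ∑ k : Fin n, Xv n k ^ i * Yv n k ^ j

def Mplus (n : ℕ) : Ideal (PolyXY n) :=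
  Ideal.span {p : PolyXY n | ∃ i j : ℕ, ¬(i = 0 ∧ j = 0) ∧ p = polarPow n i j}

abbrev DR (n : ℕ) := PolyXY n ⧸ Mplus n

def mkDR (n : ℕ) : PolyXY n →ₐ[ℚ] DR n := Ideal.Quotient.mkₐ ℚ (Mplus n)

def Ymon (n : ℕ) (b : Fin n → ℕ) : PolyXY n := ∏ j : Fin n, Yv n j ^ b j

namespace DoubleCoinvariants

theorem finite_and_finrank_le_sum_of_prod_eq_zero {A ι : Type*} [CommRing A] [Algebra ℚ A]
    (d : ι → A) (b : ι → ℕ) (s : Finset ι)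
    (h : ∀ i ∈ s, Module.Finite ℚ (A ⧸ Ideal.span {d i}) ∧
      Module.finrank ℚ (A ⧸ Ideal.span {d i}) ≤ b i) :
    Module.Finite ℚ (A ⧸ Ideal.span {∏ i ∈ s, d i}) ∧
      Module.finrank ℚ (A ⧸ Ideal.span {∏ i ∈ s, d i}) ≤ ∑ i ∈ s, b i := by
  classical
  induction s using Finset.induction_on with
  | empty =>
    have : Subsingleton (A ⧸ Ideal.span {∏ i ∈ (∅ : Finset ι), d i}) := by
      rw [Ideal.Quotient.subsingleton_iff]; simp
    exact ⟨inferInstance, Module.finrank_zero_of_subsingleton.le.trans (Nat.zero_le _)⟩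
  | insert a s ha ih =>
    obtain ⟨ih1, ih2⟩ := ih fun i hi => h i (Finset.mem_insert_of_mem hi)
    obtain ⟨h1, h2⟩ := h a (Finset.mem_insert_self _ _)
    rw [Finset.prod_insert ha, Finset.sum_insert ha]
    set e := ∏ i ∈ s, d i
    set I := Ideal.span {d a * e}
    have hle : I ≤ Ideal.span {d a} := by
      rw [Ideal.span_singleton_le_span_singleton]; exact Dvd.intro _ rfl
    let f : (A ⧸ I) →ₗ[ℚ] (A ⧸ Ideal.span {d a}) :=
      (Ideal.Quotient.factorₐ ℚ hle).toLinearMap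
    let m : A →ₗ[ℚ] (A ⧸ I) := (Ideal.Quotient.mkₐ ℚ I).toLinearMap ∘ₗ LinearMap.mulLeft ℚ (d a)
    have hm : (Ideal.span {e}).restrictScalars ℚ ≤ LinearMap.ker m := by
      intro x hx
      obtain ⟨y, rfl⟩ := Ideal.mem_span_singleton.1 hx
      simp only [m, LinearMap.mem_ker, LinearMap.comp_apply, LinearMap.mulLeft_apply,
        AlgHom.toLinearMap_apply, Ideal.Quotient.mkₐ_eq_mk]
      rw [Ideal.Quotient.eq_zero_iff_mem, ← mul_assoc]
      exact Ideal.mul_mem_right _ _ (Ideal.mem_span_singleton_self _)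
    let g : (A ⧸ Ideal.span {e}) →ₗ[ℚ] (A ⧸ I) :=
      ((Ideal.span {e}).restrictScalars ℚ).liftQ m hm
    have hker : LinearMap.ker f ≤ LinearMap.range g := by
      intro x hx
      obtain ⟨x, rfl⟩ := Ideal.Quotient.mk_surjective x
      have hx' : Ideal.Quotient.mk (Ideal.span {d a}) x = 0 := hx
      rw [Ideal.Quotient.eq_zero_iff_mem] at hx'
      obtain ⟨y, rfl⟩ := Ideal.mem_span_singleton.1 hx'
      exact ⟨Ideal.Quotient.mk _ y, rfl⟩
    have : Module.Finite ℚ (LinearMap.range g) := Module.Finite.range g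
    have hkf : Module.Finite ℚ (LinearMap.ker f) :=
      Submodule.finiteDimensional_of_le hker
    have hrf : Module.Finite ℚ (LinearMap.range f) := inferInstance
    have hfin : Module.Finite ℚ (A ⧸ I) := by
      have := Module.Finite.equiv f.quotKerEquivRange.symm
      exact Module.Finite.of_submodule_quotient (LinearMap.ker f)
    refine ⟨hfin, ?_⟩
    rw [← LinearMap.finrank_range_add_finrank_ker f]
    have e1 := Submodule.finrank_le (LinearMap.range f)
    have e2 := Submodule.finrank_mono hker
    have e3 := LinearMap.finrank_range_le g
    change _ ≤ Module.finrank ℚ (A ⧸ Ideal.span {e}) at e3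
    omega

/-- A commutative algebra generated by the `x i` (`i ∈ s`) subject to the triangular relations
`∑_{u i ≥ u c} k i ∏_{l ∈ J c} (x i - x l) = 0` has dimension at most `∏ c ∈ s, #(J c)`. -/
theorem finite_and_finrank_le_prod_card_window {ι : Type*} [DecidableEq ι] (u : ι → ℤ)
    (J : ι → Finset ι) (root : ι) (hu : Function.Injective u)
    (hJlt : ∀ c, ∀ m ∈ J c, u m < u c)
    (hJ : ∀ t c m, m ∈ J t → u m < u c → u c ≤ u t → m ∈ J c) (s : Finset ι) :
    (∀ t ∈ s, ∀ m ∈ J t, m ∈ s ∨ m = root) → (∀ c ∈ s, u root < u c) →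
    ∀ (A : Type) [CommRing A] [Algebra ℚ A] (x : ι → A) (k : ι → ℚ),
      (∀ i ∈ s, 0 < k i) → x root = 0 → Algebra.adjoin ℚ (x '' s) = ⊤ →
      (∀ c ∈ s, ∑ i ∈ s with u c ≤ u i, k i • ∏ l ∈ J c, (x i - x l) = 0) →
      Module.Finite ℚ A ∧ Module.finrank ℚ A ≤ ∏ c ∈ s, (J c).card := by
  induction s using Finset.strongInduction with
  | H s ih =>
  intro hs hroot A _ _ x k hk hx0 hgen hrel
  rcases s.eq_empty_or_nonempty with rfl | hne
  · have hb : (⊥ : Subalgebra ℚ A) = ⊤ := by simpa using hgen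
    have hsurj : Function.Surjective (Algebra.linearMap ℚ A) := by
      intro a
      have : a ∈ (⊥ : Subalgebra ℚ A) := hb ▸ Algebra.mem_top
      exact Algebra.mem_bot.1 this
    refine ⟨Module.Finite.of_surjective _ hsurj, ?_⟩
    simpa using LinearMap.finrank_le_finrank_of_surjective hsurj
  obtain ⟨t, ht, htmax⟩ := s.exists_max_image u hne
  have hprod : ∏ l ∈ J t, (x t - x l) = 0 := by
    have h := hrel t ht
    rw [show s.filter (fun i => u t ≤ u i) = {t} by
      ext i
      simp only [Finset.mem_filter, Finset.mem_singleton]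
      refine ⟨fun hi => hu (le_antisymm (htmax i hi.1) hi.2), ?_⟩
      rintro rfl; exact ⟨ht, le_rfl⟩, Finset.sum_singleton] at h
    exact (smul_eq_zero.1 h).resolve_left (hk t ht).ne'
  have key := finite_and_finrank_le_sum_of_prod_eq_zero (fun m => x t - x m)
    (fun _ => ∏ c ∈ s.erase t, (J c).card) (J t) ?_
  · rw [hprod] at key
    let e : (A ⧸ Ideal.span {(0 : A)}) ≃ₗ[ℚ] A :=
      ((Ideal.quotientEquivAlgOfEq ℚ (by simp : Ideal.span {(0 : A)} = ⊥)).trans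
        (AlgEquiv.quotientBot ℚ A)).toLinearEquiv
    obtain ⟨k1, k2⟩ := key
    refine ⟨Module.Finite.equiv e, ?_⟩
    rw [← e.finrank_eq]
    refine k2.trans_eq ?_
    rw [Finset.sum_const, smul_eq_mul, Finset.mul_prod_erase s (fun c => (J c).card) ht]
  intro m hm
  set I := Ideal.span {x t - x m}
  have hxtm : Ideal.Quotient.mk I (x t) = Ideal.Quotient.mk I (x m) := by
    rw [Ideal.Quotient.eq]; exact Ideal.mem_span_singleton_self _
  have hmt : m ≠ t := by rintro rfl; exact (hJlt _ _ hm).false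
  refine ih (s.erase t) (Finset.erase_ssubset ht) ?_
    (fun c h => hroot c (Finset.mem_of_mem_erase h))
    (A ⧸ I) (fun i => Ideal.Quotient.mk I (x i)) (fun i => k i + if i = m then k t else 0)
    ?_ (by simp [hx0]) ?_ ?_
  · intro c hc l hl
    refine (hs c (Finset.mem_of_mem_erase hc) l hl).imp_left fun h => Finset.mem_erase.2 ⟨?_, h⟩
    rintro rfl
    exact absurd (htmax c (Finset.mem_of_mem_erase hc)) (not_le.2 (hJlt _ _ hl))
  · intro i hi
    have h1 := hk i (Finset.mem_of_mem_erase hi)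
    have h2 := hk t ht
    split_ifs <;> linarith
  · have h1 : Algebra.adjoin ℚ ((Ideal.Quotient.mkₐ ℚ I) '' (x '' s)) = ⊤ := by
      rw [← AlgHom.map_adjoin, hgen, Algebra.map_top, AlgHom.range_eq_top]
      exact Ideal.Quotient.mkₐ_surjective ℚ I
    rw [eq_top_iff, ← h1, Algebra.adjoin_le_iff]
    rintro _ ⟨_, ⟨i, hi, rfl⟩, rfl⟩
    simp only [Ideal.Quotient.mkₐ_eq_mk, SetLike.mem_coe]
    by_cases hit : i = t
    · rw [hit, hxtm]
      rcases hs t ht m hm with h | h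
      · exact Algebra.subset_adjoin ⟨m, Finset.mem_erase.2 ⟨hmt, h⟩, rfl⟩
      · rw [h, hx0, map_zero]; exact zero_mem _
    · exact Algebra.subset_adjoin ⟨i, Finset.mem_erase.2 ⟨hit, hi⟩, rfl⟩
  · intro c hc
    have hcs := Finset.mem_of_mem_erase hc
    have hct := htmax c hcs
    have h := congrArg (Ideal.Quotient.mk I) (hrel c hcs)
    have hq : ∀ (q : ℚ) (a : A), Ideal.Quotient.mk I (q • a) = q • Ideal.Quotient.mk I a :=
      fun q a => map_smul (Ideal.Quotient.mkₐ ℚ I) q a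
    rw [← Finset.add_sum_erase _ _ (Finset.mem_filter.2 ⟨ht, hct⟩)] at h
    simp only [map_add, map_sum, hq, map_prod, map_sub, map_zero, hxtm] at h
    rw [← h, Finset.filter_erase]
    simp only [add_smul, Finset.sum_add_distrib, ite_smul, zero_smul, Finset.sum_ite_eq']
    rw [add_comm]
    congr 1
    split_ifs with hif
    · rfl
    · symm
      by_cases hmc : u c ≤ u m
      · have hmr : m = root := by
          refine (hs t ht m hm).resolve_left fun hms => hif ?_
          simp [hms, hmt, hmc]
        exact absurd (hroot c hcs) (not_lt.2 (hmr ▸ hmc))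
      · rw [Finset.prod_eq_zero (hJ t c m hm (not_le.1 hmc) hct), smul_zero]
        exact sub_self _

theorem exists_span_range_eq_top_of_finrank_le {V β : Type*} [AddCommGroup V] [Module ℚ V]
    [Module.Finite ℚ V] [Finite β] (h : Module.finrank ℚ V ≤ Nat.card β) :
    ∃ f : β → V, Submodule.span ℚ (Set.range f) = ⊤ := by
  classical
  have := Fintype.ofFinite β
  let e := Module.finBasis ℚ V
  have hc : Fintype.card (Fin (Module.finrank ℚ V)) ≤ Fintype.card β := by
    simpa [Nat.card_eq_fintype_card] using h
  obtain ⟨i⟩ := Function.Embedding.nonempty_of_card_le hc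
  refine ⟨Function.extend i e 0, top_le_iff.1 ?_⟩
  rw [← e.span_eq, Submodule.span_le]
  rintro _ ⟨j, rfl⟩
  exact Submodule.subset_span ⟨i j, i.injective.extend_apply _ _ _⟩

theorem finite_and_finrank_le_card_of_filtration {R M κ : Type*} [CommRing R] [Algebra ℚ R]
    [AddCommGroup M] [Module R M] [Module ℚ M] [IsScalarTower ℚ R M] (y : κ → M) (rk : κ → ℕ)
    (hspan : Submodule.span R (Set.range y) = ⊤) (β : κ → Type*) [∀ a, Finite (β a)]
    [Finite (Σ a, β a)]
    (h : ∀ a, ∃ I : Ideal R, (∀ r ∈ I, r • y a ∈ Submodule.span R (y '' {b | rk b < rk a})) ∧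
      Module.Finite ℚ (R ⧸ I) ∧ Module.finrank ℚ (R ⧸ I) ≤ Nat.card (β a)) :
    Module.Finite ℚ M ∧ Module.finrank ℚ M ≤ Nat.card (Σ a, β a) := by
  choose I hI hfin hrank using h
  have hex : ∀ a, ∃ g : β a → R, ∀ r, ∃ q ∈ Submodule.span ℚ (Set.range g), r - q ∈ I a := by
    intro a
    obtain ⟨f, hf⟩ := exists_span_range_eq_top_of_finrank_le (hrank a)
    choose g hg using fun b => Ideal.Quotient.mk_surjective (f b)
    refine ⟨g, fun r => ?_⟩
    let π := (Ideal.Quotient.mkₐ ℚ (I a)).toLinearMap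
    have hmap : (Submodule.span ℚ (Set.range g)).map π = ⊤ := by
      rw [Submodule.map_span, ← hf, ← Set.range_comp]
      congr 2
      exact funext hg
    have hr : π r ∈ (Submodule.span ℚ (Set.range g)).map π := hmap ▸ Submodule.mem_top
    obtain ⟨q, hq, hqr⟩ := hr
    exact ⟨q, hq, Ideal.Quotient.eq.1 hqr.symm⟩
  choose g hg using hex
  let G : (Σ a, β a) → M := fun p => g p.1 p.2 • y p.1
  set S := Submodule.span ℚ (Set.range G)
  have key : ∀ N a, rk a = N → ∀ r : R, r • y a ∈ S := by
    intro N
    induction N using Nat.strong_induction_on with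
    | _ N ih =>
    rintro a rfl r
    obtain ⟨q, hq, hqr⟩ := hg a r
    rw [show r = q + (r - q) by ring, add_smul]
    refine S.add_mem ?_ ?_
    · refine Submodule.span_induction (p := fun q _ => q • y a ∈ S) ?_ (by simp) ?_ ?_ hq
      · rintro _ ⟨b, rfl⟩
        exact Submodule.subset_span ⟨⟨a, b⟩, rfl⟩
      · intro p q _ _ hp hq
        rw [add_smul]; exact S.add_mem hp hq
      · intro c p _ hp
        rw [smul_assoc]; exact S.smul_mem _ hp
    · refine Submodule.span_induction (p := fun m _ => ∀ r : R, r • m ∈ S) ?_ (by simp) ?_ ?_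
        (hI a _ hqr) 1 |> (one_smul R ((r - q) • y a) ▸ ·)
      · rintro _ ⟨b, hb, rfl⟩ r
        exact ih _ hb b rfl r
      · intro m m' _ _ h1 h2 r
        rw [smul_add]; exact S.add_mem (h1 r) (h2 r)
      · intro c m _ hm r
        rw [smul_smul]; exact hm _
  have htop : S = ⊤ := by
    rw [eq_top_iff]
    intro m _
    have hm : m ∈ Submodule.span R (Set.range y) := hspan ▸ Submodule.mem_top
    have := Submodule.span_induction (p := fun m _ => ∀ r : R, r • m ∈ S) (by
      rintro _ ⟨b, rfl⟩ r
      exact key _ b rfl r) (by simp) (by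
      intro m m' _ _ h1 h2 r
      rw [smul_add]; exact S.add_mem (h1 r) (h2 r)) (by
      intro c m _ hm r
      rw [smul_smul]; exact hm _) hm 1
    simpa using this
  have := Fintype.ofFinite (Σ a, β a)
  refine ⟨⟨⟨(Set.finite_range G).toFinset, by simpa using htop⟩⟩, ?_⟩
  rw [Nat.card_eq_fintype_card]
  exact finrank_le_of_span_eq_top htop

theorem sum_eval_mul_pow_eq_zero {A ι : Type*} [CommRing A] [Fintype ι] (x y : ι → A)
    (hp : ∀ e m : ℕ, ¬(e = 0 ∧ m = 0) → ∑ i, x i ^ e * y i ^ m = 0) (G : Polynomial A) (m : ℕ)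
    (h : m ≠ 0 ∨ G.eval 0 = 0) : ∑ i, G.eval (x i) * y i ^ m = 0 := by
  simp only [Polynomial.eval_eq_sum_range, Finset.sum_mul]
  rw [Finset.sum_comm]
  refine Finset.sum_eq_zero fun e _ => ?_
  simp only [mul_assoc, ← Finset.mul_sum]
  by_cases he : e = 0 ∧ m = 0
  · have hG : G.eval 0 = 0 := h.resolve_left (not_not.2 he.2)
    rw [he.1, Polynomial.coeff_zero_eq_eval_zero, hG, zero_mul]
  · rw [hp e m he, mul_zero]

theorem sum_powersetCard_prod_mul_sum_eq_zero {A ι : Type*} [CommRing A] [DecidableEq ι]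
    (γ y : ι → A) (E : Finset ι) (h : ∀ m, m ≠ 0 → ∑ i ∈ E, γ i * y i ^ m = 0) (s : ℕ) :
    ∑ R ∈ E.powersetCard (s + 1), (∏ j ∈ R, y j) * ∑ i ∈ R, γ i = 0 := by
  have hsplit : ∀ i ∈ E, ∀ s, ∑ R ∈ E.powersetCard (s + 1), ∏ j ∈ R, y j =
      ∑ R ∈ (E.erase i).powersetCard (s + 1), ∏ j ∈ R, y j +
        y i * ∑ R ∈ (E.erase i).powersetCard s, ∏ j ∈ R, y j := by
    intro i hi s
    conv_lhs => rw [← Finset.insert_erase hi, Finset.powersetCard_succ_insert (by simp)]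
    rw [Finset.sum_union, Finset.sum_image, Finset.mul_sum]
    · congr 1
      refine Finset.sum_congr rfl fun R hR => ?_
      rw [Finset.prod_insert]
      intro hiR
      exact Finset.notMem_erase i E ((Finset.mem_powersetCard.1 hR).1 hiR)
    · intro R hR R' hR' hRR'
      have e1 : i ∉ R := fun h => Finset.notMem_erase i E ((Finset.mem_powersetCard.1 hR).1 h)
      have e2 : i ∉ R' := fun h => Finset.notMem_erase i E ((Finset.mem_powersetCard.1 hR').1 h)
      rw [← Finset.erase_insert e1, ← Finset.erase_insert e2]
      exact congrArg (Finset.erase · i) hRR'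
    · rw [Finset.disjoint_left]
      intro R hR hR'
      obtain ⟨R', _, rfl⟩ := Finset.mem_image.1 hR'
      exact Finset.notMem_erase i E
        ((Finset.mem_powersetCard.1 hR).1 (Finset.mem_insert_self _ _))
  have key : ∀ s m, m ≠ 0 → ∑ i ∈ E, γ i * y i ^ m *
      ∑ R ∈ (E.erase i).powersetCard s, ∏ j ∈ R, y j = 0 := by
    intro s
    induction s with
    | zero => intro m hm; simpa using h m hm
    | succ s ih =>
      intro m hm
      have h1 : ∀ i ∈ E, γ i * y i ^ m * ∑ R ∈ (E.erase i).powersetCard (s + 1), ∏ j ∈ R, y j =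
          (γ i * y i ^ m) * (∑ R ∈ E.powersetCard (s + 1), ∏ j ∈ R, y j) -
          γ i * y i ^ (m + 1) * ∑ R ∈ (E.erase i).powersetCard s, ∏ j ∈ R, y j := by
        intro i hi
        rw [hsplit i hi s]; ring
      rw [Finset.sum_congr rfl h1, Finset.sum_sub_distrib, ← Finset.sum_mul, h m hm,
        ih (m + 1) m.succ_ne_zero]
      simp
  rw [← key s 1 one_ne_zero]
  simp only [Finset.mul_sum]
  rw [Finset.sum_sigma', Finset.sum_sigma']
  refine Finset.sum_bij' (fun p _ => ⟨p.2, p.1.erase p.2⟩) (fun p _ => ⟨insert p.1 p.2, p.1⟩)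
    ?_ ?_ ?_ ?_ ?_
  · rintro ⟨R, i⟩ h
    simp only [Finset.mem_sigma, Finset.mem_powersetCard] at h ⊢
    refine ⟨h.1.1 h.2, Finset.erase_subset_erase _ h.1.1, ?_⟩
    rw [Finset.card_erase_of_mem h.2, h.1.2]; rfl
  · rintro ⟨i, R⟩ h
    simp only [Finset.mem_sigma, Finset.mem_powersetCard] at h ⊢
    have hi : i ∉ R := fun hh => Finset.notMem_erase i E (h.2.1 hh)
    refine ⟨⟨Finset.insert_subset h.1 (h.2.1.trans (Finset.erase_subset _ _)), ?_⟩,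
      Finset.mem_insert_self _ _⟩
    rw [Finset.card_insert_of_notMem hi, h.2.2]
  · rintro ⟨R, i⟩ h
    simp only [Finset.mem_sigma] at h
    simp [Finset.insert_erase h.2]
  · rintro ⟨i, R⟩ h
    simp only [Finset.mem_sigma, Finset.mem_powersetCard] at h
    have hi : i ∉ R := fun hh => Finset.notMem_erase i E (h.2.1 hh)
    simp [Finset.erase_insert hi]
  · rintro ⟨R, i⟩ h
    simp only [Finset.mem_sigma] at h
    simp only
    rw [← Finset.mul_prod_erase R y h.2]; ring

/-- The height of a vertex: `(n + 1) * a i + i` for the label `i`, and `-1` for the root. -/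
def vertexHeight {n : ℕ} (a : Fin n → ℕ) : Fin (n + 1) → ℤ :=
  Fin.snoc (α := fun _ => ℤ) (fun i => ((n : ℤ) + 1) * a i + i) (-1)

/-- The vertices lying strictly below `c` by less than `n + 1`. -/
def window {n : ℕ} (a : Fin n → ℕ) (c : Fin (n + 1)) : Finset (Fin (n + 1)) :=
  {v | vertexHeight a c - (n + 1) < vertexHeight a v ∧ vertexHeight a v < vertexHeight a c}

def expRank {n : ℕ} (a : Fin n → ℕ) : ℕ := ∑ i, ((n + 1) * a i ^ 2 + 2 * i * a i)

@[simp] theorem vertexHeight_castSucc {n : ℕ} (a : Fin n → ℕ) (i : Fin n) :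
    vertexHeight a i.castSucc = ((n : ℤ) + 1) * a i + i := by simp [vertexHeight]

@[simp] theorem vertexHeight_last {n : ℕ} (a : Fin n → ℕ) :
    vertexHeight a (Fin.last n) = -1 := by simp [vertexHeight]

theorem vertexHeight_emod {n : ℕ} (a : Fin n → ℕ) (v : Fin (n + 1)) :
    vertexHeight a v % (n + 1) = v := by
  induction v using Fin.lastCases with
  | last =>
    rw [vertexHeight_last, Fin.val_last]
    rw [Int.emod_eq_iff (by positivity)]
    refine ⟨by positivity, by omega, ⟨1, by ring⟩⟩
  | cast i =>
    rw [vertexHeight_castSucc, Int.mul_add_emod_self_left]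
    exact Int.emod_eq_of_lt (by positivity) (by omega)

theorem vertexHeight_injective {n : ℕ} (a : Fin n → ℕ) : Function.Injective (vertexHeight a) := by
  intro v w h
  have := vertexHeight_emod a v
  rw [h, vertexHeight_emod] at this
  exact Fin.ext (by exact_mod_cast this.symm)

theorem mem_window {n : ℕ} (a : Fin n → ℕ) (c v : Fin (n + 1)) : v ∈ window a c ↔
    vertexHeight a c - (n + 1) < vertexHeight a v ∧ vertexHeight a v < vertexHeight a c := by
  simp [window]

theorem vertexHeight_castSucc_nonneg {n : ℕ} (a : Fin n → ℕ) (i : Fin n) :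
    0 ≤ vertexHeight a i.castSucc := by rw [vertexHeight_castSucc]; positivity

/-- Exchanging part of an upper set of vertices for vertices far below decreases the rank. -/
theorem expRank_exchange_lt {n : ℕ} (a b : Fin n → ℕ) (I R : Finset (Fin n)) (t : ℤ)
    (hI : ∀ i ∈ I, t ≤ vertexHeight a i.castSucc)
    (hR : ∀ i ∈ R, i ∉ I → vertexHeight a i.castSucc < t - (n + 1))
    (hcard : R.card = I.card) (hne : R ≠ I)
    (hb : ∀ i, (b i : ℤ) = a i - (if i ∈ I then 1 else 0) + (if i ∈ R then 1 else 0)) :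
    expRank b < expRank a := by
  have hdiff : ((expRank b : ℤ) - expRank a) =
      ∑ i ∈ R \ I, (2 * vertexHeight a i.castSucc + (n + 1)) -
      ∑ i ∈ I \ R, (2 * vertexHeight a i.castSucc - (n + 1)) := by
    have e1 : R \ I = Finset.univ.filter fun i => i ∈ R ∧ i ∉ I := by ext; simp
    have e2 : I \ R = Finset.univ.filter fun i => i ∈ I ∧ i ∉ R := by ext; simp
    rw [e1, e2, Finset.sum_filter, Finset.sum_filter]
    simp only [expRank, Nat.cast_sum, ← Finset.sum_sub_distrib]
    refine Finset.sum_congr rfl fun i _ => ?_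
    push_cast
    rw [hb]
    by_cases h1 : i ∈ I <;> by_cases h2 : i ∈ R <;> simp [h1, h2] <;> ring
  have hcard' : (R \ I).card = (I \ R).card := by
    have h1 := Finset.card_sdiff_add_card_inter R I
    have h2 := Finset.card_sdiff_add_card_inter I R
    rw [Finset.inter_comm] at h2
    omega
  have hpos : 0 < (R \ I).card := by
    rw [Finset.card_pos, Finset.sdiff_nonempty]
    exact fun h => hne (Finset.eq_of_subset_of_card_le h hcard.ge)
  have h1 : ∑ i ∈ R \ I, (2 * vertexHeight a i.castSucc + (n + 1)) ≤
      (R \ I).card • (2 * t - (n + 1) - 2) := by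
    refine Finset.sum_le_card_nsmul _ _ _ fun i hi => ?_
    have := hR i (Finset.mem_sdiff.1 hi).1 (Finset.mem_sdiff.1 hi).2
    linarith
  have h2 : (I \ R).card • (2 * t - (n + 1)) ≤
      ∑ i ∈ I \ R, (2 * vertexHeight a i.castSucc - (n + 1)) := by
    refine Finset.card_nsmul_le_sum _ _ _ fun i hi => ?_
    have := hI i (Finset.mem_sdiff.1 hi).1
    linarith
  rw [hcard'] at h1 hpos
  rw [nsmul_eq_mul] at h1 h2
  have h3 : (0 : ℤ) < ((I \ R).card : ℤ) := by exact_mod_cast hpos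
  have : (expRank b : ℤ) < expRank a := by nlinarith
  exact_mod_cast this

theorem relation_mem_span {n : ℕ} {R A : Type*} [CommRing R] [CommRing A] [Algebra R A]
    (x : Fin n → R) (y : Fin n → A)
    (hp : ∀ e m : ℕ, ¬(e = 0 ∧ m = 0) → ∑ i, algebraMap R A (x i) ^ e * y i ^ m = 0)
    (a : Fin n → ℕ) (c : Fin n) :
    (∑ i with vertexHeight a c.castSucc ≤ vertexHeight a i.castSucc,
      ∏ l ∈ window a c.castSucc, (x i - Fin.snoc (α := fun _ => R) x 0 l)) • ∏ i, y i ^ a i ∈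
    Submodule.span R ((fun b : Fin n → ℕ => ∏ i, y i ^ b i) '' {b | expRank b < expRank a}) := by
  set x' : Fin (n + 1) → R := Fin.snoc (α := fun _ => R) x 0 with hx'
  set u := vertexHeight a with hu
  set J := window a c.castSucc with hJ
  let γ : Fin n → R := fun i => ∏ l ∈ J, (x i - x' l)
  let G : Polynomial A := ∏ l ∈ J, (Polynomial.X - Polynomial.C (algebraMap R A (x' l)))
  have hG : ∀ i, G.eval (algebraMap R A (x i)) = algebraMap R A (γ i) := by
    intro i
    simp [G, γ, Polynomial.eval_prod]
  have hγ : ∀ i : Fin n, i.castSucc ∈ J → γ i = 0 := by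
    intro i hi
    exact Finset.prod_eq_zero hi (by simp [hx'])
  set I : Finset (Fin n) := {i | u c.castSucc ≤ u i.castSucc} with hI
  change (∑ i ∈ I, γ i) • _ ∈ _
  rcases Nat.eq_zero_or_pos (a c) with hc | hc
  · have h0 := sum_eval_mul_pow_eq_zero (fun i => algebraMap R A (x i)) y hp G 0 (Or.inr (by
      have : Fin.last n ∈ J := by
        simp only [hJ, mem_window, vertexHeight_last, vertexHeight_castSucc, hc]
        constructor <;> simp <;> omega
      simp only [G, Polynomial.eval_prod]
      exact Finset.prod_eq_zero this (by simp [hx'])))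
    simp only [hG, pow_zero, mul_one] at h0
    have h1 : algebraMap R A (∑ i ∈ I, γ i) = 0 := by
      rw [map_sum, ← h0]
      refine Finset.sum_subset (Finset.subset_univ _) fun i _ hi => ?_
      rw [hγ i, map_zero]
      have h2 : u i.castSucc < u c.castSucc := by simpa [hI] using hi
      refine (mem_window _ _ _).2 ⟨?_, h2⟩
      have h3 := vertexHeight_castSucc_nonneg a i
      have : u c.castSucc = c := by simp [hu, hc]
      simp only [hu] at this ⊢
      omega
    rw [Algebra.smul_def, h1, zero_mul]
    exact zero_mem _
  · set E : Finset (Fin n) := {i | i.castSucc ∉ J} with hE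
    have hIE : I ⊆ E := by
      intro i hi
      simp only [hI, hE, hJ, Finset.mem_filter, Finset.mem_univ, true_and, mem_window] at hi ⊢
      exact fun h => absurd h.2 (not_lt.2 hi)
    have hcI : c ∈ I := by simp [hI]
    have hE0 : ∀ m, m ≠ 0 → ∑ i ∈ E, algebraMap R A (γ i) * y i ^ m = 0 := by
      intro m hm
      rw [← sum_eval_mul_pow_eq_zero (fun i => algebraMap R A (x i)) y hp G m (Or.inl hm)]
      simp only [hG]
      refine Finset.sum_subset (Finset.subset_univ _) fun i _ hi => ?_
      rw [hγ i (by simpa [hE] using hi), map_zero, zero_mul]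
    obtain ⟨s, hs⟩ : ∃ s, I.card = s + 1 :=
      Nat.exists_eq_succ_of_ne_zero (Finset.card_ne_zero_of_mem hcI)
    have key := sum_powersetCard_prod_mul_sum_eq_zero (fun i => algebraMap R A (γ i)) y E hE0 s
    have haI : ∀ i ∈ I, 1 ≤ a i := by
      intro i hi
      have h2 : u c.castSucc ≤ u i.castSucc := by simpa [hI] using hi
      simp only [hu, vertexHeight_castSucc] at h2
      by_contra! h3
      have h4 : a i = 0 := by omega
      have h5 : ((n : ℤ) + 1) * 1 ≤ (n + 1) * a c :=
        mul_le_mul_of_nonneg_left (by exact_mod_cast hc) (by positivity)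
      simp only [h4] at h2
      have := i.2
      omega
    let bexp : Finset (Fin n) → Fin n → ℕ := fun R i =>
      a i - (if i ∈ I then 1 else 0) + (if i ∈ R then 1 else 0)
    have hbmul : ∀ R, (∏ i, y i ^ (a i - if i ∈ I then 1 else 0)) * ∏ j ∈ R, y j =
        ∏ i, y i ^ bexp R i := by
      intro R
      simp only [bexp, pow_add, Finset.prod_mul_distrib]
      congr 1
      simp [Finset.prod_ite_mem, pow_ite]
    have hbI : bexp I = a := by
      funext i
      simp only [bexp]
      split_ifs with h
      · exact Nat.sub_add_cancel (haI i h)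
      · rfl
    have hmem : I ∈ E.powersetCard (s + 1) := Finset.mem_powersetCard.2 ⟨hIE, hs⟩
    have key2 : ∑ R' ∈ E.powersetCard (s + 1), (∑ i ∈ R', γ i) • ∏ i, y i ^ bexp R' i = 0 := by
      rw [← mul_zero (∏ i, y i ^ (a i - if i ∈ I then 1 else 0)), ← key, Finset.mul_sum]
      refine Finset.sum_congr rfl fun R' _ => ?_
      rw [← hbmul, Algebra.smul_def, map_sum]; ring
    rw [← Finset.add_sum_erase _ _ hmem, hbI] at key2
    rw [eq_neg_of_add_eq_zero_left key2]
    refine neg_mem (Submodule.sum_mem _ fun R' hR' => Submodule.smul_mem _ _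
      (Submodule.subset_span ⟨bexp R', ?_, rfl⟩))
    obtain ⟨hR1, hR2⟩ := Finset.mem_erase.1 hR'
    obtain ⟨hR2, hR3⟩ := Finset.mem_powersetCard.1 hR2
    refine expRank_exchange_lt a (bexp R') I R' (u c.castSucc) ?_ ?_ (hR3.trans hs.symm) hR1 ?_
    · intro i hi; exact (Finset.mem_filter.1 hi).2
    · intro i hi hiI
      have h1 := hR2 hi
      simp only [hI, hE, hJ, Finset.mem_filter, Finset.mem_univ, true_and, mem_window, not_and,
        not_lt, not_le] at h1 hiI
      refine lt_of_le_of_ne ?_ ?_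
      · by_contra! h2
        exact absurd (h1 h2) (not_le.2 hiI)
      · intro h2
        have e1 := vertexHeight_emod a i.castSucc
        have e2 := vertexHeight_emod a c.castSucc
        simp only [hu] at h2 hiI
        rw [h2, Int.sub_emod_right, e2] at e1
        have : c = i := by
          apply Fin.ext; simpa using e1
        rw [this] at hiI
        exact hiI.false
    · intro i
      simp only [bexp]
      have := haI i
      split_ifs <;> simp_all

def IsParking {n : ℕ} (q : Fin n → Fin (n + 1)) : Prop :=
  ∀ j : ℕ, 1 ≤ j → j ≤ n → j ≤ Finset.card {c | (q c : ℕ) < j}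

theorem IsParking.eq_of_sub_eq {m : ℕ} {q q' : Fin (m + 1) → Fin (m + 2)} (hq : IsParking q)
    (hq' : IsParking q') (h : ∀ i : Fin m, q i.succ - q 0 = q' i.succ - q' 0) : q = q' := by
  have hk : ∀ i, q i = q' i + (q 0 - q' 0) := by
    intro i
    induction i using Fin.cases with
    | zero => abel
    | succ i =>
      have := h i
      rw [← sub_eq_zero] at this ⊢
      rw [← this]; abel
  set k := q 0 - q' 0
  by_cases hk0 : k = 0
  · funext i; rw [hk i, hk0, add_zero]
  exfalso
  have hkpos : 1 ≤ (k : ℕ) := Nat.one_le_iff_ne_zero.2 fun h => hk0 (Fin.ext h)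
  have hklt := k.2
  have h1 := hq k hkpos (by omega)
  have h2 := hq' (m + 2 - k) (by omega) (by omega)
  have hdisj : Disjoint (Finset.univ.filter fun c => (q c : ℕ) < k)
      (Finset.univ.filter fun c => (q' c : ℕ) < m + 2 - k) := by
    rw [Finset.disjoint_left]
    intro c hc hc'
    simp only [Finset.mem_filter, Finset.mem_univ, true_and] at hc hc'
    rw [hk c, Fin.val_add, Nat.mod_eq_of_lt (by omega)] at hc
    omega
  have h3 := Finset.card_le_univ ((Finset.univ.filter fun c => (q c : ℕ) < k) ∪
      (Finset.univ.filter fun c => (q' c : ℕ) < m + 2 - k))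
  rw [Finset.card_union_of_disjoint hdisj, Fintype.card_fin] at h3
  omega

/-- The number of vertices below `v`. -/
def vertexPos {n : ℕ} (a : Fin n → ℕ) (v : Fin (n + 1)) : Fin (n + 1) :=
  ⟨Finset.card {w | vertexHeight a w < vertexHeight a v}, by
    have : Finset.card {w | vertexHeight a w < vertexHeight a v} <
        (Finset.univ : Finset (Fin (n + 1))).card :=
      Finset.card_lt_card (Finset.filter_ssubset.2 ⟨v, Finset.mem_univ _, lt_irrefl _⟩)
    simpa using this⟩

theorem vertexPos_lt_iff {n : ℕ} (a : Fin n → ℕ) (v w : Fin (n + 1)) :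
    vertexPos a v < vertexPos a w ↔ vertexHeight a v < vertexHeight a w := by
  have key : ∀ v w, vertexHeight a v < vertexHeight a w → vertexPos a v < vertexPos a w := by
    intro v w h
    simp only [vertexPos, Fin.mk_lt_mk]
    refine Finset.card_lt_card ?_
    rw [Finset.ssubset_iff_of_subset]
    · exact ⟨v, by simpa using h, by simp⟩
    · intro x hx
      simp only [Finset.mem_filter, Finset.mem_univ, true_and] at hx ⊢
      exact hx.trans h
  refine ⟨fun h => ?_, key v w⟩
  by_contra! h'
  rcases h'.lt_or_eq with h'' | h''
  · exact (key _ _ h'').not_gt h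
  · rw [vertexHeight_injective a h''] at h; exact h.false

theorem vertexPos_injective {n : ℕ} (a : Fin n → ℕ) : Function.Injective (vertexPos a) := by
  intro v w h
  have h1 := (vertexPos_lt_iff a v w).not.1 (by simp [h])
  have h2 := (vertexPos_lt_iff a w v).not.1 (by simp [h])
  exact vertexHeight_injective a (by omega)

abbrev WindowTree (n : ℕ) := Σ a : Fin n → ℕ, ∀ c : Fin n, {v // v ∈ window a c.castSucc}

def WindowTree.code {n : ℕ} (p : WindowTree n) : Fin n → Fin (n + 1) :=
  fun c => vertexPos p.1 (p.2 c)

theorem WindowTree.isParking_code {n : ℕ} (p : WindowTree n) : IsParking p.code := by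
  intro j hj hjn
  have hbij : Function.Bijective (vertexPos p.1) :=
    Finite.injective_iff_bijective.1 (vertexPos_injective p.1)
  let S : Finset (Fin n) := {c | (p.code c : ℕ) < j}
  have hsub : (Finset.univ.filter fun v => (vertexPos p.1 v : ℕ) ≤ j) ⊆
      insert (Fin.last n) (S.map Fin.castSuccEmb) := by
    intro v hv
    simp only [Finset.mem_filter, Finset.mem_univ, true_and] at hv
    induction v using Fin.lastCases with
    | last => exact Finset.mem_insert_self _ _
    | cast c =>
      refine Finset.mem_insert_of_mem (Finset.mem_map.2 ⟨c, ?_, rfl⟩)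
      simp only [S, Finset.mem_filter, Finset.mem_univ, true_and]
      have := (vertexPos_lt_iff p.1 _ _).2 ((mem_window _ _ _).1 (p.2 c).2).2
      exact lt_of_lt_of_le this hv
  have hcard : (Finset.univ.filter fun v => (vertexPos p.1 v : ℕ) ≤ j).card = j + 1 := by
    rw [← Finset.card_map ⟨vertexPos p.1, hbij.1⟩]
    have : (Finset.univ.filter fun v => (vertexPos p.1 v : ℕ) ≤ j).map ⟨vertexPos p.1, hbij.1⟩ =
        Finset.Iic ⟨j, by omega⟩ := by
      ext x
      obtain ⟨v, rfl⟩ := hbij.2 x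
      simp [Fin.le_def]
    rw [this, Fin.card_Iic]
  have h1 := Finset.card_le_card hsub
  rw [hcard] at h1
  have h2 := Finset.card_insert_le (Fin.last n) (S.map Fin.castSuccEmb)
  rw [Finset.card_map] at h2
  change j ≤ S.card
  omega

theorem WindowTree.code_injective (n : ℕ) : Function.Injective (WindowTree.code (n := n)) := by
  rintro ⟨a, p⟩ ⟨a', p'⟩ h
  have hcode : ∀ c, vertexPos a (p c) = vertexPos a' (p' c) := fun c => congrFun h c
  have hpar : ∀ c, vertexPos a (p c) < vertexPos a c.castSucc := fun c =>
    (vertexPos_lt_iff _ _ _).2 ((mem_window _ _ _).1 (p c).2).2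
  have hpar' : ∀ c, vertexPos a' (p' c) < vertexPos a' c.castSucc := fun c =>
    (vertexPos_lt_iff _ _ _).2 ((mem_window _ _ _).1 (p' c).2).2
  have hdet : ∀ c, (p c : Fin (n + 1)) = p' c →
      vertexHeight a (p c) = vertexHeight a' (p' c) →
      vertexHeight a c.castSucc = vertexHeight a' c.castSucc := by
    intro c _ h2
    have w1 := (mem_window _ _ _).1 (p c).2
    have w2 := (mem_window _ _ _).1 (p' c).2
    have e1 := vertexHeight_emod a c.castSucc
    have e2 := vertexHeight_emod a' c.castSucc
    have e3 : (vertexHeight a c.castSucc - vertexHeight a' c.castSucc) % (n + 1) = 0 :=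
      Int.emod_eq_emod_iff_emod_sub_eq_zero.1 (e1.trans e2.symm)
    obtain ⟨k, hk⟩ := Int.dvd_of_emod_eq_zero e3
    have hk0 : k = 0 := by
      have h5 : ((n : ℤ) + 1) * k < (n + 1) * 1 := by omega
      have h6 : ((n : ℤ) + 1) * (-1) < (n + 1) * k := by omega
      have h7 := lt_of_mul_lt_mul_left h5 (by positivity)
      have h8 := lt_of_mul_lt_mul_left h6 (by positivity)
      omega
    rw [hk0] at hk
    omega
  have key : ∀ t : ℕ, ∀ v, ((vertexPos a v : ℕ) < t ∨ (vertexPos a' v : ℕ) < t) →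
      vertexHeight a v = vertexHeight a' v ∧ vertexPos a v = vertexPos a' v := by
    intro t
    induction t with
    | zero => intro v hv; omega
    | succ t ih =>
      have hht : ∀ v, ((vertexPos a v : ℕ) ≤ t ∨ (vertexPos a' v : ℕ) ≤ t) →
          vertexHeight a v = vertexHeight a' v := by
        intro v hv
        induction v using Fin.lastCases with
        | last => simp
        | cast c =>
          have h1 := hpar c
          have h2 := hpar' c
          have h3 := hcode c
          rw [Fin.lt_def] at h1 h2
          have hlt : (vertexPos a (p c) : ℕ) < t := by rw [Fin.ext_iff] at h3; omega
          have i1 := ih (p c) (Or.inl hlt)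
          have hpp : (p c : Fin (n + 1)) = p' c :=
            vertexPos_injective a' (by rw [← i1.2, h3])
          exact hdet c hpp (by rw [i1.1, hpp])
      have hex : ∀ v, (vertexPos a v : ℕ) ≤ t → (vertexPos a' v : ℕ) ≤ t := by
        intro v hv
        by_contra! hv'
        have hvt : t < n + 1 := lt_trans hv' (vertexPos a' v).2
        obtain ⟨w, hw⟩ := (Finite.injective_iff_bijective.1 (vertexPos_injective a')).2 ⟨t, hvt⟩
        have hw' : (vertexPos a' w : ℕ) = t := by rw [hw]
        have l1 : vertexHeight a' w < vertexHeight a' v := by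
          rw [← vertexPos_lt_iff, Fin.lt_def]; omega
        rw [← hht w (Or.inr hw'.le), ← hht v (Or.inl hv), ← vertexPos_lt_iff, Fin.lt_def] at l1
        have := ih w (Or.inl (by omega))
        rw [Fin.ext_iff] at this
        omega
      have hex' : ∀ v, (vertexPos a' v : ℕ) ≤ t → (vertexPos a v : ℕ) ≤ t := by
        intro v hv
        by_contra! hv'
        have hvt : t < n + 1 := lt_trans hv' (vertexPos a v).2
        obtain ⟨w, hw⟩ := (Finite.injective_iff_bijective.1 (vertexPos_injective a)).2 ⟨t, hvt⟩
        have hw' : (vertexPos a w : ℕ) = t := by rw [hw]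
        have l1 : vertexHeight a w < vertexHeight a v := by
          rw [← vertexPos_lt_iff, Fin.lt_def]; omega
        rw [hht w (Or.inl hw'.le), hht v (Or.inr hv), ← vertexPos_lt_iff, Fin.lt_def] at l1
        have := ih w (Or.inr (by omega))
        rw [Fin.ext_iff] at this
        omega
      intro v hv
      have hv1 : (vertexPos a v : ℕ) ≤ t ∨ (vertexPos a' v : ℕ) ≤ t := by omega
      refine ⟨hht v hv1, ?_⟩
      have b1 := hv1.elim id (hex' v)
      have b2 := hv1.elim (hex v) id
      by_cases hlt : (vertexPos a v : ℕ) < t ∨ (vertexPos a' v : ℕ) < t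
      · exact (ih v hlt).2
      · apply Fin.ext; omega
  have hall : ∀ v, vertexHeight a v = vertexHeight a' v ∧ vertexPos a v = vertexPos a' v :=
    fun v => key (n + 1) v (Or.inl (vertexPos a v).2)
  have haa : a = a' := by
    funext c
    have := (hall c.castSucc).1
    simp only [vertexHeight_castSucc, add_left_inj] at this
    have := mul_left_cancel₀ (by positivity) this
    exact_mod_cast this
  subst haa
  congr 1
  funext c
  exact Subtype.ext (vertexPos_injective a (hcode c))

theorem WindowTree.finite_and_card_le (m : ℕ) :
    Finite (WindowTree (m + 1)) ∧ Nat.card (WindowTree (m + 1)) ≤ (m + 2) ^ m := by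
  let f : WindowTree (m + 1) → Fin m → Fin (m + 2) := fun p i => p.code i.succ - p.code 0
  have hf : Function.Injective f := fun p p' h => WindowTree.code_injective _
    (p.isParking_code.eq_of_sub_eq p'.isParking_code fun i => congrFun h i)
  refine ⟨Finite.of_injective f hf, (Nat.card_le_card_of_injective f hf).trans_eq ?_⟩
  simp

theorem finite_and_finrank_le_of_polarPow_eq_zero (n m : ℕ) (hn : n = m + 1)
    (A : Type) [CommRing A] [Algebra ℚ A]
    (π : PolyXY n →ₐ[ℚ] A) (hsurj : Function.Surjective π)
    (hπ : ∀ e k : ℕ, ¬(e = 0 ∧ k = 0) → π (polarPow n e k) = 0) :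
    Module.Finite ℚ A ∧ Module.finrank ℚ A ≤ (m + 2) ^ m := by
  let φ : MvPolynomial (Fin n) ℚ →ₐ[ℚ] A := MvPolynomial.aeval fun i => π (Xv n i)
  let : Algebra (MvPolynomial (Fin n) ℚ) A := φ.toRingHom.toAlgebra
  have hφ : ∀ r, algebraMap (MvPolynomial (Fin n) ℚ) A r = φ r := fun _ => rfl
  have : IsScalarTower ℚ (MvPolynomial (Fin n) ℚ) A :=
    IsScalarTower.of_algebraMap_eq' φ.comp_algebraMap.symm
  let x : Fin n → MvPolynomial (Fin n) ℚ := MvPolynomial.X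
  let y : Fin n → A := fun i => π (Yv n i)
  have hφx : ∀ i, φ (x i) = π (Xv n i) := fun i => by simp [φ, x]
  have hp : ∀ e k : ℕ, ¬(e = 0 ∧ k = 0) → ∑ i, algebraMap _ A (x i) ^ e * y i ^ k = 0 := by
    intro e k h
    rw [← hπ e k h, polarPow, map_sum]
    simp [hφ, hφx, y]
  obtain ⟨hfin, hcard⟩ : Finite (WindowTree n) ∧ Nat.card (WindowTree n) ≤ (m + 2) ^ m :=
    hn ▸ WindowTree.finite_and_card_le m
  have key := finite_and_finrank_le_card_of_filtration (R := MvPolynomial (Fin n) ℚ) (M := A)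
    (fun b : Fin n → ℕ => ∏ i, y i ^ b i) expRank ?_
    (fun a => ∀ c : Fin n, {v // v ∈ window a c.castSucc}) ?_
  · exact ⟨key.1, key.2.trans hcard⟩
  · rw [eq_top_iff]
    rintro q -
    obtain ⟨p, rfl⟩ := hsurj q
    induction p using MvPolynomial.induction_on' with
    | monomial s c =>
      have : π (MvPolynomial.monomial s c) =
          (MvPolynomial.monomial (s.comapDomain Sum.inl Sum.inl_injective.injOn) c :
            MvPolynomial (Fin n) ℚ) •
            ∏ i, y i ^ s (Sum.inr i) := by
        rw [Algebra.smul_def, hφ, MvPolynomial.monomial_eq, MvPolynomial.monomial_eq,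
          Finsupp.prod_fintype _ _ (by simp), Finsupp.prod_fintype _ _ (by simp)]
        simp [φ, y, Xv, Yv, Fintype.prod_sum_type, mul_assoc]
      rw [this]
      exact Submodule.smul_mem _ _ (Submodule.subset_span ⟨_, rfl⟩)
    | add p q hp hq => rw [map_add]; exact Submodule.add_mem _ hp hq
  · intro a
    set F := Submodule.span (MvPolynomial (Fin n) ℚ) ((fun b : Fin n → ℕ => ∏ i, y i ^ b i) ''
      {b | expRank b < expRank a})
    let I : Ideal (MvPolynomial (Fin n) ℚ) := F.comap
      (LinearMap.toSpanSingleton (MvPolynomial (Fin n) ℚ) A (∏ i, y i ^ a i))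
    have hI : ∀ r, r ∈ I ↔ r • ∏ i, y i ^ a i ∈ F := fun r => Iff.rfl
    refine ⟨I, fun r hr => (hI r).1 hr, ?_⟩
    let s : Finset (Fin (n + 1)) := Finset.univ.map Fin.castSuccEmb
    have hms : ∀ c : Fin n, c.castSucc ∈ s := fun c => Finset.mem_map.2 ⟨c, Finset.mem_univ _, rfl⟩
    let x' : Fin (n + 1) → MvPolynomial (Fin n) ℚ :=
      Fin.snoc (α := fun _ => MvPolynomial (Fin n) ℚ) x 0
    have hx' : ∀ c : Fin n, x' c.castSucc = x c := fun c => by simp [x']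
    have hdim := finite_and_finrank_le_prod_card_window (vertexHeight a) (window a)
      (Fin.last n)
      (vertexHeight_injective a) (fun c m hm => ((mem_window _ _ _).1 hm).2) ?_ s ?_ ?_
      (MvPolynomial (Fin n) ℚ ⧸ I) (fun v => Ideal.Quotient.mk I (x' v)) (fun _ => 1)
      (fun _ _ => one_pos)
      (by simp [x']) ?_ ?_
    · refine ⟨hdim.1, hdim.2.trans_eq ?_⟩
      rw [Nat.card_pi]
      simp [s]
    · intro t c k hk h1 h2
      rw [mem_window] at hk ⊢
      exact ⟨by linarith [hk.1], h1⟩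
    · intro t _ k _
      induction k using Fin.lastCases with
      | last => exact Or.inr rfl
      | cast k => exact Or.inl (hms k)
    · intro c hc
      obtain ⟨c, _, rfl⟩ := Finset.mem_map.1 hc
      rw [vertexHeight_last]
      have := vertexHeight_castSucc_nonneg a c
      simp only [Fin.castSuccEmb_apply]
      omega
    · have h1 : Algebra.adjoin ℚ ((Ideal.Quotient.mkₐ ℚ I) '' Set.range x) = ⊤ := by
        rw [← AlgHom.map_adjoin, MvPolynomial.adjoin_range_X, Algebra.map_top,
          AlgHom.range_eq_top]
        exact Ideal.Quotient.mkₐ_surjective ℚ I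
      rw [eq_top_iff, ← h1]
      refine Algebra.adjoin_mono ?_
      rintro _ ⟨_, ⟨i, rfl⟩, rfl⟩
      exact ⟨i.castSucc, hms i, by simp [hx']⟩
    · intro c hc
      obtain ⟨c, _, rfl⟩ := Finset.mem_map.1 hc
      have := relation_mem_span x y hp a c
      rw [← hI, ← Ideal.Quotient.eq_zero_iff_mem] at this
      rw [← this]
      simp only [s, Finset.sum_map, Finset.filter_map, one_smul, map_sum, map_prod, map_sub]
      refine Finset.sum_congr rfl fun i _ => Finset.prod_congr rfl fun l _ => ?_
      simp [x']

theorem DR_finite_and_finrank_le (m : ℕ) : Module.Finite ℚ (DR (m + 1)) ∧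
    Module.finrank ℚ (DR (m + 1)) ≤ (m + 2) ^ m :=
  finite_and_finrank_le_of_polarPow_eq_zero _ m rfl (DR (m + 1)) (mkDR (m + 1))
    (Ideal.Quotient.mkₐ_surjective ℚ _) fun e k h =>
      Ideal.Quotient.eq_zero_iff_mem.2 (Ideal.subset_span ⟨e, k, h, rfl⟩)

/-- The number of functions `Fin n → Fin (n + 1)` invariant under a permutation. -/
def fixCount {n : ℕ} (w : Equiv.Perm (Fin n)) : ℕ :=
  (Finset.univ.filter fun f : Fin n → Fin (n + 1) => ∀ i, f (w i) = f i).card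

theorem fixCount_pos {n : ℕ} (w : Equiv.Perm (Fin n)) : 0 < fixCount w :=
  Finset.card_pos.2 ⟨fun _ => 0, by simp⟩

theorem fixCount_one (n : ℕ) : fixCount (1 : Equiv.Perm (Fin n)) = (n + 1) ^ n := by
  simp [fixCount]

theorem apply_eq_of_sameCycle {n : ℕ} {β : Type*} {w : Equiv.Perm (Fin n)} {f : Fin n → β}
    (hf : ∀ i, f (w i) = f i) {a b : Fin n} (h : w.SameCycle a b) : f b = f a := by
  obtain ⟨m, -, rfl⟩ := h.exists_pow_eq'
  clear h
  induction m with
  | zero => rfl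
  | succ m ih => rw [pow_succ', Equiv.Perm.mul_apply, hf, ih]

theorem invariant_swap_mul_iff {n : ℕ} {β : Type*} {w : Equiv.Perm (Fin n)} {a k : Fin n}
    (hak : ¬ w.SameCycle k a) (f : Fin n → β) :
    (∀ i, f ((Equiv.swap a k * w) i) = f i) ↔ (∀ i, f (w i) = f i) ∧ f a = f k := by
  constructor
  · intro h
    have hpow : ∀ m : ℕ, f ((w ^ m) k) = f k := by
      intro m
      induction m with
      | zero => rfl
      | succ m ih =>
        have hw := h ((w ^ m) k)
        rw [Equiv.Perm.mul_apply, ← Equiv.Perm.mul_apply w, ← pow_succ'] at hw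
        by_cases hk : (w ^ (m + 1)) k = k
        · rw [hk]
        · rw [Equiv.swap_apply_of_ne_of_ne (fun e => hak ⟨(m + 1 : ℕ), by
            rw [zpow_natCast]; exact e⟩) hk] at hw
          rw [hw, ih]
    obtain ⟨m, -, hm⟩ :=
      (Equiv.Perm.SameCycle.exists_pow_eq' (f := w) (x := k) (y := w⁻¹ k) ⟨-1, by simp⟩)
    have hka : f a = f k := by
      have h1 := h ((w ^ m) k)
      rw [hpow, hm] at h1
      simpa using h1
    refine ⟨fun i => ?_, hka⟩
    rw [← h i, Equiv.Perm.mul_apply]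
    rcases eq_or_ne (w i) a with e | e
    · rw [e, Equiv.swap_apply_left, hka]
    rcases eq_or_ne (w i) k with e' | e'
    · rw [e', Equiv.swap_apply_right, hka]
    · rw [Equiv.swap_apply_of_ne_of_ne e e']
  · rintro ⟨h, hka⟩ i
    rw [← h i, Equiv.Perm.mul_apply]
    rcases eq_or_ne (w i) a with e | e
    · rw [e, Equiv.swap_apply_left, hka]
    rcases eq_or_ne (w i) k with e' | e'
    · rw [e', Equiv.swap_apply_right, hka]
    · rw [Equiv.swap_apply_of_ne_of_ne e e']

open Classical in
theorem fixCount_swap_mul {n : ℕ} {w : Equiv.Perm (Fin n)} {a k : Fin n}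
    (hak : ¬ w.SameCycle k a) :
    fixCount w = (n + 1) * fixCount (Equiv.swap a k * w) := by
  have hsh : ∀ i, w.SameCycle k (w i) ↔ w.SameCycle k i := fun i =>
    Equiv.Perm.sameCycle_apply_right
  have hcard : (n + 1) * fixCount (Equiv.swap a k * w) =
      ((Finset.univ : Finset (Fin (n + 1))) ×ˢ (Finset.univ.filter
        fun f : Fin n → Fin (n + 1) => ∀ i, f ((Equiv.swap a k * w) i) = f i)).card := by
    simp [fixCount]
  rw [hcard, fixCount]
  refine Finset.card_bij'
    (fun f _ => (f a - f k, fun i => f i + if w.SameCycle k i then f a - f k else 0))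
    (fun p _ => fun i => p.2 i - if w.SameCycle k i then p.1 else 0) ?_ ?_ ?_ ?_
  · intro f hf
    simp only [Finset.mem_filter, Finset.mem_univ, true_and, Finset.mem_product] at hf ⊢
    rw [invariant_swap_mul_iff (f := fun i => f i + if w.SameCycle k i then f a - f k else 0) hak]
    refine ⟨fun i => ?_, ?_⟩
    · simp only [hsh, hf i]
    · simp [hak, Equiv.Perm.SameCycle.refl w k]
  · intro p hp
    simp only [Finset.mem_filter, Finset.mem_univ, true_and, Finset.mem_product] at hp ⊢
    rw [invariant_swap_mul_iff hak] at hp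
    intro i
    simp only [hsh, hp.1 i]
  · intro f hf
    simp
  · intro p hp
    simp only [Finset.mem_filter, Finset.mem_univ, true_and, Finset.mem_product] at hp
    rw [invariant_swap_mul_iff hak] at hp
    have hkk : w.SameCycle k k := Equiv.Perm.SameCycle.refl w k
    ext1
    · simp [hak, hp.2, hkk]
    · simp [hak, hp.2, hkk]

theorem isConj_finRotate {m : ℕ} {w : Equiv.Perm (Fin (m + 1))} (h : ∀ i, w.SameCycle 0 i) :
    IsConj w (finRotate (m + 1)) := by
  cases m with
  | zero =>
    rw [show w = finRotate (0 + 1) from Equiv.ext fun i => Subsingleton.elim (α := Fin 1) _ _]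
  | succ m =>
    have hne : ∀ i, w i ≠ i := by
      intro i hi
      have h0 : ∀ j, j = i := fun j => by
        obtain ⟨t, ht⟩ := (h i).symm.trans (h j)
        rw [← ht]
        exact (Function.IsFixedPt.perm_zpow hi t)
      exact absurd ((h0 0).trans (h0 1).symm) (by simp)
    have hc : w.IsCycle := ⟨0, hne 0, fun y _ => h y⟩
    rw [hc.isConj_iff isCycle_finRotate, support_finRotate]
    congr 1
    ext i
    simp [hne]

theorem fixCount_of_sameCycle {m : ℕ} {w : Equiv.Perm (Fin (m + 1))} (h : ∀ i, w.SameCycle 0 i) :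
    fixCount w = m + 2 := by
  unfold fixCount
  have : (Finset.univ.filter fun f : Fin (m + 1) → Fin (m + 2) => ∀ i, f (w i) = f i) =
      Finset.univ.image fun (c : Fin (m + 2)) (_ : Fin (m + 1)) => c := by
    ext f
    simp only [Finset.mem_filter, Finset.mem_univ, true_and, Finset.mem_image]
    constructor
    · intro hf
      exact ⟨f 0, funext fun i => (apply_eq_of_sameCycle hf (h i)).symm⟩
    · rintro ⟨c, rfl⟩ i
      rfl
  rw [this, Finset.card_image_of_injective _ fun a b hab => congrFun hab 0]
  simp

open Classical in
theorem classFunction_eq_fixCount {m : ℕ} {χ : Equiv.Perm (Fin (m + 1)) → ℚ}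
    (hconj : ∀ w w', IsConj w w' → χ w = χ w')
    (hrec : ∀ w a, (1 - ((Finset.univ.filter fun i => w.SameCycle a i).card : ℚ) / (m + 1)) * χ w =
      ((m + 2) / (m + 1)) * ∑ k ∈ Finset.univ.filter (fun i => ¬ w.SameCycle a i),
        χ (Equiv.swap a k * w)) (w : Equiv.Perm (Fin (m + 1))) :
    (m + 2) * χ w = fixCount w * χ (finRotate (m + 1)) := by
  induction hN : fixCount w using Nat.strong_induction_on generalizing w with
  | _ N ih =>
  subst hN
  by_cases h : ∀ i, w.SameCycle 0 i
  · rw [hconj _ _ (isConj_finRotate h), fixCount_of_sameCycle h]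
    push_cast
    ring
  · have hsum : ∑ k ∈ Finset.univ.filter (fun i => ¬ w.SameCycle 0 i),
        χ (Equiv.swap 0 k * w) = (Finset.univ.filter (fun i => ¬ w.SameCycle 0 i)).card *
          (fixCount w * χ (finRotate (m + 1)) / (m + 2) ^ 2) := by
      rw [← nsmul_eq_mul]
      refine Finset.sum_eq_card_nsmul fun k hk => ?_
      have hk' : ¬ w.SameCycle k 0 := fun e => (Finset.mem_filter.1 hk).2 e.symm
      have h1 := fixCount_swap_mul hk'
      have h2 := fixCount_pos (Equiv.swap 0 k * w)
      have h3 := ih (fixCount (Equiv.swap 0 k * w)) (by nlinarith) _ rfl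
      rw [h1]
      push_cast
      have : ((m : ℚ) + 2) ≠ 0 := by positivity
      field_simp
      linear_combination ((m : ℚ) + 2) * h3
    have hcard : ((Finset.univ.filter fun i => w.SameCycle 0 i).card : ℚ) =
        (m + 1) - (Finset.univ.filter (fun i => ¬ w.SameCycle 0 i)).card := by
      rw [eq_sub_iff_add_eq]
      have := Finset.card_filter_add_card_filter_not (s := (Finset.univ : Finset (Fin (m + 1))))
        (fun i => w.SameCycle 0 i)
      rw [Finset.card_univ, Fintype.card_fin] at this
      exact_mod_cast this
    have hpos : ((Finset.univ.filter (fun i => ¬ w.SameCycle 0 i)).card : ℚ) ≠ 0 := by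
      push Not at h
      obtain ⟨i, hi⟩ := h
      exact_mod_cast (Finset.card_pos.2 ⟨i, by simp [hi]⟩).ne'
    have key := hrec w 0
    rw [hsum, hcard] at key
    have h1 : ((m : ℚ) + 2) ≠ 0 := by positivity
    have h2 : ((m : ℚ) + 1) ≠ 0 := by positivity
    field_simp at key
    apply mul_left_cancel₀ hpos
    linear_combination key

theorem sum_sign_invariant_eq {n : ℕ} {β : Type*} [DecidableEq β] (f : Fin n → β) :
    ∑ w : Equiv.Perm (Fin n), (if ∀ i, f (w i) = f i then ((Equiv.Perm.sign w : ℤ) : ℚ) else 0) =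
      if Function.Injective f then 1 else 0 := by
  split_ifs with hf
  · rw [Finset.sum_eq_single 1]
    · simp
    · intro w _ hw
      rw [if_neg]
      exact fun h => hw (Equiv.ext fun i => hf (h i))
    · simp
  · simp only [Function.Injective, not_forall] at hf
    obtain ⟨i, j, hij, hne⟩ := hf
    have hinv : ∀ k, f (Equiv.swap i j k) = f k := fun k => by
      rcases eq_or_ne k i with rfl | e
      · rw [Equiv.swap_apply_left, hij]
      rcases eq_or_ne k j with rfl | e'
      · rw [Equiv.swap_apply_right, hij]
      · rw [Equiv.swap_apply_of_ne_of_ne e e']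
    have hiff : ∀ w : Equiv.Perm (Fin n), (∀ k, f ((w * Equiv.swap i j) k) = f k) ↔
        ∀ k, f (w k) = f k := fun w => by
      constructor
      · intro h k
        have := h (Equiv.swap i j k)
        simpa [hinv] using this
      · intro h k
        rw [Equiv.Perm.mul_apply, h, hinv]
    have hs := Equiv.sum_comp (Equiv.mulRight (Equiv.swap i j))
      (fun w : Equiv.Perm (Fin n) =>
        (if ∀ i, f (w i) = f i then ((Equiv.Perm.sign w : ℤ) : ℚ) else 0))
    simp only [Equiv.coe_mulRight, hiff, Equiv.Perm.sign_mul, Equiv.Perm.sign_swap hne] at hs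
    rw [← sub_eq_zero, ← Finset.sum_sub_distrib] at hs
    have : ∀ w : Equiv.Perm (Fin n), ((if ∀ i, f (w i) = f i then
        (((Equiv.Perm.sign w * -1 : ℤˣ) : ℤ) : ℚ) else 0) -
        (if ∀ i, f (w i) = f i then ((Equiv.Perm.sign w : ℤ) : ℚ) else 0)) = -2 *
        (if ∀ i, f (w i) = f i then ((Equiv.Perm.sign w : ℤ) : ℚ) else 0) := fun w => by
      split_ifs
      · push_cast
        ring
      · simp
    rw [Finset.sum_congr rfl fun w _ => this w, ← Finset.mul_sum] at hs
    linarith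

theorem sum_sign_mul_fixCount (n : ℕ) :
    ∑ w : Equiv.Perm (Fin n), ((Equiv.Perm.sign w : ℤ) : ℚ) * fixCount w =
      (n + 1).factorial := by
  have h : ∀ w : Equiv.Perm (Fin n), ((Equiv.Perm.sign w : ℤ) : ℚ) * fixCount w =
      ∑ f : Fin n → Fin (n + 1),
        (if ∀ i, f (w i) = f i then ((Equiv.Perm.sign w : ℤ) : ℚ) else 0) := fun w => by
    rw [fixCount, ← Finset.sum_filter, Finset.sum_const, nsmul_eq_mul, mul_comm]
  rw [Finset.sum_congr rfl fun w _ => h w, Finset.sum_comm,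
    Finset.sum_congr rfl fun f _ => sum_sign_invariant_eq f, Finset.sum_boole]
  norm_cast
  rw [← Fintype.card_subtype, Fintype.card_congr (Equiv.subtypeInjectiveEquivEmbedding _ _),
    Fintype.card_embedding_eq]
  simp [Nat.descFactorial_eq_div]

/-- A module over the rational Cherednik algebra of `S_n` at parameter `(n + 1) / n`, given by
the operators through which the generators act. -/
structure CherednikModule (n : ℕ) (W : Type*) [AddCommGroup W] [Module ℚ W] where
  X : Fin n → Module.End ℚ W
  Y : Fin n → Module.End ℚ W
  σ : Equiv.Perm (Fin n) →* Module.End ℚ W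
  σ_mul_X : ∀ w i, σ w * X i = X (w i) * σ w
  σ_mul_Y : ∀ w i, σ w * Y i = Y (w i) * σ w
  X_comm : ∀ i j, X i * X j = X j * X i
  Y_comm : ∀ i j, Y i * Y j = Y j * Y i
  YX_ne : ∀ i j, i ≠ j → Y i * X j - X j * Y i =
    (((n : ℚ) + 1) / n) • σ (Equiv.swap i j) - ((1 : ℚ) / n) • 1
  YX_self : ∀ i, Y i * X i - X i * Y i = (1 - (1 : ℚ) / n) • 1 -
    (((n : ℚ) + 1) / n) • ∑ k ∈ Finset.univ.erase i, σ (Equiv.swap i k)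

namespace CherednikModule

variable {n : ℕ} {W : Type*} [AddCommGroup W] [Module ℚ W] (M : CherednikModule n W)

/-- The action of the symmetric group twisted by the sign character. -/
def twist : Representation ℚ (Equiv.Perm (Fin n)) W where
  toFun w := ((Equiv.Perm.sign w : ℤ) : ℚ) • M.σ w
  map_one' := by simp
  map_mul' w w' := by
    rw [map_mul, map_mul, smul_mul_smul_comm]
    push_cast
    rfl

/-- The vectors on which the symmetric group acts through the sign character. -/
def signPart : Submodule ℚ W := M.twist.invariants

theorem mem_signPart {v : W} :
    v ∈ M.signPart ↔ ∀ w, M.σ w v = ((Equiv.Perm.sign w : ℤ) : ℚ) • v := by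
  have hs : ∀ w : Equiv.Perm (Fin n),
      ((Equiv.Perm.sign w : ℤ) : ℚ) * ((Equiv.Perm.sign w : ℤ) : ℚ) = 1 := fun w => by
    rcases Int.units_eq_one_or (Equiv.Perm.sign w) with h | h <;> simp [h]
  rw [signPart, Representation.mem_invariants]
  refine forall_congr' fun w => ?_
  change ((Equiv.Perm.sign w : ℤ) : ℚ) • M.σ w v = v ↔ _
  constructor
  · intro h
    rw [← h, smul_smul, hs, one_smul, h]
  · intro h
    rw [h, smul_smul, hs, one_smul]

theorem finrank_signPart [FiniteDimensional ℚ W] :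
    (Module.finrank ℚ M.signPart : ℚ) * n.factorial =
      ∑ w, ((Equiv.Perm.sign w : ℤ) : ℚ) * LinearMap.trace ℚ W (M.σ w) := by
  have hcard : (Fintype.card (Equiv.Perm (Fin n)) : ℚ) = n.factorial := by
    rw [Fintype.card_perm, Fintype.card_fin]
  have h0 : (Fintype.card (Equiv.Perm (Fin n)) : ℚ) ≠ 0 := by positivity
  let := invertibleOfNonzero h0
  have h := (Representation.isProj_averageMap M.twist).trace
  rw [signPart, ← h, Representation.averageMap, GroupAlgebra.average, map_smul, map_sum, map_smul,
    map_sum, ← hcard, smul_eq_mul, mul_comm, ← mul_assoc, mul_invOf_self, one_mul]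
  refine Finset.sum_congr rfl fun w _ => ?_
  rw [Representation.asAlgebraHom_of]
  change LinearMap.trace ℚ W (((Equiv.Perm.sign w : ℤ) : ℚ) • M.σ w) = _
  rw [map_smul, smul_eq_mul]

open Classical in
theorem sum_Y_commutator_X (C : Finset (Fin n)) (a : Fin n) (ha : a ∈ C) :
    (∑ i ∈ C, M.Y i) * M.X a - M.X a * ∑ i ∈ C, M.Y i =
      (1 - (C.card : ℚ) / n) • 1 -
        (((n : ℚ) + 1) / n) • ∑ k ∈ Finset.univ.filter (· ∉ C), M.σ (Equiv.swap a k) := by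
  rw [Finset.sum_mul, Finset.mul_sum, ← Finset.sum_sub_distrib, ← Finset.add_sum_erase C _ ha,
    M.YX_self, Finset.sum_congr rfl fun i hi => M.YX_ne i a (Finset.ne_of_mem_erase hi),
    Finset.sum_sub_distrib, ← Finset.smul_sum, Finset.sum_const]
  have h1 : ∑ k ∈ Finset.univ.erase a, M.σ (Equiv.swap a k) =
      ∑ k ∈ C.erase a, M.σ (Equiv.swap k a) +
        ∑ k ∈ Finset.univ.filter (· ∉ C), M.σ (Equiv.swap a k) := by
    rw [← Finset.sum_filter_add_sum_filter_not (Finset.univ.erase a) (· ∈ C)]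
    congr 1
    · refine Finset.sum_congr ?_ fun k _ => by rw [Equiv.swap_comm]
      ext k
      simp
    · refine Finset.sum_congr ?_ fun k _ => rfl
      ext k
      simp only [Finset.mem_filter, Finset.mem_erase, Finset.mem_univ, and_true, true_and]
      exact ⟨fun h => h.2, fun h => ⟨fun e => h (e ▸ ha), h⟩⟩
  rw [h1, Finset.card_erase_of_mem ha, ← Nat.cast_smul_eq_nsmul ℚ, smul_smul,
    Nat.cast_sub (Finset.card_pos.2 ⟨a, ha⟩)]
  push_cast
  module

theorem finrank_mul_succ {m : ℕ} (M : CherednikModule (m + 1) W) [FiniteDimensional ℚ W] :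
    Module.finrank ℚ W = (m + 2) ^ m * Module.finrank ℚ M.signPart := by
  classical
  set χ : Equiv.Perm (Fin (m + 1)) → ℚ := fun w => LinearMap.trace ℚ W (M.σ w) with hχ
  have hconj : ∀ w w', IsConj w w' → χ w = χ w' := by
    intro w w' h
    obtain ⟨g, rfl⟩ := isConj_iff.1 h
    simp only [hχ, map_mul]
    rw [LinearMap.trace_mul_comm, ← mul_assoc, ← map_mul, inv_mul_cancel, map_one, one_mul]
  have hrec : ∀ w a, (1 - ((Finset.univ.filter fun i => w.SameCycle a i).card : ℚ) / (m + 1)) *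
      χ w = ((m + 2) / (m + 1)) * ∑ k ∈ Finset.univ.filter (fun i => ¬ w.SameCycle a i),
        χ (Equiv.swap a k * w) := by
    intro w a
    set C := Finset.univ.filter fun i => w.SameCycle a i with hC
    have hcomm : M.σ w * ∑ i ∈ C, M.Y i = (∑ i ∈ C, M.Y i) * M.σ w := by
      rw [Finset.mul_sum, Finset.sum_mul, Finset.sum_congr rfl fun i _ => M.σ_mul_Y w i]
      refine Finset.sum_equiv w (fun i => ?_) fun i _ => rfl
      simp [hC, Equiv.Perm.sameCycle_apply_right]
    have h0 : LinearMap.trace ℚ W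
        (((∑ i ∈ C, M.Y i) * M.X a - M.X a * ∑ i ∈ C, M.Y i) * M.σ w) = 0 := by
      rw [sub_mul, map_sub, sub_eq_zero, mul_assoc, LinearMap.trace_mul_comm, mul_assoc, hcomm,
        mul_assoc]
    rw [M.sum_Y_commutator_X C a (by simp [hC, Equiv.Perm.SameCycle.refl w a]), sub_mul,
      smul_mul_assoc, smul_mul_assoc, one_mul,
      Finset.sum_mul, map_sub, map_smul, map_smul, map_sum, sub_eq_zero] at h0
    simp only [← map_mul, hC, Finset.mem_filter, Finset.mem_univ, true_and, smul_eq_mul] at h0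
    push_cast at h0
    rw [add_assoc, one_add_one_eq_two] at h0
    exact h0
  have key := classFunction_eq_fixCount hconj hrec
  have h1 := key 1
  simp only [hχ, map_one, LinearMap.trace_one, fixCount_one] at h1
  have h2 := M.finrank_signPart
  have h3 : ((m : ℚ) + 2) * ∑ w, ((Equiv.Perm.sign w : ℤ) : ℚ) * χ w =
      (m + 1 + 1).factorial * χ (finRotate (m + 1)) := by
    rw [← sum_sign_mul_fixCount, Finset.mul_sum, Finset.sum_mul]
    refine Finset.sum_congr rfl fun w _ => ?_
    linear_combination ((Equiv.Perm.sign w : ℤ) : ℚ) * key w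
  have hfac : ((m + 1).factorial : ℚ) ≠ 0 := by positivity
  have hm : (m : ℚ) + 2 ≠ 0 := by positivity
  rw [← h2, Nat.factorial_succ (m + 1)] at h3
  push_cast at h3 h1
  have h4 : (Module.finrank ℚ M.signPart : ℚ) = χ (finRotate (m + 1)) := by
    apply mul_left_cancel₀ hfac
    apply mul_left_cancel₀ hm
    linear_combination h3
  have h5 : (Module.finrank ℚ W : ℚ) = (m + 2) ^ m * Module.finrank ℚ M.signPart := by
    apply mul_left_cancel₀ hm
    rw [h4]
    simp only [hχ]
    rw [h1]
    ring
  exact_mod_cast h5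

end CherednikModule

theorem exists_divDiff {n : ℕ} (i j : Fin n) :
    ∃ D : MvPolynomial (Fin n) ℚ →ₗ[ℚ] MvPolynomial (Fin n) ℚ,
      ∀ f, (X i - X j) * D f = f - rename (Equiv.swap i j) f := by
  rcases eq_or_ne i j with rfl | hij
  · exact ⟨0, fun f => by simp⟩
  have hdvd : ∀ f : MvPolynomial (Fin n) ℚ, (X i - X j) ∣ f - rename (Equiv.swap i j) f := by
    intro f
    induction f using MvPolynomial.induction_on with
    | C a => simp
    | add p q hp hq =>
      rw [map_add, add_sub_add_comm]
      exact dvd_add hp hq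
    | mul_X p k hp =>
      have h1 : (X i - X j : MvPolynomial (Fin n) ℚ) ∣ X k - X (Equiv.swap i j k) := by
        rcases eq_or_ne k i with rfl | hi
        · rw [Equiv.swap_apply_left]
        rcases eq_or_ne k j with rfl | hj
        · rw [Equiv.swap_apply_right, ← neg_sub]
          exact neg_dvd.2 dvd_rfl
        · rw [Equiv.swap_apply_of_ne_of_ne hi hj, sub_self]
          exact dvd_zero _
      rw [map_mul, rename_X, show p * X k - rename (Equiv.swap i j) p * X (Equiv.swap i j k) =
        (p - rename (Equiv.swap i j) p) * X k +
          rename (Equiv.swap i j) p * (X k - X (Equiv.swap i j k)) by ring]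
      exact dvd_add (hp.mul_right _) (h1.mul_left _)
  have hne : (X i - X j : MvPolynomial (Fin n) ℚ) ≠ 0 :=
    sub_ne_zero.2 fun h => hij (X_injective h)
  choose D hD using hdvd
  refine ⟨⟨⟨D, fun f g => mul_left_cancel₀ hne ?_⟩, fun r f => mul_left_cancel₀ hne ?_⟩,
    fun f => (hD f).symm⟩
  · rw [mul_add, ← hD, ← hD, ← hD, map_add]
    ring
  · dsimp only
    rw [RingHom.id_apply, mul_smul_comm, ← hD, ← hD, map_smul, smul_sub]

/-- The divided difference `(f - s_{ij} f) / (x_i - x_j)`. -/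
def divDiff {n : ℕ} (i j : Fin n) : MvPolynomial (Fin n) ℚ →ₗ[ℚ] MvPolynomial (Fin n) ℚ :=
  (exists_divDiff i j).choose

theorem X_sub_X_mul_divDiff {n : ℕ} (i j : Fin n) (f : MvPolynomial (Fin n) ℚ) :
    (X i - X j) * divDiff i j f = f - rename (Equiv.swap i j) f :=
  (exists_divDiff i j).choose_spec f

theorem X_sub_X_ne_zero {n : ℕ} {i j : Fin n} (hij : i ≠ j) :
    (X i - X j : MvPolynomial (Fin n) ℚ) ≠ 0 :=
  sub_ne_zero.2 fun h => hij (X_injective h)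

theorem divDiff_C {n : ℕ} {i j : Fin n} (hij : i ≠ j) (a : ℚ) : divDiff i j (C a) = 0 := by
  apply mul_left_cancel₀ (X_sub_X_ne_zero hij)
  rw [X_sub_X_mul_divDiff, rename_C, sub_self, mul_zero]

theorem divDiff_X_left_mul {n : ℕ} {i j : Fin n} (hij : i ≠ j) (f : MvPolynomial (Fin n) ℚ) :
    divDiff i j (X i * f) = X i * divDiff i j f + rename (Equiv.swap i j) f := by
  apply mul_left_cancel₀ (X_sub_X_ne_zero hij)
  rw [X_sub_X_mul_divDiff, map_mul, rename_X, Equiv.swap_apply_left]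
  linear_combination (-X i) * X_sub_X_mul_divDiff i j f

theorem divDiff_X_right_mul {n : ℕ} {i j : Fin n} (hij : i ≠ j) (f : MvPolynomial (Fin n) ℚ) :
    divDiff i j (X j * f) = X j * divDiff i j f - rename (Equiv.swap i j) f := by
  apply mul_left_cancel₀ (X_sub_X_ne_zero hij)
  rw [X_sub_X_mul_divDiff, map_mul, rename_X, Equiv.swap_apply_right]
  linear_combination (-X j) * X_sub_X_mul_divDiff i j f

theorem divDiff_X_mul {n : ℕ} {i j k : Fin n} (hij : i ≠ j) (hki : k ≠ i) (hkj : k ≠ j)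
    (f : MvPolynomial (Fin n) ℚ) : divDiff i j (X k * f) = X k * divDiff i j f := by
  apply mul_left_cancel₀ (X_sub_X_ne_zero hij)
  rw [X_sub_X_mul_divDiff, map_mul, rename_X, Equiv.swap_apply_of_ne_of_ne hki hkj]
  linear_combination (-X k) * X_sub_X_mul_divDiff i j f

/-- The Dunkl operator with parameter `c`. -/
def dunkl {n : ℕ} (c : ℚ) (i : Fin n) : Module.End ℚ (MvPolynomial (Fin n) ℚ) :=
  (pderiv i).toLinearMap - c • ∑ j ∈ Finset.univ.erase i, divDiff i j

theorem dunkl_apply {n : ℕ} (c : ℚ) (i : Fin n) (f : MvPolynomial (Fin n) ℚ) :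
    dunkl c i f = pderiv i f - c • ∑ j ∈ Finset.univ.erase i, divDiff i j f := by
  simp [dunkl]

theorem dunkl_C {n : ℕ} (c : ℚ) (i : Fin n) (a : ℚ) : dunkl c i (C a) = 0 := by
  rw [dunkl_apply, pderiv_C, Finset.sum_eq_zero, smul_zero, sub_zero]
  exact fun j hj => divDiff_C (Finset.ne_of_mem_erase hj).symm a

theorem dunkl_X_self_mul {n : ℕ} (c : ℚ) (i : Fin n) (f : MvPolynomial (Fin n) ℚ) :
    dunkl c i (X i * f) = X i * dunkl c i f + f -
      c • ∑ j ∈ Finset.univ.erase i, rename (Equiv.swap i j) f := by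
  rw [dunkl_apply, dunkl_apply, Derivation.leibniz, pderiv_X_self,
    Finset.sum_congr rfl fun j hj => divDiff_X_left_mul (Finset.ne_of_mem_erase hj).symm f,
    Finset.sum_add_distrib, ← Finset.mul_sum, smul_eq_mul, smul_eq_mul, smul_add, mul_sub,
    mul_smul_comm]
  ring

theorem dunkl_X_mul {n : ℕ} (c : ℚ) {i j : Fin n} (hij : i ≠ j) (f : MvPolynomial (Fin n) ℚ) :
    dunkl c i (X j * f) = X j * dunkl c i f + c • rename (Equiv.swap i j) f := by
  have h : ∀ k ∈ (Finset.univ.erase i).erase j, divDiff i k (X j * f) = X j * divDiff i k f :=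
    fun k hk => by
      rw [Finset.mem_erase, Finset.mem_erase] at hk
      exact divDiff_X_mul hk.2.1.symm hij.symm hk.1.symm f
  have hj : j ∈ Finset.univ.erase i := Finset.mem_erase.2 ⟨hij.symm, Finset.mem_univ _⟩
  rw [dunkl_apply, dunkl_apply, Derivation.leibniz, pderiv_X_of_ne hij.symm,
    ← Finset.add_sum_erase _ _ hj, ← Finset.add_sum_erase _ _ hj, Finset.sum_congr rfl h,
    divDiff_X_right_mul hij, ← Finset.mul_sum, smul_eq_mul, smul_zero, add_zero]
  simp only [smul_eq_C_mul]
  ring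

theorem rename_mul_swap {n : ℕ} (w : Equiv.Perm (Fin n)) (i j : Fin n)
    (f : MvPolynomial (Fin n) ℚ) :
    rename w (rename (Equiv.swap i j) f) = rename (Equiv.swap (w i) (w j)) (rename w f) := by
  rw [rename_rename, rename_rename]
  congr 1
  exact congrArg _ (funext fun k =>
    congrArg (fun g : Equiv.Perm (Fin n) => g k) (Equiv.mul_swap_eq_swap_mul w i j))

theorem rename_dunkl {n : ℕ} (c : ℚ) (w : Equiv.Perm (Fin n)) (i : Fin n)
    (f : MvPolynomial (Fin n) ℚ) :
    rename w (dunkl c i f) = dunkl c (w i) (rename w f) := by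
  induction f using MvPolynomial.induction_on with
  | C a => rw [dunkl_C, rename_C, dunkl_C, map_zero]
  | add p q hp hq => simp only [map_add, hp, hq]
  | mul_X p k hp =>
    rw [mul_comm p, map_mul (rename w), rename_X]
    rcases eq_or_ne i k with rfl | hik
    · rw [dunkl_X_self_mul, dunkl_X_self_mul, map_sub, map_add, map_mul, rename_X, hp, map_smul,
        map_sum, Finset.sum_congr rfl fun j _ => rename_mul_swap w i j p]
      congr 2
      refine Finset.sum_equiv w (fun j => ?_) fun j _ => rfl
      simp
    · rw [dunkl_X_mul c hik, dunkl_X_mul c (w.injective.ne hik), map_add, map_mul, rename_X, hp,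
        map_smul, rename_mul_swap]

theorem sum_dunkl {n : ℕ} (c : ℚ) (f : MvPolynomial (Fin n) ℚ) :
    ∑ i, dunkl c i f = ∑ i, pderiv i f := by
  induction f using MvPolynomial.induction_on with
  | C a => simp [dunkl_C]
  | add p q hp hq => simp only [map_add, Finset.sum_add_distrib, hp, hq]
  | mul_X p k hp =>
    have hk := Finset.mem_univ k
    have h1 : ∀ i ∈ Finset.univ.erase k, dunkl c i (X k * p) =
        X k * dunkl c i p + c • rename (Equiv.swap k i) p := fun i hi => by
      rw [dunkl_X_mul c (Finset.ne_of_mem_erase hi), Equiv.swap_comm]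
    have h2 : ∀ i ∈ Finset.univ.erase k, pderiv i (X k * p) = X k * pderiv i p := fun i hi => by
      rw [Derivation.leibniz, pderiv_X_of_ne (Finset.ne_of_mem_erase hi).symm, smul_eq_mul,
        smul_zero, add_zero]
    rw [mul_comm p, ← Finset.add_sum_erase _ _ hk, Finset.sum_congr rfl h1, dunkl_X_self_mul,
      ← Finset.add_sum_erase _ _ hk, Finset.sum_congr rfl h2, Derivation.leibniz, pderiv_X_self,
      Finset.sum_add_distrib, ← Finset.mul_sum, ← Finset.mul_sum, ← Finset.smul_sum]
    rw [← Finset.add_sum_erase _ _ hk, ← Finset.add_sum_erase _ _ hk] at hp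
    rw [smul_eq_mul, smul_eq_mul]
    linear_combination (X k : MvPolynomial (Fin n) ℚ) * hp

theorem dunkl_swap_of_ne {n : ℕ} (c : ℚ) {i j k : Fin n} (hji : i ≠ j) (hki : i ≠ k)
    (f : MvPolynomial (Fin n) ℚ) :
    dunkl c i (rename (Equiv.swap j k) f) = rename (Equiv.swap j k) (dunkl c i f) := by
  rw [rename_dunkl, Equiv.swap_apply_of_ne_of_ne hji hki]

theorem dunkl_comm_X_self {n : ℕ} (c : ℚ) {i j : Fin n} (hij : i ≠ j)
    {f : MvPolynomial (Fin n) ℚ} (hf : dunkl c i (dunkl c j f) = dunkl c j (dunkl c i f)) :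
    dunkl c i (dunkl c j (X i * f)) = dunkl c j (dunkl c i (X i * f)) := by
  have hj : j ∈ Finset.univ.erase i := Finset.mem_erase.2 ⟨hij.symm, Finset.mem_univ _⟩
  have h : ∀ k ∈ (Finset.univ.erase i).erase j, dunkl c j (rename (Equiv.swap i k) f) =
      rename (Equiv.swap i k) (dunkl c j f) := fun k hk => by
    rw [Finset.mem_erase, Finset.mem_erase] at hk
    exact dunkl_swap_of_ne c hij.symm hk.1.symm f
  have h1 : dunkl c j (rename (Equiv.swap i j) f) = rename (Equiv.swap i j) (dunkl c i f) := by
    rw [rename_dunkl, Equiv.swap_apply_left]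
  have h2 : dunkl c i (rename (Equiv.swap i j) f) = rename (Equiv.swap i j) (dunkl c j f) := by
    rw [rename_dunkl, Equiv.swap_apply_right]
  rw [dunkl_X_mul c hij.symm, dunkl_X_self_mul, map_add, map_sub, map_add, dunkl_X_self_mul,
    dunkl_X_mul c hij.symm, map_smul, map_smul, map_sum, ← Finset.add_sum_erase _ _ hj,
    ← Finset.add_sum_erase _ _ hj, Finset.sum_congr rfl h, Equiv.swap_comm j i, h1, h2, hf]
  module

theorem dunkl_comm {n : ℕ} (c : ℚ) (i j : Fin n) (f : MvPolynomial (Fin n) ℚ) :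
    dunkl c i (dunkl c j f) = dunkl c j (dunkl c i f) := by
  rcases eq_or_ne i j with rfl | hij
  · rfl
  induction f using MvPolynomial.induction_on with
  | C a => simp only [dunkl_C, map_zero]
  | add p q hp hq => simp only [map_add, hp, hq]
  | mul_X p k hp =>
    rw [mul_comm p]
    rcases eq_or_ne i k with rfl | hik
    · exact dunkl_comm_X_self c hij hp
    rcases eq_or_ne j k with rfl | hjk
    · exact (dunkl_comm_X_self c hij.symm hp.symm).symm
    · rw [dunkl_X_mul c hik, dunkl_X_mul c hjk, map_add, map_add, dunkl_X_mul c hik,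
        dunkl_X_mul c hjk, map_smul, map_smul, dunkl_swap_of_ne c hij hik,
        dunkl_swap_of_ne c hij.symm hjk, hp]
      module

theorem sum_dunkl_X_mul {n : ℕ} (c : ℚ) (j : Fin n) (f : MvPolynomial (Fin n) ℚ) :
    ∑ i, dunkl c i (X j * f) = X j * ∑ i, dunkl c i f + f := by
  have hj := Finset.mem_univ j
  rw [sum_dunkl, sum_dunkl]
  simp only [Derivation.leibniz, smul_eq_mul, pderiv_X, Pi.single_apply, mul_ite, mul_one,
    mul_zero, Finset.sum_add_distrib, ← Finset.mul_sum]
  simp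

/-- The symmetric group acting on polynomials by permuting the variables. -/
def permRename (n : ℕ) : Equiv.Perm (Fin n) →* Module.End ℚ (MvPolynomial (Fin n) ℚ) where
  toFun w := (rename w).toLinearMap
  map_one' := LinearMap.ext fun f => by simp
  map_mul' w w' := LinearMap.ext fun f => by simp [rename_rename, Equiv.Perm.coe_mul]

theorem permRename_apply {n : ℕ} (w : Equiv.Perm (Fin n)) (f : MvPolynomial (Fin n) ℚ) :
    permRename n w f = rename w f := rfl

/-- The Dunkl operator projected to the hyperplane of sum zero. -/
def reducedDunkl {n : ℕ} (c : ℚ) (i : Fin n) : Module.End ℚ (MvPolynomial (Fin n) ℚ) :=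
  dunkl c i - ((1 : ℚ) / n) • ∑ k, dunkl c k

theorem reducedDunkl_apply {n : ℕ} (c : ℚ) (i : Fin n) (f : MvPolynomial (Fin n) ℚ) :
    reducedDunkl c i f = dunkl c i f - ((1 : ℚ) / n) • ∑ k, dunkl c k f := by
  simp only [reducedDunkl, LinearMap.sub_apply, LinearMap.smul_apply, LinearMap.sum_apply]

theorem reducedDunkl_X_mul {n : ℕ} (c : ℚ) {i j : Fin n} (hij : i ≠ j)
    (f : MvPolynomial (Fin n) ℚ) :
    reducedDunkl c i (X j * f) = X j * reducedDunkl c i f + c • rename (Equiv.swap i j) f -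
      ((1 : ℚ) / n) • f := by
  rw [reducedDunkl_apply, reducedDunkl_apply, sum_dunkl_X_mul, dunkl_X_mul c hij]
  simp only [smul_eq_C_mul]
  ring

theorem reducedDunkl_X_self_mul {n : ℕ} (c : ℚ) (i : Fin n) (f : MvPolynomial (Fin n) ℚ) :
    reducedDunkl c i (X i * f) = X i * reducedDunkl c i f + (1 - (1 : ℚ) / n) • f -
      c • ∑ j ∈ Finset.univ.erase i, rename (Equiv.swap i j) f := by
  rw [reducedDunkl_apply, reducedDunkl_apply, sum_dunkl_X_mul, dunkl_X_self_mul]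
  simp only [smul_eq_C_mul, map_sub, map_one]
  ring

theorem rename_reducedDunkl {n : ℕ} (c : ℚ) (w : Equiv.Perm (Fin n)) (i : Fin n)
    (f : MvPolynomial (Fin n) ℚ) :
    rename w (reducedDunkl c i f) = reducedDunkl c (w i) (rename w f) := by
  rw [reducedDunkl_apply, reducedDunkl_apply, map_sub, map_smul, map_sum, rename_dunkl,
    Finset.sum_congr rfl fun k _ => rename_dunkl c w k f,
    Equiv.sum_comp w fun k => dunkl c k (rename w f)]

theorem reducedDunkl_comm {n : ℕ} (c : ℚ) (i j : Fin n) :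
    reducedDunkl c i * reducedDunkl c j = reducedDunkl c j * reducedDunkl c i := by
  have h : ∀ i j : Fin n, Commute (dunkl c i) (dunkl c j) := fun i j =>
    LinearMap.ext fun f => dunkl_comm c i j f
  have h2 : ∀ i : Fin n, Commute (dunkl c i) (((1 : ℚ) / n) • ∑ k : Fin n, dunkl c k) := fun i =>
    (Commute.sum_right _ _ _ fun k _ => h i k).smul_right _
  exact ((h i j).sub_right (h2 i)).sub_left (((h2 j).symm).sub_right (Commute.refl _))

theorem reducedDunkl_mul_mulLeft_sub {n : ℕ} (c : ℚ) {i j : Fin n} (hij : i ≠ j) :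
    reducedDunkl c i * LinearMap.mulLeft ℚ (X j) - LinearMap.mulLeft ℚ (X j) * reducedDunkl c i =
      c • permRename n (Equiv.swap i j) - ((1 : ℚ) / n) • 1 := LinearMap.ext fun f => by
  change reducedDunkl c i (X j * f) - X j * reducedDunkl c i f =
    c • rename (Equiv.swap i j) f - ((1 : ℚ) / n) • f
  rw [reducedDunkl_X_mul c hij]
  abel

theorem reducedDunkl_mul_mulLeft_self_sub {n : ℕ} (c : ℚ) (i : Fin n) :
    reducedDunkl c i * LinearMap.mulLeft ℚ (X i) - LinearMap.mulLeft ℚ (X i) * reducedDunkl c i =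
      (1 - (1 : ℚ) / n) • 1 - c • ∑ k ∈ Finset.univ.erase i, permRename n (Equiv.swap i k) :=
  LinearMap.ext fun f => by
    rw [LinearMap.sub_apply, LinearMap.sub_apply, LinearMap.smul_apply, LinearMap.smul_apply,
      LinearMap.sum_apply, Module.End.mul_apply, Module.End.mul_apply, LinearMap.mulLeft_apply,
      LinearMap.mulLeft_apply, Module.End.one_apply,
      Finset.sum_congr rfl fun k _ => permRename_apply (Equiv.swap i k) f]
    rw [reducedDunkl_X_self_mul c i, add_sub_assoc, add_sub_cancel_left]

theorem mulLeft_X_comm {n : ℕ} (i j : Fin n) :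
    LinearMap.mulLeft ℚ (X i : MvPolynomial (Fin n) ℚ) * LinearMap.mulLeft ℚ (X j) =
      LinearMap.mulLeft ℚ (X j) * LinearMap.mulLeft ℚ (X i) := by
  rw [Module.End.mul_eq_comp, Module.End.mul_eq_comp, ← LinearMap.mulLeft_mul,
    ← LinearMap.mulLeft_mul, mul_comm]

theorem permRename_mul_reducedDunkl {n : ℕ} (c : ℚ) (w : Equiv.Perm (Fin n)) (i : Fin n) :
    permRename n w * reducedDunkl c i = reducedDunkl c (w i) * permRename n w :=
  LinearMap.ext fun f => by
    rw [Module.End.mul_apply, Module.End.mul_apply, permRename_apply, permRename_apply,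
      rename_reducedDunkl]

namespace CherednikModule

/-- The polynomial representation, in which `Y` acts by reduced Dunkl operators. -/
def polynomial (n : ℕ) : CherednikModule n (MvPolynomial (Fin n) ℚ) where
  X i := LinearMap.mulLeft ℚ (MvPolynomial.X i)
  Y i := reducedDunkl (((n : ℚ) + 1) / n) i
  σ := permRename n
  σ_mul_X w i := LinearMap.ext fun f => by simp [permRename_apply]
  σ_mul_Y w i := permRename_mul_reducedDunkl _ w i
  X_comm i j := mulLeft_X_comm i j
  Y_comm := reducedDunkl_comm _
  YX_ne _ _ hij := reducedDunkl_mul_mulLeft_sub _ hij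
  YX_self i := reducedDunkl_mul_mulLeft_self_sub _ i

variable {n : ℕ} {W : Type*} [AddCommGroup W] [Module ℚ W] (M : CherednikModule n W)

theorem exists_quotient {W' : Type*} [AddCommGroup W'] [Module ℚ W'] (π : W →ₗ[ℚ] W')
    (hπ : Function.Surjective π) (hX : ∀ i v, π v = 0 → π (M.X i v) = 0)
    (hY : ∀ i v, π v = 0 → π (M.Y i v) = 0) (hσ : ∀ w v, π v = 0 → π (M.σ w v) = 0) :
    ∃ M' : CherednikModule n W', (∀ i v, M'.X i (π v) = π (M.X i v)) ∧
      (∀ i v, M'.Y i (π v) = π (M.Y i v)) ∧ ∀ w v, M'.σ w (π v) = π (M.σ w v) := by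
  have key : ∀ f : Module.End ℚ W, (∀ v, π v = 0 → π (f v) = 0) →
      ∃ g : Module.End ℚ W', ∀ v, g (π v) = π (f v) := by
    intro f hf
    obtain ⟨s, hs⟩ := π.exists_rightInverse_of_surjective (LinearMap.range_eq_top.2 hπ)
    refine ⟨π ∘ₗ f ∘ₗ s, fun v => ?_⟩
    have h := hf (s (π v) - v) (by
      rw [map_sub, sub_eq_zero]
      exact LinearMap.congr_fun hs (π v))
    rwa [map_sub, map_sub, sub_eq_zero] at h
  choose X' hX' using fun i => key (M.X i) (hX i)
  choose Y' hY' using fun i => key (M.Y i) (hY i)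
  choose σ' hσ' using fun w => key (M.σ w) (hσ w)
  have hext : ∀ {f g : Module.End ℚ W'}, (∀ v, f (π v) = g (π v)) → f = g := fun h =>
    LinearMap.ext fun u => by
      obtain ⟨v, rfl⟩ := hπ u
      exact h v
  refine ⟨⟨X', Y', ⟨⟨σ', hext fun v => ?_⟩, fun w w' => hext fun v => ?_⟩,
    fun w i => hext fun v => ?_,
    fun w i => hext fun v => ?_, fun i j => hext fun v => ?_, fun i j => hext fun v => ?_,
    fun i j hij => hext fun v => ?_, fun i => hext fun v => ?_⟩, hX', hY', hσ'⟩
  · simp [hσ']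
  · simp [hσ']
  · simpa [hσ', hX'] using congrArg π (LinearMap.congr_fun (M.σ_mul_X w i) v)
  · simpa [hσ', hY'] using congrArg π (LinearMap.congr_fun (M.σ_mul_Y w i) v)
  · simpa [hX'] using congrArg π (LinearMap.congr_fun (M.X_comm i j) v)
  · simpa [hY'] using congrArg π (LinearMap.congr_fun (M.Y_comm i j) v)
  · simpa [hσ', hX', hY', -one_div] using congrArg π (LinearMap.congr_fun (M.YX_ne i j hij) v)
  · simpa [hσ', hX', hY', -one_div] using congrArg π (LinearMap.congr_fun (M.YX_self i) v)

theorem exists_restrict (N : Submodule ℚ W) (hX : ∀ i, ∀ v ∈ N, M.X i v ∈ N)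
    (hY : ∀ i, ∀ v ∈ N, M.Y i v ∈ N) (hσ : ∀ w, ∀ v ∈ N, M.σ w v ∈ N) :
    ∃ M' : CherednikModule n N, (∀ i v, (M'.X i v : W) = M.X i v) ∧
      (∀ i v, (M'.Y i v : W) = M.Y i v) ∧ ∀ w v, (M'.σ w v : W) = M.σ w v := by
  refine ⟨⟨fun i => (M.X i).restrict (hX i), fun i => (M.Y i).restrict (hY i),
    ⟨⟨fun w => (M.σ w).restrict (hσ w), LinearMap.ext fun v => Subtype.ext ?_⟩,
      fun w w' => LinearMap.ext fun v => Subtype.ext ?_⟩,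
    fun w i => LinearMap.ext fun v => Subtype.ext ?_,
    fun w i => LinearMap.ext fun v => Subtype.ext ?_,
    fun i j => LinearMap.ext fun v => Subtype.ext ?_,
    fun i j => LinearMap.ext fun v => Subtype.ext ?_,
    fun i j hij => LinearMap.ext fun v => Subtype.ext ?_,
    fun i => LinearMap.ext fun v => Subtype.ext ?_⟩, fun _ _ => rfl, fun _ _ => rfl,
    fun _ _ => rfl⟩
  · simp
  · simp
  · simpa using LinearMap.congr_fun (M.σ_mul_X w i) v
  · simpa using LinearMap.congr_fun (M.σ_mul_Y w i) v
  · simpa using LinearMap.congr_fun (M.X_comm i j) v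
  · simpa using LinearMap.congr_fun (M.Y_comm i j) v
  · simpa [-one_div] using LinearMap.congr_fun (M.YX_ne i j hij) v
  · simpa [-one_div] using LinearMap.congr_fun (M.YX_self i) v

end CherednikModule

/-- The coefficients of the binomial series `(1 - z) ^ c`. -/
def oneSubCoeff (c : ℚ) (m : ℕ) : ℚ := (-1) ^ m * Ring.choose c m

theorem oneSubCoeff_zero (c : ℚ) : oneSubCoeff c 0 = 1 := by
  simp [oneSubCoeff]

theorem succ_mul_oneSubCoeff_succ (c : ℚ) (m : ℕ) :
    ((m : ℚ) + 1) * oneSubCoeff c (m + 1) = (m - c) * oneSubCoeff c m := by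
  rw [oneSubCoeff, oneSubCoeff, Ring.choose_eq_smul, Ring.choose_eq_smul,
    descPochhammer_succ_right, Polynomial.smeval_mul, Polynomial.smeval_sub, Polynomial.smeval_X,
    Polynomial.smeval_natCast, Nat.factorial_succ]
  have h : ((m.factorial : ℕ) : ℚ) ≠ 0 := by positivity
  have h' : (m : ℚ) + 1 ≠ 0 := by positivity
  push_cast
  simp only [pow_one, pow_zero, nsmul_eq_mul, mul_one, smul_eq_mul]
  field_simp
  ring

/-- The power series `(1 - u z) ^ c`. -/
def binPow {A : Type*} [CommRing A] [Algebra ℚ A] (c : ℚ) (u : A) : PowerSeries A :=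
  PowerSeries.mk fun m => u ^ m * algebraMap ℚ A (oneSubCoeff c m)

/-- The geometric series `1 / (1 - u z)`. -/
def geomSeries {A : Type*} [CommRing A] (u : A) : PowerSeries A := PowerSeries.mk fun m => u ^ m

theorem binPow_pow {A : Type*} [CommRing A] [Algebra ℚ A] {c : ℚ} {n k : ℕ} (h : n * c = k)
    (u : A) : binPow c u ^ n = (1 - PowerSeries.C u * PowerSeries.X) ^ k := by
  have h1 : binPow c u = PowerSeries.rescale u (PowerSeries.map (algebraMap ℚ A)
      (PowerSeries.rescale (-1) (PowerSeries.binomialSeries ℚ c))) := by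
    ext m
    simp [binPow, oneSubCoeff]
  have h2 : ∀ n : ℕ, PowerSeries.binomialSeries ℚ c ^ n =
      PowerSeries.binomialSeries ℚ ((n : ℚ) * c) := fun n => by
    induction n with
    | zero => simp
    | succ n ih =>
      rw [pow_succ, ih, ← PowerSeries.binomialSeries_add]
      push_cast
      congr 1
      ring
  rw [h1, ← map_pow, ← map_pow, ← map_pow, h2, h, PowerSeries.binomialSeries_nat]
  simp [PowerSeries.rescale_X, sub_eq_add_neg]

theorem one_sub_mul_geomSeries {A : Type*} [CommRing A] (u : A) :
    (1 - PowerSeries.C u * PowerSeries.X) * geomSeries u = 1 := by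
  ext m
  rw [sub_mul, one_mul, mul_assoc, map_sub, PowerSeries.coeff_C_mul]
  cases m with
  | zero => simp [geomSeries]
  | succ m =>
    rw [PowerSeries.coeff_succ_X_mul, geomSeries, PowerSeries.coeff_mk, PowerSeries.coeff_mk,
      pow_succ', sub_self, PowerSeries.coeff_one, if_neg m.succ_ne_zero]

/-- The generating series `∏ j, (1 - u j z) ^ c / (1 - u i z)`. -/
def singularSeries {A ι : Type*} [CommRing A] [Algebra ℚ A] [Fintype ι] (c : ℚ) (u : ι → A)
    (i : ι) : PowerSeries A := (∏ j, binPow c (u j)) * geomSeries (u i)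

theorem one_sub_mul_singularSeries {A ι : Type*} [CommRing A] [Algebra ℚ A] [Fintype ι] (c : ℚ)
    (u : ι → A) (i : ι) : (1 - PowerSeries.C (u i) * PowerSeries.X) * singularSeries c u i =
      ∏ j, binPow c (u j) := by
  rw [singularSeries, mul_left_comm, one_sub_mul_geomSeries, mul_one]

theorem map_singularSeries {A B ι : Type*} [CommRing A] [Algebra ℚ A] [CommRing B] [Algebra ℚ B]
    [Fintype ι] (φ : A →ₐ[ℚ] B) (c : ℚ) (u : ι → A) (i : ι) :
    PowerSeries.map (φ : A →+* B) (singularSeries c u i) = singularSeries c (φ ∘ u) i := by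
  have h1 : ∀ u : A, PowerSeries.map (φ : A →+* B) (binPow c u) = binPow c (φ u) := fun u => by
    ext m
    simp [binPow]
  have h2 : ∀ u : A, PowerSeries.map (φ : A →+* B) (geomSeries u) = geomSeries (φ u) := fun u => by
    ext m
    simp [geomSeries]
  rw [singularSeries, map_mul, map_prod, Finset.prod_congr rfl fun j _ => h1 (u j), h2]
  rfl

theorem constantCoeff_singularSeries {A ι : Type*} [CommRing A] [Algebra ℚ A] [Fintype ι] (c : ℚ)
    (u : ι → A) (i : ι) : PowerSeries.constantCoeff (singularSeries c u i) = 1 := by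
  have h1 : ∀ u : A, PowerSeries.constantCoeff (binPow c u) = 1 := fun u => by
    rw [← PowerSeries.coeff_zero_eq_constantCoeff_apply, binPow, PowerSeries.coeff_mk,
      oneSubCoeff_zero, map_one, pow_zero, mul_one]
  have h2 : ∀ u : A, PowerSeries.constantCoeff (geomSeries u) = 1 := fun u => by
    rw [← PowerSeries.coeff_zero_eq_constantCoeff_apply, geomSeries, PowerSeries.coeff_mk, pow_zero]
  rw [singularSeries, map_mul, map_prod, Finset.prod_congr rfl fun j _ => h1 (u j), h2]
  simp

/-- Partial differentiation applied to the coefficients of a power series. -/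
def coeffPderiv {n : ℕ} (j : Fin n) (f : PowerSeries (MvPolynomial (Fin n) ℚ)) :
    PowerSeries (MvPolynomial (Fin n) ℚ) :=
  PowerSeries.mk fun m => pderiv j (PowerSeries.coeff m f)

theorem coeffPderiv_mul {n : ℕ} (j : Fin n) (f g : PowerSeries (MvPolynomial (Fin n) ℚ)) :
    coeffPderiv j (f * g) = coeffPderiv j f * g + f * coeffPderiv j g := by
  ext1 m
  rw [coeffPderiv, PowerSeries.coeff_mk, map_add, PowerSeries.coeff_mul, PowerSeries.coeff_mul,
    PowerSeries.coeff_mul, map_sum, ← Finset.sum_add_distrib]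
  refine Finset.sum_congr rfl fun p _ => ?_
  rw [coeffPderiv, coeffPderiv, PowerSeries.coeff_mk, PowerSeries.coeff_mk, Derivation.leibniz,
    smul_eq_mul, smul_eq_mul]
  ring

theorem coeffPderiv_prod_eq_zero {n : ℕ} {j : Fin n} {ι : Type*} (s : Finset ι)
    (f : ι → PowerSeries (MvPolynomial (Fin n) ℚ)) (h : ∀ k ∈ s, coeffPderiv j (f k) = 0) :
    coeffPderiv j (∏ k ∈ s, f k) = 0 := by
  classical
  induction s using Finset.induction_on with
  | empty =>
    ext1 m
    rw [Finset.prod_empty, coeffPderiv, PowerSeries.coeff_mk, PowerSeries.coeff_one]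
    split_ifs <;> simp
  | insert a s ha ih =>
    rw [Finset.prod_insert ha, coeffPderiv_mul, h a (Finset.mem_insert_self a s),
      ih fun k hk => h k (Finset.mem_insert_of_mem hk), zero_mul, mul_zero, add_zero]

theorem coeffPderiv_binPow_of_ne {n : ℕ} {j k : Fin n} (hjk : j ≠ k) (c : ℚ) :
    coeffPderiv j (binPow c (X k)) = 0 := by
  ext1 m
  rw [coeffPderiv, PowerSeries.coeff_mk, binPow, PowerSeries.coeff_mk, Derivation.leibniz,
    Derivation.leibniz_pow, pderiv_X_of_ne hjk.symm, algebraMap_eq, pderiv_C]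
  simp

theorem coeffPderiv_geomSeries_of_ne {n : ℕ} {j k : Fin n} (hjk : j ≠ k) :
    coeffPderiv j (geomSeries (X k)) = 0 := by
  ext1 m
  rw [coeffPderiv, PowerSeries.coeff_mk, geomSeries, PowerSeries.coeff_mk,
    Derivation.leibniz_pow, pderiv_X_of_ne hjk.symm]
  simp

theorem one_sub_mul_coeffPderiv_binPow {n : ℕ} (j : Fin n) (c : ℚ) :
    (1 - PowerSeries.C (X j) * PowerSeries.X) * coeffPderiv j (binPow c (X j)) =
      -(PowerSeries.C (C c) * PowerSeries.X * binPow c (X j)) := by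
  have h : ∀ m, PowerSeries.coeff m (coeffPderiv j (binPow c (X j))) =
      (m : MvPolynomial (Fin n) ℚ) * X j ^ (m - 1) * C (oneSubCoeff c m) := fun m => by
    rw [coeffPderiv, PowerSeries.coeff_mk, binPow, PowerSeries.coeff_mk, Derivation.leibniz,
      Derivation.leibniz_pow, pderiv_X_self, algebraMap_eq, pderiv_C, smul_zero, zero_add]
    simp only [nsmul_eq_mul, smul_eq_mul, mul_one]
    ring
  ext1 m
  rw [sub_mul, one_mul, map_sub, map_neg, mul_assoc, mul_assoc, PowerSeries.coeff_C_mul,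
    PowerSeries.coeff_C_mul]
  cases m with
  | zero => simp [h]
  | succ m =>
    rw [PowerSeries.coeff_succ_X_mul, PowerSeries.coeff_succ_X_mul, h, h, binPow,
      PowerSeries.coeff_mk, algebraMap_eq]
    have hrec := congrArg (C (σ := Fin n)) (succ_mul_oneSubCoeff_succ c m)
    simp only [map_mul, map_add, map_sub, map_natCast, map_one] at hrec
    have hm : (X j : MvPolynomial (Fin n) ℚ) * ((m : MvPolynomial (Fin n) ℚ) * X j ^ (m - 1)) =
        (m : MvPolynomial (Fin n) ℚ) * X j ^ m := by
      cases m with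
      | zero => simp
      | succ m =>
        rw [Nat.add_sub_cancel]
        ring
    push_cast
    linear_combination X j ^ m * hrec - C (oneSubCoeff c m) * hm

theorem one_sub_mul_coeffPderiv_geomSeries {n : ℕ} (j : Fin n) :
    (1 - PowerSeries.C (X j) * PowerSeries.X) * coeffPderiv j (geomSeries (X j)) =
      PowerSeries.X * geomSeries (X j) := by
  have h := congrArg (coeffPderiv j) (one_sub_mul_geomSeries (X j : MvPolynomial (Fin n) ℚ))
  have h1 : coeffPderiv j (1 : PowerSeries (MvPolynomial (Fin n) ℚ)) = 0 := by
    simpa using coeffPderiv_prod_eq_zero (j := j) (∅ : Finset ℕ) (fun _ => 0) (by simp)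
  have h2 : coeffPderiv j (1 - PowerSeries.C (X j) * PowerSeries.X :
      PowerSeries (MvPolynomial (Fin n) ℚ)) = -PowerSeries.X := by
    ext1 m
    rw [coeffPderiv, PowerSeries.coeff_mk, map_sub, PowerSeries.coeff_C_mul, PowerSeries.coeff_X,
      PowerSeries.coeff_one, map_neg, PowerSeries.coeff_X]
    split_ifs <;> simp
  rw [coeffPderiv_mul, h1, h2] at h
  linear_combination h

theorem one_sub_mul_coeffPderiv_singularSeries {n : ℕ} (c : ℚ) (i j : Fin n) :
    (1 - PowerSeries.C (X j) * PowerSeries.X) * coeffPderiv j (singularSeries c X i) =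
      PowerSeries.C (C ((if j = i then 1 else 0) - c)) *
        (PowerSeries.X * singularSeries c X i) := by
  have hF : (1 - PowerSeries.C (X j) * PowerSeries.X) *
      coeffPderiv j (∏ k : Fin n, binPow c (X k : MvPolynomial (Fin n) ℚ)) =
      -(PowerSeries.C (C c) * PowerSeries.X *
        ∏ k : Fin n, binPow c (X k : MvPolynomial (Fin n) ℚ)) := by
    rw [← Finset.mul_prod_erase _ _ (Finset.mem_univ j), coeffPderiv_mul,
      coeffPderiv_prod_eq_zero (j := j) (Finset.univ.erase j) _ fun k hk =>
        coeffPderiv_binPow_of_ne (Finset.ne_of_mem_erase hk).symm c, mul_zero, add_zero,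
      ← mul_assoc, one_sub_mul_coeffPderiv_binPow]
    ring
  rw [singularSeries, coeffPderiv_mul, mul_add, ← mul_assoc, hF]
  split_ifs with hji
  · subst hji
    rw [mul_left_comm, one_sub_mul_coeffPderiv_geomSeries]
    simp only [map_sub, map_one]
    ring
  · rw [coeffPderiv_geomSeries_of_ne hji]
    simp only [map_sub, map_zero]
    ring

theorem rename_coeff_singularSeries {n : ℕ} (c : ℚ) (w : Equiv.Perm (Fin n)) (i : Fin n) (m : ℕ) :
    rename w (PowerSeries.coeff m (singularSeries c X i)) =
      PowerSeries.coeff m (singularSeries c (X : Fin n → MvPolynomial (Fin n) ℚ) (w i)) := by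
  have h := congrArg (PowerSeries.coeff m) (map_singularSeries (rename w) c
    (X : Fin n → MvPolynomial (Fin n) ℚ) i)
  rw [PowerSeries.coeff_map] at h
  refine h.trans ?_
  have h1 : (rename w ∘ X : Fin n → MvPolynomial (Fin n) ℚ) = fun k => X (w k) :=
    funext fun k => rename_X _ _
  rw [h1, singularSeries, singularSeries,
    Equiv.prod_comp w fun k => binPow c (X k : MvPolynomial (Fin n) ℚ)]

theorem isHomogeneous_coeff_mul {n : ℕ} {f g : PowerSeries (MvPolynomial (Fin n) ℚ)}
    (hf : ∀ m, (PowerSeries.coeff m f).IsHomogeneous m)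
    (hg : ∀ m, (PowerSeries.coeff m g).IsHomogeneous m) (m : ℕ) :
    (PowerSeries.coeff m (f * g)).IsHomogeneous m := by
  rw [PowerSeries.coeff_mul]
  refine IsHomogeneous.sum _ _ _ fun p hp => ?_
  rw [← Finset.HasAntidiagonal.mem_antidiagonal.1 hp]
  exact (hf p.1).mul (hg p.2)

theorem isHomogeneous_coeff_singularSeries {n : ℕ} (c : ℚ) (i : Fin n) (m : ℕ) :
    (PowerSeries.coeff m (singularSeries c (X : Fin n → MvPolynomial (Fin n) ℚ) i)).IsHomogeneous
      m := by
  have hX : ∀ (j : Fin n) (m : ℕ), (X j ^ m : MvPolynomial (Fin n) ℚ).IsHomogeneous m :=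
    fun j m => by simpa using (isHomogeneous_X ℚ j).pow m
  have hprod : ∀ (s : Finset (Fin n)) (m : ℕ), (PowerSeries.coeff m
      (∏ j ∈ s, binPow c (X j : MvPolynomial (Fin n) ℚ))).IsHomogeneous m := by
    intro s
    induction s using Finset.induction_on with
    | empty =>
      intro m
      rw [Finset.prod_empty, PowerSeries.coeff_one]
      split_ifs with h
      · rw [h]
        exact isHomogeneous_one _ _
      · exact isHomogeneous_zero _ _ _
    | insert a s ha ih =>
      rw [Finset.prod_insert ha]
      refine isHomogeneous_coeff_mul (fun m => ?_) ih
      rw [binPow, PowerSeries.coeff_mk, algebraMap_eq, ← add_zero m]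
      exact (hX a m).mul (isHomogeneous_C _ _)
  exact isHomogeneous_coeff_mul (hprod _) (fun m => by
    rw [geomSeries, PowerSeries.coeff_mk]
    exact hX i m) m

theorem pderiv_coeff_succ_singularSeries {n : ℕ} (c : ℚ) (i j : Fin n) (m : ℕ) :
    pderiv j (PowerSeries.coeff (m + 1) (singularSeries c X i)) =
      X j * pderiv j (PowerSeries.coeff m (singularSeries c X i)) +
        C ((if j = i then 1 else 0) - c) * PowerSeries.coeff m (singularSeries c X i) := by
  have h := congrArg (PowerSeries.coeff (m + 1)) (one_sub_mul_coeffPderiv_singularSeries c i j)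
  rw [sub_mul, one_mul, map_sub, mul_assoc, PowerSeries.coeff_C_mul, PowerSeries.coeff_C_mul,
    PowerSeries.coeff_succ_X_mul, PowerSeries.coeff_succ_X_mul, coeffPderiv, PowerSeries.coeff_mk,
    PowerSeries.coeff_mk] at h
  linear_combination h

theorem divDiff_coeff_succ_singularSeries {n : ℕ} (c : ℚ) {i j : Fin n} (hij : j ≠ i) (m : ℕ) :
    divDiff j i (PowerSeries.coeff (m + 1) (singularSeries c X i)) =
      X j * divDiff j i (PowerSeries.coeff m (singularSeries c X i)) -
        PowerSeries.coeff m (singularSeries c X i) := by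
  apply mul_left_cancel₀ (X_sub_X_ne_zero hij)
  have h : (1 - PowerSeries.C (X j) * PowerSeries.X) * singularSeries c X j =
      (1 - PowerSeries.C (X i : MvPolynomial (Fin n) ℚ) * PowerSeries.X) *
        singularSeries c X i := by
    rw [one_sub_mul_singularSeries, one_sub_mul_singularSeries]
  replace h := congrArg (PowerSeries.coeff (m + 1)) h
  rw [sub_mul, sub_mul, one_mul, one_mul, map_sub, map_sub, mul_assoc, mul_assoc,
    PowerSeries.coeff_C_mul, PowerSeries.coeff_C_mul, PowerSeries.coeff_succ_X_mul,
    PowerSeries.coeff_succ_X_mul] at h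
  rw [mul_sub, mul_left_comm, X_sub_X_mul_divDiff, X_sub_X_mul_divDiff,
    rename_coeff_singularSeries, rename_coeff_singularSeries, Equiv.swap_apply_right]
  linear_combination -h

theorem divDiff_coeff_singularSeries_of_ne {n : ℕ} (c : ℚ) {i j k : Fin n} (hjk : j ≠ k)
    (hij : i ≠ j) (hik : i ≠ k) (m : ℕ) :
    divDiff j k (PowerSeries.coeff m (singularSeries c X i)) = 0 := by
  apply mul_left_cancel₀ (X_sub_X_ne_zero hjk)
  rw [X_sub_X_mul_divDiff, rename_coeff_singularSeries, Equiv.swap_apply_of_ne_of_ne hij hik,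
    sub_self, mul_zero]

theorem coeff_zero_singularSeries {n : ℕ} (c : ℚ) (i : Fin n) :
    PowerSeries.coeff 0 (singularSeries c (X : Fin n → MvPolynomial (Fin n) ℚ) i) = C 1 := by
  rw [PowerSeries.coeff_zero_eq_constantCoeff_apply, constantCoeff_singularSeries, C_1]

theorem dunkl_coeff_singularSeries_of_ne {n : ℕ} (c : ℚ) {i j : Fin n} (hij : j ≠ i) (m : ℕ) :
    dunkl c j (PowerSeries.coeff m (singularSeries c X i)) = 0 := by
  induction m with
  | zero => rw [coeff_zero_singularSeries, dunkl_C]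
  | succ m ih =>
    have h : ∀ m, dunkl c j (PowerSeries.coeff m (singularSeries c X i)) =
        pderiv j (PowerSeries.coeff m (singularSeries c X i)) -
          c • divDiff j i (PowerSeries.coeff m (singularSeries c X i)) := fun m => by
      rw [dunkl_apply, Finset.sum_eq_single i]
      · intro k hk hki
        exact divDiff_coeff_singularSeries_of_ne c (Finset.ne_of_mem_erase hk).symm hij.symm
          hki.symm m
      · intro hi
        simp [hij.symm] at hi
    rw [h, smul_eq_C_mul] at ih ⊢
    rw [pderiv_coeff_succ_singularSeries, divDiff_coeff_succ_singularSeries c hij, if_neg hij,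
      map_sub, map_zero]
    linear_combination X j * ih

theorem sum_pderiv_coeff_singularSeries {n : ℕ} {c : ℚ} (h : n * c = n + 1) (i : Fin n) :
    ∑ j, pderiv j (PowerSeries.coeff (n + 1)
      (singularSeries c (X : Fin n → MvPolynomial (Fin n) ℚ) i)) = 0 := by
  rw [Finset.sum_congr rfl fun j _ => pderiv_coeff_succ_singularSeries c i j n,
    Finset.sum_add_distrib, (isHomogeneous_coeff_singularSeries c i n).sum_X_mul_pderiv,
    ← Finset.sum_mul, ← map_sum, Finset.sum_sub_distrib, Finset.sum_ite_eq' Finset.univ i,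
    if_pos (Finset.mem_univ i), Finset.sum_const, Finset.card_univ, Fintype.card_fin, nsmul_eq_mul,
    nsmul_eq_mul, h, ← add_mul, ← map_natCast (C (σ := Fin n)), ← map_add]
  simp

theorem dunkl_coeff_singularSeries {n : ℕ} {c : ℚ} (h : n * c = n + 1) (i j : Fin n) :
    dunkl c j (PowerSeries.coeff (n + 1) (singularSeries c X i)) = 0 := by
  rcases eq_or_ne j i with rfl | hij
  · have h1 := sum_dunkl c (PowerSeries.coeff (n + 1) (singularSeries c X j))
    rw [sum_pderiv_coeff_singularSeries h, Finset.sum_eq_single j] at h1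
    · exact h1
    · intro k _ hk
      exact dunkl_coeff_singularSeries_of_ne c hk _
    · simp
  · exact dunkl_coeff_singularSeries_of_ne c hij _

theorem reducedDunkl_coeff_singularSeries {n : ℕ} {c : ℚ} (h : n * c = n + 1) (i j : Fin n) :
    reducedDunkl c j (PowerSeries.coeff (n + 1) (singularSeries c X i)) = 0 := by
  rw [reducedDunkl_apply, dunkl_coeff_singularSeries h,
    Finset.sum_eq_zero fun k _ => dunkl_coeff_singularSeries h i k, smul_zero, sub_zero]

theorem reducedDunkl_sum_X {n : ℕ} (c : ℚ) (j : Fin n) :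
    reducedDunkl c j (∑ k, X k) = 0 := by
  have hj := Finset.mem_univ j
  have h0 : ∀ a : ℚ, reducedDunkl c j (C a) = 0 := fun a => by
    rw [reducedDunkl_apply, dunkl_C, Finset.sum_eq_zero fun k _ => dunkl_C c k a, smul_zero,
      sub_zero]
  have h1 := reducedDunkl_X_self_mul c j 1
  have h2 : ∀ k ∈ Finset.univ.erase j, reducedDunkl c j (X k) =
      c • (1 : MvPolynomial (Fin n) ℚ) - ((1 : ℚ) / n) • 1 := fun k hk => by
    have := reducedDunkl_X_mul c (Finset.ne_of_mem_erase hk).symm 1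
    rwa [← C_1, h0, C_1, mul_one, mul_zero, zero_add, map_one] at this
  have hn : (n : ℚ) ≠ 0 := by
    have := j.pos
    positivity
  rw [← C_1, h0, C_1, mul_one, mul_zero, zero_add,
    Finset.sum_congr rfl fun k _ => map_one (rename (Equiv.swap j k))] at h1
  rw [map_sum, ← Finset.add_sum_erase _ _ hj, Finset.sum_congr rfl h2, h1, Finset.sum_const,
    Finset.sum_const, Finset.card_erase_of_mem hj, Finset.card_univ, Fintype.card_fin,
    ← Nat.cast_smul_eq_nsmul ℚ, ← Nat.cast_smul_eq_nsmul ℚ, Nat.cast_sub j.pos]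
  have : (n : ℚ) * (1 / n) = 1 := by field_simp
  simp only [smul_eq_C_mul, map_sub, Nat.succ_eq_add_one, zero_add, Nat.cast_one, map_one]
  have h3 := congrArg (C (σ := Fin n)) this
  rw [map_mul, map_one] at h3
  linear_combination -h3

theorem rename_mem_span {n : ℕ} {s : Set (MvPolynomial (Fin n) ℚ)} {w : Equiv.Perm (Fin n)}
    (hs : ∀ p ∈ s, rename w p ∈ s) {f : MvPolynomial (Fin n) ℚ} (hf : f ∈ Ideal.span s) :
    rename w f ∈ Ideal.span s := by
  have h : Ideal.span s ≤ (Ideal.span s).comap (rename w : MvPolynomial (Fin n) ℚ →ₐ[ℚ] _) :=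
    Ideal.span_le.2 fun p hp => Ideal.subset_span (hs p hp)
  exact h hf

theorem reducedDunkl_mem_span {n : ℕ} {s : Set (MvPolynomial (Fin n) ℚ)} {c : ℚ}
    (hs : ∀ (w : Equiv.Perm (Fin n)), ∀ p ∈ s, rename w p ∈ s)
    (hc : ∀ i, ∀ p ∈ s, reducedDunkl c i p = 0) {f : MvPolynomial (Fin n) ℚ}
    (hf : f ∈ Ideal.span s) (i : Fin n) : reducedDunkl c i f ∈ Ideal.span s := by
  have hsmul : ∀ (a : ℚ) (p : MvPolynomial (Fin n) ℚ), p ∈ Ideal.span s → a • p ∈ Ideal.span s :=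
    fun a p hp => by
      rw [smul_eq_C_mul]
      exact Ideal.mul_mem_left _ _ hp
  have hX : ∀ j p, p ∈ Ideal.span s → reducedDunkl c i p ∈ Ideal.span s →
      reducedDunkl c i (X j * p) ∈ Ideal.span s := by
    intro j p hp hp'
    rcases eq_or_ne i j with rfl | hij
    · rw [reducedDunkl_X_self_mul]
      exact sub_mem (add_mem (Ideal.mul_mem_left _ _ hp') (hsmul _ _ hp))
        (hsmul _ _ (sum_mem fun k _ => rename_mem_span (hs _) hp))
    · rw [reducedDunkl_X_mul c hij]
      exact sub_mem (add_mem (Ideal.mul_mem_left _ _ hp') (hsmul _ _ (rename_mem_span (hs _) hp)))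
        (hsmul _ _ hp)
  induction hf using Submodule.span_induction with
  | mem p hp =>
    rw [hc i p hp]
    exact zero_mem _
  | zero =>
    rw [map_zero]
    exact zero_mem _
  | add p q _ _ hp hq =>
    rw [map_add]
    exact add_mem hp hq
  | smul a p hp ih =>
    rw [smul_eq_mul]
    induction a using MvPolynomial.induction_on with
    | C a =>
      rw [← smul_eq_C_mul, map_smul]
      exact hsmul _ _ ih
    | add a b ha hb =>
      rw [add_mul, map_add]
      exact add_mem ha hb
    | mul_X a j ha =>
      rw [mul_right_comm, mul_comm]
      exact hX j _ (Ideal.mul_mem_left _ _ hp) ha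

/-- The ideal generated by `∑ i, x i` and the singular polynomials of degree `n + 1`. -/
def singularIdeal (n : ℕ) : Ideal (MvPolynomial (Fin n) ℚ) :=
  Ideal.span (insert (∑ i, X i) (Set.range fun i =>
    PowerSeries.coeff (n + 1) (singularSeries (((n : ℚ) + 1) / n) X i)))

theorem singularIdeal_ne_top (n : ℕ) : singularIdeal n ≠ ⊤ := by
  have h : singularIdeal n ≤ RingHom.ker (constantCoeff (R := ℚ) (σ := Fin n)) := by
    refine Ideal.span_le.2 ?_
    rintro p (rfl | ⟨i, rfl⟩)
    · simp [RingHom.mem_ker]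
    · rw [SetLike.mem_coe, RingHom.mem_ker]
      exact (isHomogeneous_coeff_singularSeries _ i _).coeff_eq_zero (by simp)
  intro htop
  have h1 := h (htop ▸ Submodule.mem_top (x := (1 : MvPolynomial (Fin n) ℚ)))
  rw [RingHom.mem_ker, map_one] at h1
  exact one_ne_zero h1

theorem exists_singularQuotient (n : ℕ) : ∃ M : CherednikModule n
    (MvPolynomial (Fin n) ℚ ⧸ singularIdeal n),
    (∀ i f, M.X i (Ideal.Quotient.mk _ f) = Ideal.Quotient.mk _ (X i * f)) ∧
      (∀ i f, M.Y i (Ideal.Quotient.mk _ f) =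
        Ideal.Quotient.mk _ (reducedDunkl (((n : ℚ) + 1) / n) i f)) ∧
      ∀ w f, M.σ w (Ideal.Quotient.mk _ f) = Ideal.Quotient.mk _ (rename w f) := by
  have hs : ∀ (w : Equiv.Perm (Fin n)), ∀ p ∈ insert (∑ i, X i) (Set.range fun i =>
      PowerSeries.coeff (n + 1) (singularSeries (((n : ℚ) + 1) / n) X i)), rename w p ∈
      insert (∑ i, X i) (Set.range fun i => PowerSeries.coeff (n + 1) (singularSeries
        (((n : ℚ) + 1) / n) (X : Fin n → MvPolynomial (Fin n) ℚ) i)) := by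
    rintro w p (rfl | ⟨i, rfl⟩)
    · left
      rw [map_sum, Finset.sum_congr rfl fun i _ => rename_X _ _, Equiv.sum_comp w]
    · right
      exact ⟨w i, (rename_coeff_singularSeries _ _ _ _).symm⟩
  have key := (CherednikModule.polynomial n).exists_quotient
    (Ideal.Quotient.mkₐ ℚ (singularIdeal n)).toLinearMap Ideal.Quotient.mk_surjective
    (fun i v hv => ?_) (fun i v hv => ?_) (fun w v hv => ?_)
  · exact key
  all_goals
    replace hv := Ideal.Quotient.eq_zero_iff_mem.1 hv
    refine Ideal.Quotient.eq_zero_iff_mem.2 ?_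
  · exact Ideal.mul_mem_left _ _ hv
  · refine reducedDunkl_mem_span hs ?_ hv i
    have hn : (n : ℚ) ≠ 0 := by
      have := i.pos
      positivity
    rintro j p (rfl | ⟨k, rfl⟩)
    · exact reducedDunkl_sum_X _ j
    · exact reducedDunkl_coeff_singularSeries (by field_simp) k j
  · exact rename_mem_span (hs w) hv

/-- The polynomial `∏ a ∈ s, (1 - a z)`. -/
def oneSubProd {K : Type*} [Field K] (s : Finset K) : Polynomial K :=
  ∏ a ∈ s, (1 - Polynomial.C a * Polynomial.X)

theorem coeff_oneSubProd_eq_zero {K : Type*} [Field K] {s : Finset K} {k : ℕ} (h : s.card < k) :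
    (oneSubProd s).coeff k = 0 := by
  refine Polynomial.coeff_eq_zero_of_natDegree_lt (lt_of_le_of_lt ?_ h)
  refine (Polynomial.natDegree_prod_le _ _).trans ?_
  rw [Finset.card_eq_sum_ones]
  refine Finset.sum_le_sum fun a _ => ?_
  refine (Polynomial.natDegree_sub_le _ _).trans ?_
  rw [Polynomial.natDegree_one]
  exact max_le zero_le_one ((Polynomial.natDegree_C_mul_le _ _).trans Polynomial.natDegree_X_le)

theorem coeff_mul_prod_geomSeries {K : Type*} [Field K] {N : ℕ} {F : PowerSeries K}
    {s : Finset K} (hs : ∀ a ∈ s, PowerSeries.coeff N (F * geomSeries a) = 0) {k : ℕ}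
    (hk : k < s.card) :
    PowerSeries.coeff N (PowerSeries.X ^ k * (F * ∏ a ∈ s, geomSeries a)) = 0 := by
  classical
  induction hm : s.card generalizing s k with
  | zero => omega
  | succ m ih =>
    rcases Nat.eq_zero_or_pos m with rfl | hm0
    · obtain ⟨a, rfl⟩ := Finset.card_eq_one.1 hm
      obtain rfl : k = 0 := by omega
      simpa using hs a
    · obtain ⟨a, ha, b, hb, hab⟩ := Finset.one_lt_card.1 (show 1 < s.card by omega)
      have h1 : ∀ k < m, PowerSeries.coeff N (PowerSeries.X ^ k *
          (F * ∏ x ∈ s.erase a, geomSeries x)) = 0 := fun k hk' =>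
        ih (fun x hx => hs x (Finset.mem_of_mem_erase hx))
          (by rw [Finset.card_erase_of_mem ha]; omega) (by rw [Finset.card_erase_of_mem ha]; omega)
      have h2 : ∀ k < m, PowerSeries.coeff N (PowerSeries.X ^ k *
          (F * ∏ x ∈ s.erase b, geomSeries x)) = 0 := fun k hk' =>
        ih (fun x hx => hs x (Finset.mem_of_mem_erase hx))
          (by rw [Finset.card_erase_of_mem hb]; omega) (by rw [Finset.card_erase_of_mem hb]; omega)
      have hG : ∏ x ∈ s.erase a, geomSeries x =
          (1 - PowerSeries.C a * PowerSeries.X) * ∏ x ∈ s, geomSeries x := by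
        rw [← Finset.mul_prod_erase _ _ ha, ← mul_assoc, one_sub_mul_geomSeries, one_mul]
      have hG' : ∏ x ∈ s.erase b, geomSeries x =
          (1 - PowerSeries.C b * PowerSeries.X) * ∏ x ∈ s, geomSeries x := by
        rw [← Finset.mul_prod_erase _ _ hb, ← mul_assoc, one_sub_mul_geomSeries, one_mul]
      apply mul_left_cancel₀ (sub_ne_zero.2 hab)
      rw [mul_zero, ← PowerSeries.coeff_C_mul]
      rcases Nat.eq_zero_or_pos k with rfl | hk0
      · have h3 : PowerSeries.C (a - b) * (PowerSeries.X ^ 0 * (F * ∏ x ∈ s, geomSeries x)) =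
            PowerSeries.C a * (PowerSeries.X ^ 0 * (F * ∏ x ∈ s.erase b, geomSeries x)) -
              PowerSeries.C b * (PowerSeries.X ^ 0 * (F * ∏ x ∈ s.erase a, geomSeries x)) := by
          rw [hG, hG', map_sub]
          ring
        rw [h3, map_sub, PowerSeries.coeff_C_mul, PowerSeries.coeff_C_mul, h1 0 hm0, h2 0 hm0]
        simp
      · obtain ⟨k, rfl⟩ := Nat.exists_eq_succ_of_ne_zero hk0.ne'
        have h3 : PowerSeries.C (a - b) * (PowerSeries.X ^ (k + 1) * (F * ∏ x ∈ s, geomSeries x)) =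
            PowerSeries.X ^ k * (F * ∏ x ∈ s.erase b, geomSeries x) -
              PowerSeries.X ^ k * (F * ∏ x ∈ s.erase a, geomSeries x) := by
          rw [hG, hG', map_sub]
          ring
        rw [h3, map_sub, h1 k (by omega), h2 k (by omega), sub_zero]

theorem coeff_eq_zero_of_mul_derivative {K : Type*} [Field K] [CharZero K] {r N : ℕ}
    {f p q : PowerSeries K} (hf : q * PowerSeries.derivative K f = p * f)
    (hq0 : PowerSeries.coeff 0 q = 1) (hq : ∀ k, r < k → PowerSeries.coeff k q = 0)
    (hp : ∀ k, r ≤ k → PowerSeries.coeff k p = 0)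
    (hN : ∀ k < r, PowerSeries.coeff (N - k) f = 0) (hrN : r ≤ N) (m : ℕ) (hm : N - r < m) :
    PowerSeries.coeff m f = 0 := by
  induction m using Nat.strong_induction_on with
  | _ m ih =>
    rcases le_or_gt m N with hmN | hmN
    · have := hN (N - m) (by omega)
      rwa [Nat.sub_sub_self hmN] at this
    · obtain ⟨m, rfl⟩ := Nat.exists_eq_succ_of_ne_zero (show m ≠ 0 by omega)
      have h := congrArg (PowerSeries.coeff m) hf
      rw [PowerSeries.coeff_mul, PowerSeries.coeff_mul, Finset.sum_eq_zero (s := _)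
        (f := fun x : ℕ × ℕ => PowerSeries.coeff x.1 p * PowerSeries.coeff x.2 f),
        Finset.sum_eq_single (0, m)] at h
      · rw [hq0, one_mul, PowerSeries.coeff_derivative] at h
        exact (mul_eq_zero.1 h).resolve_right (Nat.cast_add_one_ne_zero m)
      · rintro ⟨i, j⟩ hij hne
        rw [Finset.HasAntidiagonal.mem_antidiagonal] at hij
        simp only at hij ⊢
        rcases lt_or_ge r i with hi | hi
        · rw [hq i hi, zero_mul]
        · have hi0 : i ≠ 0 := by
            rintro rfl
            exact hne (by rw [← hij, zero_add])
          rw [PowerSeries.coeff_derivative, ih (j + 1) (by omega) (by omega), zero_mul, mul_zero]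
      · intro h0
        simp [Finset.HasAntidiagonal.mem_antidiagonal] at h0
      · rintro ⟨i, j⟩ hij
        rw [Finset.HasAntidiagonal.mem_antidiagonal] at hij
        simp only at hij ⊢
        rcases le_or_gt r i with hi | hi
        · rw [hp i hi, zero_mul]
        · rw [ih j (by omega) (by omega), mul_zero]

theorem one_sub_mul_derivative_binPow {K : Type*} [Field K] [Algebra ℚ K] (c : ℚ) (u : K) :
    (1 - PowerSeries.C u * PowerSeries.X) * PowerSeries.derivative K (binPow c u) =
      PowerSeries.C (-(algebraMap ℚ K c * u)) * binPow c u := by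
  ext m
  have h := congrArg (algebraMap ℚ K) (succ_mul_oneSubCoeff_succ c m)
  rw [map_mul, map_mul, map_add, map_sub, map_natCast, map_one] at h
  rw [sub_mul, one_mul, map_sub, mul_assoc, PowerSeries.coeff_C_mul, PowerSeries.coeff_C_mul,
    PowerSeries.coeff_derivative, binPow, PowerSeries.coeff_mk, PowerSeries.coeff_mk]
  cases m with
  | zero =>
    rw [PowerSeries.coeff_zero_X_mul]
    push_cast at h ⊢
    linear_combination u * h
  | succ m =>
    rw [PowerSeries.coeff_succ_X_mul, PowerSeries.coeff_derivative, PowerSeries.coeff_mk]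
    push_cast at h ⊢
    linear_combination u ^ (m + 2) * h

theorem one_sub_mul_derivative_geomSeries {K : Type*} [Field K] (u : K) :
    (1 - PowerSeries.C u * PowerSeries.X) * PowerSeries.derivative K (geomSeries u) =
      PowerSeries.C u * geomSeries u := by
  have h := congrArg (PowerSeries.derivative K) (one_sub_mul_geomSeries u)
  rw [Derivation.leibniz, smul_eq_mul, smul_eq_mul, map_sub, Derivation.map_one_eq_zero,
    Derivation.leibniz, PowerSeries.derivative_C, PowerSeries.derivative_X] at h
  simp only [smul_eq_mul] at h
  linear_combination h

/-- The condition that the logarithmic derivative of `f` is of the form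
`p / ∏ a ∈ s, (1 - a z)` with `deg p < |s|`. -/
def IsLogDerivative {K : Type*} [Field K] (s : Finset K) (f : PowerSeries K) : Prop :=
  ∃ p : PowerSeries K, (oneSubProd s : PowerSeries K) * PowerSeries.derivative K f = p * f ∧
    ∀ k, s.card ≤ k → PowerSeries.coeff k p = 0

theorem IsLogDerivative.one {K : Type*} [Field K] (s : Finset K) : IsLogDerivative s 1 :=
  ⟨0, by rw [Derivation.map_one_eq_zero, mul_zero, zero_mul], fun k _ => map_zero _⟩

theorem IsLogDerivative.mul {K : Type*} [Field K] {s : Finset K} {f g : PowerSeries K}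
    (hf : IsLogDerivative s f) (hg : IsLogDerivative s g) : IsLogDerivative s (f * g) := by
  obtain ⟨p, hp, hp'⟩ := hf
  obtain ⟨q, hq, hq'⟩ := hg
  refine ⟨p + q, ?_, fun k hk => by rw [map_add, hp' k hk, hq' k hk, add_zero]⟩
  rw [Derivation.leibniz, smul_eq_mul, smul_eq_mul]
  linear_combination f * hq + g * hp

theorem IsLogDerivative.prod {K ι : Type*} [Field K] {s : Finset K} {t : Finset ι}
    {f : ι → PowerSeries K} (hf : ∀ i ∈ t, IsLogDerivative s (f i)) :
    IsLogDerivative s (∏ i ∈ t, f i) := by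
  classical
  induction t using Finset.induction_on with
  | empty => exact IsLogDerivative.one s
  | insert a t ha ih =>
    rw [Finset.prod_insert ha]
    exact (hf a (Finset.mem_insert_self _ _)).mul
      (ih fun i hi => hf i (Finset.mem_insert_of_mem hi))

theorem IsLogDerivative.of_one_sub_mul {K : Type*} [Field K] {s : Finset K} {f : PowerSeries K}
    {a e : K} (ha : a ∈ s) (hf : (1 - PowerSeries.C a * PowerSeries.X) *
      PowerSeries.derivative K f = PowerSeries.C e * f) : IsLogDerivative s f := by
  classical
  refine ⟨PowerSeries.C e * (oneSubProd (s.erase a) : PowerSeries K), ?_, fun k hk => ?_⟩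
  · have h : (oneSubProd s : PowerSeries K) =
        (1 - PowerSeries.C a * PowerSeries.X) * (oneSubProd (s.erase a) : PowerSeries K) := by
      rw [oneSubProd, ← Finset.mul_prod_erase _ _ ha]
      simp [oneSubProd]
    rw [h]
    linear_combination (oneSubProd (s.erase a) : PowerSeries K) * hf
  · rw [PowerSeries.coeff_C_mul, Polynomial.coeff_coe, coeff_oneSubProd_eq_zero, mul_zero]
    have := Finset.card_pos.2 ⟨a, ha⟩
    rw [Finset.card_erase_of_mem ha]
    omega

theorem coe_prod_powerSeries {R ι : Type*} [CommSemiring R] (s : Finset ι)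
    (f : ι → Polynomial R) : ((∏ i ∈ s, f i : Polynomial R) : PowerSeries R) =
      ∏ i ∈ s, (f i : PowerSeries R) :=
  map_prod (Polynomial.coeToPowerSeries.ringHom (R := R)) f s

theorem one_sub_C_mul_X_ne_zero {K : Type*} [Field K] (u : K) :
    1 - Polynomial.C u * Polynomial.X ≠ 0 := fun h => by
  simpa using congrArg (Polynomial.eval 0) h

theorem count_roots_one_sub_C_mul_X {K : Type*} [Field K] [DecidableEq K] {a : K} (ha : a ≠ 0)
    (u : K) : (1 - Polynomial.C u * Polynomial.X).roots.count a⁻¹ = if u = a then 1 else 0 := by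
  rcases eq_or_ne u 0 with rfl | hu
  · simp [ha.symm]
  · have h : 1 - Polynomial.C u * Polynomial.X =
        Polynomial.C (-u) * (Polynomial.X - Polynomial.C u⁻¹) := by
      rw [mul_sub, ← Polynomial.C_mul]
      simp [hu]
      ring
    rw [h, Polynomial.roots_C_mul _ (neg_ne_zero.2 hu), Polynomial.roots_X_sub_C,
      Multiset.count_singleton]
    simp [eq_comm]

theorem eq_zero_of_coeff_singularSeries {K : Type*} [Field K] [Algebra ℚ K] {n : ℕ}
    {u : Fin n → K} (hsum : ∑ i, u i = 0)
    (h : ∀ i, PowerSeries.coeff (n + 1) (singularSeries (((n : ℚ) + 1) / n) u i) = 0)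
    (i : Fin n) : u i = 0 := by
  classical
  have := algebraRat.charZero K
  by_contra hi
  have hn : n ≠ 0 := i.pos.ne'
  set c : ℚ := ((n : ℚ) + 1) / n with hc
  have hnc : n * c = (n + 1 : ℕ) := by
    rw [hc]
    push_cast
    field_simp
  set s := (Finset.univ.image u).erase 0 with hs
  have hcard : s.card ≤ n := by
    refine (Finset.card_erase_le.trans Finset.card_image_le).trans ?_
    rw [Finset.card_univ, Fintype.card_fin]
  set F : PowerSeries K := ∏ j, binPow c (u j) with hF
  set f := F * ∏ a ∈ s, geomSeries a with hf
  have hfs : ∀ k < s.card, PowerSeries.coeff (n + 1 - k) f = 0 := fun k hk => by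
    have h1 := coeff_mul_prod_geomSeries (N := n + 1) (F := F) (s := s) (fun a ha => by
      obtain ⟨j, -, rfl⟩ := Finset.mem_image.1 (Finset.mem_of_mem_erase ha)
      exact h j) hk
    rwa [PowerSeries.coeff_X_pow_mul', if_pos (by omega)] at h1
  have hlog : IsLogDerivative s f := by
    refine IsLogDerivative.mul (IsLogDerivative.prod fun j _ => ?_)
      (IsLogDerivative.prod fun a ha => IsLogDerivative.of_one_sub_mul ha
        (one_sub_mul_derivative_geomSeries a))
    by_cases hj : u j = 0
    · have h1 : binPow c (u j) = 1 := by
        ext m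
        rw [hj, binPow, PowerSeries.coeff_mk, PowerSeries.coeff_one]
        rcases eq_or_ne m 0 with rfl | hm
        · rw [oneSubCoeff_zero, map_one, pow_zero, mul_one, if_pos rfl]
        · rw [zero_pow hm, zero_mul, if_neg hm]
      rw [h1]
      exact IsLogDerivative.one s
    · exact IsLogDerivative.of_one_sub_mul
        (Finset.mem_erase.2 ⟨hj, Finset.mem_image_of_mem u (Finset.mem_univ j)⟩)
        (one_sub_mul_derivative_binPow c (u j))
  obtain ⟨p, hp, hp'⟩ := hlog
  have hvan : ∀ m, n + 1 - s.card < m → PowerSeries.coeff m f = 0 :=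
    coeff_eq_zero_of_mul_derivative hp
      (by rw [Polynomial.coeff_coe, oneSubProd, Polynomial.coeff_zero_prod]; simp)
      (fun k hk => by rw [Polynomial.coeff_coe, coeff_oneSubProd_eq_zero hk]) hp' hfs (by omega)
  have htrunc : (PowerSeries.trunc (n + 2) f : PowerSeries K) = f := by
    ext m
    rw [Polynomial.coeff_coe, PowerSeries.coeff_trunc]
    split_ifs with hm
    · rfl
    · exact (hvan m (by omega)).symm
  have hFf : F = f * (oneSubProd s : PowerSeries K) := by
    have h1 : (oneSubProd s : PowerSeries K) =
        ∏ a ∈ s, (1 - PowerSeries.C a * PowerSeries.X) := by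
      rw [oneSubProd, coe_prod_powerSeries]
      simp
    rw [hf, mul_assoc, h1, ← Finset.prod_mul_distrib, Finset.prod_eq_one, mul_one]
    intro a _
    rw [mul_comm, one_sub_mul_geomSeries]
  have hpoly : (PowerSeries.trunc (n + 2) f * oneSubProd s) ^ n =
      ∏ j, (1 - Polynomial.C (u j) * Polynomial.X) ^ (n + 1) := by
    apply Polynomial.coe_injective
    rw [Polynomial.coe_pow, Polynomial.coe_mul, htrunc, ← hFf, hF, ← Finset.prod_pow,
      Finset.prod_congr rfl fun j _ => binPow_pow hnc (u j), coe_prod_powerSeries]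
    simp
  have hroots := congrArg (fun q => q.roots.count (u i)⁻¹) hpoly
  rw [Polynomial.roots_pow, Multiset.count_nsmul, Finset.prod_pow, Polynomial.roots_pow,
    Multiset.count_nsmul, Polynomial.roots_prod _ _ (Finset.prod_ne_zero_iff.2 fun j _ =>
      one_sub_C_mul_X_ne_zero (u j)), Multiset.count_bind] at hroots
  have hsumcount : (Multiset.map (fun j => Multiset.count (u i)⁻¹
      (1 - Polynomial.C (u j) * Polynomial.X).roots) (Finset.univ : Finset (Fin n)).val).sum =
      (Finset.univ.filter fun j => u j = u i).card := by
    rw [Finset.card_filter]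
    exact Finset.sum_congr rfl fun j _ => count_roots_one_sub_C_mul_X hi (u j)
  rw [hsumcount] at hroots
  have hdvd : n ∣ (Finset.univ.filter fun j => u j = u i).card :=
    (Nat.coprime_self_add_right.2 (Nat.coprime_one_right n)).dvd_of_dvd_mul_left
      (Dvd.intro _ hroots)
  have hpos : 0 < (Finset.univ.filter fun j => u j = u i).card :=
    Finset.card_pos.2 ⟨i, by simp⟩
  have hle := Finset.card_filter_le (Finset.univ : Finset (Fin n)) fun j => u j = u i
  have heq : (Finset.univ.filter fun j => u j = u i) = Finset.univ := by
    refine Finset.eq_univ_of_card _ (le_antisymm (hle.trans (by simp)) ?_)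
    rw [Fintype.card_fin]
    exact Nat.le_of_dvd hpos hdvd
  have hall : ∀ j, u j = u i := fun j => by
    simpa using Finset.ext_iff.1 heq j
  rw [Finset.sum_congr rfl fun j _ => hall j, Finset.sum_const, Finset.card_univ, Fintype.card_fin,
    nsmul_eq_mul] at hsum
  exact (mul_ne_zero (Nat.cast_ne_zero.2 hn) hi) hsum

theorem isNilpotent_of_singularIdeal {A : Type*} [CommRing A] [Algebra ℚ A] {n : ℕ}
    (φ : MvPolynomial (Fin n) ℚ →ₐ[ℚ] A) (hφ : ∀ p ∈ singularIdeal n, φ p = 0) (i : Fin n) :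
    IsNilpotent (φ (X i)) := by
  rw [nilpotent_iff_mem_prime]
  intro 𝔭 h𝔭
  let ψ : A →ₐ[ℚ] FractionRing (A ⧸ 𝔭) :=
    (Algebra.ofId (A ⧸ 𝔭) (FractionRing (A ⧸ 𝔭))).restrictScalars ℚ |>.comp
      (Ideal.Quotient.mkₐ ℚ 𝔭)
  have h := eq_zero_of_coeff_singularSeries (u := ψ.comp φ ∘ X) ?_ ?_ i
  · exact Ideal.Quotient.eq_zero_iff_mem.1
      ((map_eq_zero_iff _ (IsFractionRing.injective (A ⧸ 𝔭) (FractionRing (A ⧸ 𝔭)))).1 h)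
  · have := congrArg ψ (hφ _ (Ideal.subset_span (Set.mem_insert _ _)))
    rwa [map_zero, map_sum, map_sum] at this
  · intro i
    rw [← map_singularSeries, PowerSeries.coeff_map]
    have := congrArg ψ (hφ _ (Ideal.subset_span (Set.mem_insert_of_mem _ ⟨i, rfl⟩)))
    rwa [map_zero] at this

theorem finite_singularQuotient (n : ℕ) :
    Module.Finite ℚ (MvPolynomial (Fin n) ℚ ⧸ singularIdeal n) := by
  have hnil : ∀ i, IsNilpotent (Ideal.Quotient.mk (singularIdeal n) (X i)) :=
    isNilpotent_of_singularIdeal (Ideal.Quotient.mkₐ ℚ (singularIdeal n)) fun p hp =>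
      Ideal.Quotient.eq_zero_iff_mem.2 hp
  have hint : Algebra.IsIntegral ℚ (MvPolynomial (Fin n) ℚ ⧸ singularIdeal n) := by
    constructor
    intro v
    obtain ⟨f, rfl⟩ := Ideal.Quotient.mk_surjective v
    induction f using MvPolynomial.induction_on with
    | C a => exact isIntegral_algebraMap (R := ℚ) (x := a)
    | add p q hp hq =>
      rw [map_add]
      exact hp.add hq
    | mul_X p i hp =>
      rw [map_mul]
      refine hp.mul ?_
      obtain ⟨k, hk⟩ := hnil i
      refine ⟨Polynomial.X ^ k, Polynomial.monic_X_pow k, ?_⟩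
      rw [Polynomial.eval₂_pow, Polynomial.eval₂_X, hk]
  exact Algebra.IsIntegral.finite

theorem sq_commutator {R : Type*} [Ring R] (a b : R) :
    a * a * b - b * (a * a) = a * (a * b - b * a) + (a * b - b * a) * a := by
  noncomm_ring

theorem sum_sq_commutator {R : Type*} [Ring R] [Algebra ℚ R] {n : ℕ} {x y : Fin n → R}
    {s : Fin n → Fin n → R} {c d : ℚ} (hs : ∀ i j, s i j = s j i)
    (hsy : ∀ i j, s i j * y i = y j * s i j)
    (hne : ∀ i j, i ≠ j → y i * x j - x j * y i = c • s i j - d • 1)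
    (hself : ∀ i, y i * x i - x i * y i = (1 - d) • 1 - c • ∑ k ∈ Finset.univ.erase i, s i k)
    (hy : ∑ i, y i = 0) (j : Fin n) :
    (∑ i, y i * y i) * x j - x j * ∑ i, y i * y i = (2 : ℚ) • y j := by
  have hj := Finset.mem_univ j
  have h1 : y j * y j * x j - x j * (y j * y j) =
      (2 : ℚ) • y j - (2 * d) • y j -
        c • ∑ i ∈ Finset.univ.erase j, (y i * s j i + y j * s j i) := by
    rw [sq_commutator, hself, mul_sub, sub_mul, mul_smul_comm, smul_mul_assoc, mul_one, one_mul,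
      mul_smul_comm, smul_mul_assoc, Finset.mul_sum, Finset.sum_mul, Finset.sum_add_distrib,
      Finset.sum_congr rfl fun i _ => hsy j i]
    module
  have h2 : ∀ i ∈ Finset.univ.erase j, y i * y i * x j - x j * (y i * y i) =
      c • (y i * s j i + y j * s j i) - (2 * d) • y i := fun i hi => by
    rw [sq_commutator, hne i j (Finset.ne_of_mem_erase hi), mul_sub, sub_mul, mul_smul_comm,
      smul_mul_assoc, mul_smul_comm, smul_mul_assoc, mul_one, one_mul, hsy,
      hs i j]
    module
  rw [Finset.sum_mul, Finset.mul_sum, ← Finset.sum_sub_distrib, ← Finset.add_sum_erase _ _ hj, h1,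
    Finset.sum_congr rfl h2, Finset.sum_sub_distrib, ← Finset.smul_sum, ← Finset.smul_sum]
  rw [← Finset.add_sum_erase _ _ hj, add_comm, ← eq_neg_iff_add_eq_zero] at hy
  rw [hy]
  module

theorem sum_sq_commutator_sum_sq {R : Type*} [Ring R] [Algebra ℚ R] {n : ℕ} {x y : Fin n → R}
    {f : R} (h : ∀ j, f * x j - x j * f = (2 : ℚ) • y j) :
    f * (∑ j, x j * x j) - (∑ j, x j * x j) * f =
      (4 : ℚ) • ∑ j, x j * y j + (2 : ℚ) • ∑ j, (y j * x j - x j * y j) := by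
  have h1 : ∀ j, f * (x j * x j) - x j * x j * f =
      (4 : ℚ) • (x j * y j) + (2 : ℚ) • (y j * x j - x j * y j) := fun j => by
    have : f * (x j * x j) - x j * x j * f =
        (f * x j - x j * f) * x j + x j * (f * x j - x j * f) := by noncomm_ring
    rw [this, h, smul_mul_assoc, mul_smul_comm]
    module
  rw [Finset.mul_sum, Finset.sum_mul, ← Finset.sum_sub_distrib,
    Finset.sum_congr rfl fun j _ => h1 j, Finset.sum_add_distrib, Finset.smul_sum, Finset.smul_sum]

namespace CherednikModule

variable {n : ℕ} {W : Type*} [AddCommGroup W] [Module ℚ W] (M : CherednikModule n W)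

theorem mem_signPart_of_comm {f : Module.End ℚ W} (hf : ∀ w, M.σ w * f = f * M.σ w) {v : W}
    (hv : v ∈ M.signPart) : f v ∈ M.signPart := by
  rw [mem_signPart] at hv ⊢
  intro w
  rw [← Module.End.mul_apply, hf, Module.End.mul_apply, hv, map_smul]

theorem σ_mul_sum_X_mul_Y (w : Equiv.Perm (Fin n)) :
    M.σ w * (∑ j, M.X j * M.Y j) = (∑ j, M.X j * M.Y j) * M.σ w := by
  rw [Finset.mul_sum, Finset.sum_mul, ← Equiv.sum_comp w fun j => M.X j * M.Y j * M.σ w]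
  refine Finset.sum_congr rfl fun j _ => ?_
  rw [← mul_assoc, M.σ_mul_X, mul_assoc, M.σ_mul_Y, mul_assoc]

theorem σ_mul_sum_X_mul_X (w : Equiv.Perm (Fin n)) :
    M.σ w * (∑ j, M.X j * M.X j) = (∑ j, M.X j * M.X j) * M.σ w := by
  rw [Finset.mul_sum, Finset.sum_mul, ← Equiv.sum_comp w fun j => M.X j * M.X j * M.σ w]
  refine Finset.sum_congr rfl fun j _ => ?_
  rw [← mul_assoc, M.σ_mul_X, mul_assoc, M.σ_mul_X, mul_assoc]

theorem σ_mul_sum_Y_mul_Y (w : Equiv.Perm (Fin n)) :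
    M.σ w * (∑ j, M.Y j * M.Y j) = (∑ j, M.Y j * M.Y j) * M.σ w := by
  rw [Finset.mul_sum, Finset.sum_mul, ← Equiv.sum_comp w fun j => M.Y j * M.Y j * M.σ w]
  refine Finset.sum_congr rfl fun j _ => ?_
  rw [← mul_assoc, M.σ_mul_Y, mul_assoc, M.σ_mul_Y, mul_assoc]

theorem sum_commutator_apply (hn : n ≠ 0) {v : W} (hv : v ∈ M.signPart) :
    (∑ j, (M.Y j * M.X j - M.X j * M.Y j)) v = (((n : ℚ) - 1) * (n + 2)) • v := by
  have hn' : (n : ℚ) ≠ 0 := Nat.cast_ne_zero.2 hn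
  rw [mem_signPart] at hv
  have h1 : ∀ j, (M.Y j * M.X j - M.X j * M.Y j) v =
      ((1 - (1 : ℚ) / n) + (((n : ℚ) + 1) / n) * (n - 1)) • v := fun j => by
    have h2 : ∀ k ∈ Finset.univ.erase j, M.σ (Equiv.swap j k) v = (-1 : ℚ) • v := fun k hk => by
      rw [hv, Equiv.Perm.sign_swap (Finset.ne_of_mem_erase hk).symm]
      norm_num
    rw [M.YX_self, LinearMap.sub_apply, LinearMap.smul_apply, LinearMap.smul_apply,
      Module.End.one_apply, LinearMap.sum_apply, Finset.sum_congr rfl h2, Finset.sum_const,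
      Finset.card_erase_of_mem (Finset.mem_univ j), Finset.card_univ, Fintype.card_fin,
      ← Nat.cast_smul_eq_nsmul ℚ, Nat.cast_pred (Nat.pos_of_ne_zero hn)]
    module
  rw [LinearMap.sum_apply, Finset.sum_congr rfl fun j _ => h1 j, Finset.sum_const, Finset.card_univ,
    Fintype.card_fin, ← Nat.cast_smul_eq_nsmul ℚ, smul_smul]
  congr 1
  field_simp
  ring

theorem trace_sum_X_mul_Y (hn : n ≠ 0) (hY : ∑ j, M.Y j = 0) [FiniteDimensional ℚ W] :
    LinearMap.trace ℚ M.signPart ((∑ j, M.X j * M.Y j).restrict fun _ hv =>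
      M.mem_signPart_of_comm M.σ_mul_sum_X_mul_Y hv) =
      -(((n : ℚ) - 1) * (n + 2) / 2) * Module.finrank ℚ M.signPart := by
  set E : Module.End ℚ M.signPart := (∑ j, M.X j * M.Y j).restrict fun _ hv =>
    M.mem_signPart_of_comm M.σ_mul_sum_X_mul_Y hv with hE
  set F : Module.End ℚ M.signPart := (∑ j, M.Y j * M.Y j).restrict fun _ hv =>
    M.mem_signPart_of_comm M.σ_mul_sum_Y_mul_Y hv with hF
  set G : Module.End ℚ M.signPart := (∑ j, M.X j * M.X j).restrict fun _ hv =>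
    M.mem_signPart_of_comm M.σ_mul_sum_X_mul_X hv with hG
  have h1 := sum_sq_commutator_sum_sq (x := M.X) (sum_sq_commutator (x := M.X) (y := M.Y)
    (s := fun i j => M.σ (Equiv.swap i j)) (fun i j => by rw [Equiv.swap_comm])
    (fun i j => by rw [M.σ_mul_Y, Equiv.swap_apply_left]) M.YX_ne M.YX_self hY)
  have h2 : F * G - G * F = (4 : ℚ) • E + (2 * (((n : ℚ) - 1) * (n + 2))) • 1 := by
    refine LinearMap.ext fun v => Subtype.ext ?_
    have h := LinearMap.congr_fun h1 (v : W)
    rw [LinearMap.add_apply, LinearMap.smul_apply _ (∑ j, (M.Y j * M.X j - M.X j * M.Y j)),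
      M.sum_commutator_apply hn v.2, smul_smul] at h
    exact h
  have h3 := congrArg (LinearMap.trace ℚ M.signPart) h2
  rw [map_sub, LinearMap.trace_mul_comm, sub_self, map_add, map_smul, map_smul, LinearMap.trace_one,
    smul_eq_mul, smul_eq_mul] at h3
  linear_combination -(1 / 4) * h3

theorem twist_apply (w : Equiv.Perm (Fin n)) (v : W) :
    M.twist w v = ((Equiv.Perm.sign w : ℤ) : ℚ) • M.σ w v := rfl

/-- The projection onto the sign-isotypic part, up to the factor `n!`. -/
def antisymm : W →ₗ[ℚ] W := ∑ w, M.twist w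

theorem antisymm_apply (v : W) : M.antisymm v = ∑ w, M.twist w v := LinearMap.sum_apply _ _ _

theorem antisymm_mem (v : W) : M.antisymm v ∈ M.signPart := by
  rw [signPart, Representation.mem_invariants]
  intro u
  rw [antisymm_apply, map_sum, ← Equiv.sum_comp (Equiv.mulLeft u) fun w => M.twist w v]
  refine Finset.sum_congr rfl fun w _ => ?_
  rw [Equiv.coe_mulLeft, map_mul, Module.End.mul_apply]

theorem antisymm_twist (u : Equiv.Perm (Fin n)) (v : W) :
    M.antisymm (M.twist u v) = M.antisymm v := by
  rw [antisymm_apply, antisymm_apply, ← Equiv.sum_comp (Equiv.mulRight u) fun w => M.twist w v]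
  refine Finset.sum_congr rfl fun w _ => ?_
  rw [Equiv.coe_mulRight, map_mul, Module.End.mul_apply]

theorem antisymm_of_mem {v : W} (hv : v ∈ M.signPart) :
    M.antisymm v = (n.factorial : ℚ) • v := by
  rw [signPart, Representation.mem_invariants] at hv
  rw [antisymm_apply, Finset.sum_congr rfl fun w _ => hv w, Finset.sum_const, Finset.card_univ,
    Fintype.card_perm, Fintype.card_fin, Nat.cast_smul_eq_nsmul]

end CherednikModule

theorem span_singleton_eq_top_of_trace {U : Type*} [AddCommGroup U] [Module ℚ U]
    [FiniteDimensional ℚ U] {E : Module.End ℚ U} {s : Set U} (hs : Submodule.span ℚ s = ⊤) {D : U}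
    {N : ℚ} (h : ∀ v ∈ s, ∃ k : ℚ, E v = k • v ∧ N ≤ k ∧ (k = N → v ∈ Submodule.span ℚ {D}))
    (htr : LinearMap.trace ℚ U E = N * Module.finrank ℚ U) : Submodule.span ℚ {D} = ⊤ := by
  classical
  obtain ⟨b, hbs, hspan, hli⟩ := exists_linearIndependent ℚ s
  have hspan' : ⊤ ≤ Submodule.span ℚ (Set.range ((↑) : b → U)) := by
    rw [Subtype.range_coe, hspan, hs]
  set B := Module.Basis.mk hli hspan' with hB
  have hBv : ∀ i, B i = (i : U) := fun i => Module.Basis.mk_apply _ _ i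
  have : Fintype b := FiniteDimensional.fintypeBasisIndex B
  choose k hk hkN hkD using fun i : b => h i (hbs i.2)
  have h1 : LinearMap.trace ℚ U E = ∑ i, k i := by
    rw [LinearMap.trace_eq_matrix_trace ℚ B, Matrix.trace]
    refine Finset.sum_congr rfl fun i _ => ?_
    rw [Matrix.diag_apply, LinearMap.toMatrix_apply, hBv, hk, ← hBv, map_smul, B.repr_self]
    simp
  have h2 : ∑ _i : b, N = ∑ i, k i := by
    rw [← h1, htr, Finset.sum_const, Finset.card_univ, Module.finrank_eq_card_basis B, nsmul_eq_mul,
      mul_comm]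
  have h3 := (Finset.sum_eq_sum_iff_of_le fun i _ => hkN i).1 h2
  rw [eq_top_iff, ← hs, ← hspan, Submodule.span_le]
  intro v hv
  exact hkD ⟨v, hv⟩ (h3 ⟨v, hv⟩ (Finset.mem_univ _)).symm

theorem exists_perm_of_injective {n : ℕ} {a : Fin n → ℕ} (ha : Function.Injective a) :
    ∑ i : Fin n, (i : ℕ) ≤ ∑ i, a i ∧
      (∑ i : Fin n, (i : ℕ) = ∑ i, a i → ∃ w : Equiv.Perm (Fin n), ∀ i, a i = w i) := by
  have hmono : StrictMono (a ∘ Tuple.sort a) :=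
    (Tuple.monotone_sort a).strictMono_of_injective (ha.comp (Equiv.injective _))
  have hle : ∀ i : Fin n, (i : ℕ) ≤ a (Tuple.sort a i) := by
    intro i
    obtain ⟨i, hi⟩ := i
    induction i with
    | zero => exact Nat.zero_le _
    | succ i ih =>
      have h1 := ih (by omega)
      have h2 : a (Tuple.sort a ⟨i, by omega⟩) < a (Tuple.sort a ⟨i + 1, hi⟩) :=
        hmono (Fin.mk_lt_mk.2 (Nat.lt_succ_self i))
      exact lt_of_le_of_lt h1 h2
  rw [← Equiv.sum_comp (Tuple.sort a) a]
  refine ⟨Finset.sum_le_sum fun i _ => hle i, fun h => ⟨(Tuple.sort a).symm, fun i => ?_⟩⟩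
  have h1 := (Finset.sum_eq_sum_iff_of_le fun i _ => hle i).1 h ((Tuple.sort a).symm i)
    (Finset.mem_univ _)
  rw [h1, Equiv.apply_symm_apply]

theorem sum_X_mul_dunkl {n : ℕ} (c : ℚ) {d : ℕ} {f : MvPolynomial (Fin n) ℚ}
    (hf : f.IsHomogeneous d) (hs : f ∈ (CherednikModule.polynomial n).signPart) :
    ∑ j, X j * dunkl c j f = C (d - c * (n * ((n : ℚ) - 1))) * f := by
  have hswap : ∀ j k : Fin n, j ≠ k → rename (Equiv.swap j k) f = -f := fun j k hjk => by
    have := (CherednikModule.mem_signPart _).1 hs (Equiv.swap j k)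
    rw [Equiv.Perm.sign_swap hjk] at this
    refine this.trans ?_
    norm_num
  have hdd : ∀ j k : Fin n, j ≠ k → (X j - X k) * divDiff j k f = 2 * f := fun j k hjk => by
    rw [X_sub_X_mul_divDiff, hswap j k hjk]
    ring
  set S := ∑ j, ∑ k ∈ Finset.univ.erase j, X j * divDiff j k f with hS
  have hS' : S = ∑ j, ∑ k ∈ Finset.univ.erase j, X k * divDiff k j f := by
    rw [hS, Finset.sum_comm']
    intro j k
    simp [eq_comm]
  have hSS : (2 : MvPolynomial (Fin n) ℚ) * S = 2 * (C (n * ((n : ℚ) - 1)) * f) := by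
    have h1 : ∀ j : Fin n, ∀ k ∈ Finset.univ.erase j,
        X j * divDiff j k f + X k * divDiff k j f = 2 * f := fun j k hk => by
      have hjk := (Finset.ne_of_mem_erase hk).symm
      have h2 : divDiff k j f = -divDiff j k f := by
        apply mul_left_cancel₀ (X_sub_X_ne_zero hjk)
        linear_combination -(hdd k j hjk.symm) + hdd j k hjk
      rw [h2]
      linear_combination hdd j k hjk
    rw [two_mul]
    nth_rewrite 2 [hS']
    rw [hS, ← Finset.sum_add_distrib, Finset.sum_congr rfl fun j _ => by
      rw [← Finset.sum_add_distrib, Finset.sum_congr rfl (h1 j), Finset.sum_const,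
        Finset.card_erase_of_mem (Finset.mem_univ j)], Finset.sum_const, Finset.card_univ,
      Fintype.card_fin]
    rcases Nat.eq_zero_or_pos n with rfl | hn
    · simp
    · simp only [nsmul_eq_mul, Nat.cast_pred hn, map_mul, map_sub, map_natCast, map_one]
      ring
  have hE := hf.sum_X_mul_pderiv
  rw [nsmul_eq_mul] at hE
  simp only [dunkl_apply, mul_sub, Finset.sum_sub_distrib, hE, smul_eq_C_mul, mul_left_comm _ (C c),
    ← Finset.mul_sum]
  have hSS' := mul_left_cancel₀ two_ne_zero hSS
  simp only [hS, Finset.mul_sum] at hSS' ⊢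
  simp only [← Finset.mul_sum] at hSS' ⊢
  rw [hSS']
  simp only [map_sub, map_mul, map_natCast, map_one]
  ring

/-- The monomial with exponents `a`. -/
def expMonomial {n : ℕ} (a : Fin n → ℕ) : MvPolynomial (Fin n) ℚ := ∏ i, X i ^ a i

theorem isHomogeneous_expMonomial {n : ℕ} (a : Fin n → ℕ) :
    (expMonomial a).IsHomogeneous (∑ i, a i) :=
  IsHomogeneous.prod _ _ _ fun i _ => by simpa using (isHomogeneous_X ℚ i).pow (a i)

theorem rename_expMonomial {n : ℕ} (w : Equiv.Perm (Fin n)) (a : Fin n → ℕ) :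
    rename w (expMonomial (a ∘ w)) = expMonomial a := by
  rw [expMonomial, map_prod, expMonomial, ← Equiv.prod_comp w fun i => X i ^ a i]
  exact Finset.prod_congr rfl fun i _ => by rw [map_pow, rename_X, Function.comp_apply]

theorem span_range_expMonomial (n : ℕ) :
    Submodule.span ℚ (Set.range (expMonomial (n := n))) = ⊤ := by
  rw [eq_top_iff]
  intro f _
  induction f using MvPolynomial.induction_on' with
  | monomial a r =>
    rw [monomial_eq, Finsupp.prod_fintype _ _ fun i => pow_zero _, ← smul_eq_C_mul]
    exact Submodule.smul_mem _ _ (Submodule.subset_span ⟨_, rfl⟩)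
  | add p q hp hq => exact add_mem (hp trivial) (hq trivial)

theorem antisymm_expMonomial_eq_zero {n : ℕ} {a : Fin n → ℕ} (ha : ¬Function.Injective a) :
    (CherednikModule.polynomial n).antisymm (expMonomial a) = 0 := by
  simp only [Function.Injective, not_forall] at ha
  obtain ⟨i, j, hij, hne⟩ := ha
  have h := (CherednikModule.polynomial n).antisymm_twist (Equiv.swap i j) (expMonomial a)
  have ha' : a ∘ Equiv.swap i j = a := by
    ext k
    rw [Function.comp_apply, Equiv.swap_apply_def]
    split_ifs with h1 h2
    · rw [h1, hij]
    · rw [h2, hij]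
    · rfl
  have h1 : (CherednikModule.polynomial n).twist (Equiv.swap i j) (expMonomial a) =
      (-1 : ℚ) • expMonomial a := by
    rw [CherednikModule.twist_apply, Equiv.Perm.sign_swap hne]
    have h2 := rename_expMonomial (Equiv.swap i j) a
    rw [ha'] at h2
    refine (congrArg _ h2).trans ?_
    norm_num
  rw [h1, map_smul, neg_one_smul, neg_eq_iff_add_eq_zero, ← two_smul ℚ] at h
  exact (smul_eq_zero.1 h).resolve_left two_ne_zero

theorem antisymm_expMonomial_perm {n : ℕ} {a : Fin n → ℕ} {w : Equiv.Perm (Fin n)}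
    (ha : ∀ i, a i = w i) : (CherednikModule.polynomial n).antisymm (expMonomial a) ∈
      Submodule.span ℚ
        {(CherednikModule.polynomial n).antisymm (expMonomial fun i : Fin n => (i : ℕ))} := by
  have h := (CherednikModule.polynomial n).antisymm_twist w (expMonomial a)
  rw [CherednikModule.twist_apply, map_smul] at h
  have h1 : (CherednikModule.polynomial n).σ w (expMonomial a) =
      expMonomial fun i : Fin n => (i : ℕ) := by
    refine Eq.trans ?_ (rename_expMonomial w _)
    exact congrArg (fun b => rename w (expMonomial b)) (funext ha)
  rw [← h, h1]
  exact Submodule.smul_mem _ _ (Submodule.mem_span_singleton_self _)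

theorem isHomogeneous_antisymm {n d : ℕ} {f : MvPolynomial (Fin n) ℚ} (hf : f.IsHomogeneous d) :
    ((CherednikModule.polynomial n).antisymm f).IsHomogeneous d := by
  rw [CherednikModule.antisymm_apply]
  refine IsHomogeneous.sum _ _ _ fun w _ => ?_
  rw [CherednikModule.twist_apply, smul_eq_C_mul, ← zero_add d]
  exact (isHomogeneous_C _ _).mul hf.rename_isHomogeneous

/-- Over the rational Cherednik algebra there is a finite-dimensional module whose sign-isotypic
part is a line. -/
theorem exists_cherednikModule (m : ℕ) : ∃ (W : Type) (_ : AddCommGroup W) (_ : Module ℚ W)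
    (M : CherednikModule (m + 1) W) (D : W), FiniteDimensional ℚ W ∧ D ≠ 0 ∧
      M.signPart = Submodule.span ℚ {D} := by
  obtain ⟨M, hX, hY, hσ⟩ := exists_singularQuotient (m + 1)
  have hfin := finite_singularQuotient (m + 1)
  set P := CherednikModule.polynomial (m + 1) with hP
  set π := Ideal.Quotient.mkₐ ℚ (singularIdeal (m + 1)) with hπ
  set c : ℚ := ((m + 1 : ℕ) + 1 : ℚ) / (m + 1 : ℕ) with hc
  set N : ℚ := -((((m + 1 : ℕ) : ℚ) - 1) * ((m + 1 : ℕ) + 2) / 2) with hN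
  have hanti : ∀ f, M.antisymm (π f) = π (P.antisymm f) := fun f => by
    rw [CherednikModule.antisymm_apply, CherednikModule.antisymm_apply, map_sum]
    refine Finset.sum_congr rfl fun w _ => ?_
    rw [CherednikModule.twist_apply, CherednikModule.twist_apply, map_smul]
    exact congrArg _ (hσ w f)
  have hX0 : π (∑ j, X j) = 0 :=
    Ideal.Quotient.eq_zero_iff_mem.2 (Ideal.subset_span (Set.mem_insert _ _))
  have hYsum : ∑ j, M.Y j = 0 := by
    refine LinearMap.ext fun v => ?_
    obtain ⟨f, rfl⟩ := Ideal.Quotient.mk_surjective v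
    rw [LinearMap.sum_apply, Finset.sum_congr rfl fun j _ => hY j f, ← map_sum,
      Finset.sum_congr rfl fun j _ => reducedDunkl_apply c j f, Finset.sum_sub_distrib,
      Finset.sum_const, Finset.card_univ, Fintype.card_fin, ← Nat.cast_smul_eq_nsmul ℚ, smul_smul,
      mul_one_div_cancel (Nat.cast_ne_zero.2 m.succ_ne_zero), one_smul, sub_self, map_zero,
      LinearMap.zero_apply]
  have hEig : ∀ {f : MvPolynomial (Fin (m + 1)) ℚ} {d : ℕ}, f.IsHomogeneous d → f ∈ P.signPart →
      (∑ j, M.X j * M.Y j) (π f) =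
        (d - c * ((m + 1 : ℕ) * (((m + 1 : ℕ) : ℚ) - 1))) • π f := by
    intro f d hf hs
    have h1 : ∑ j, X j * reducedDunkl c j f =
        C (d - c * ((m + 1 : ℕ) * (((m + 1 : ℕ) : ℚ) - 1))) * f -
          (∑ j, X j) * ((1 : ℚ) / (m + 1 : ℕ)) • ∑ k, dunkl c k f := by
      rw [← sum_X_mul_dunkl c hf hs, Finset.sum_mul, ← Finset.sum_sub_distrib]
      refine Finset.sum_congr rfl fun j _ => ?_
      rw [reducedDunkl_apply, mul_sub]
    have h2 := congrArg π h1
    rw [map_sub, map_mul π (∑ j, X j), hX0, zero_mul, sub_zero, ← smul_eq_C_mul, map_smul,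
      map_sum] at h2
    rw [← h2, LinearMap.sum_apply]
    refine Finset.sum_congr rfl fun j _ => ?_
    rw [Module.End.mul_apply]
    exact (congrArg _ (hY j f)).trans (hX j _)
  set D : M.signPart := ⟨M.antisymm (π (expMonomial fun i => (i : ℕ))), M.antisymm_mem _⟩ with hD
  have htop : Submodule.span ℚ {D} = ⊤ := by
    refine span_singleton_eq_top_of_trace (s := Set.range fun a =>
      (⟨M.antisymm (π (expMonomial a)), M.antisymm_mem _⟩ : M.signPart)) (N := N) ?_ ?_
      (M.trace_sum_X_mul_Y m.succ_ne_zero hYsum)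
    · rw [eq_top_iff]
      rintro ⟨v, hv⟩ -
      obtain ⟨f, rfl⟩ := Ideal.Quotient.mk_surjective v
      have h1 : (⟨M.antisymm (π f), M.antisymm_mem _⟩ : M.signPart) ∈ Submodule.span ℚ
          (Set.range fun a => (⟨M.antisymm (π (expMonomial a)), M.antisymm_mem _⟩ :
            M.signPart)) := by
        have h2 := (span_range_expMonomial (m + 1)).symm ▸ Submodule.mem_top (x := f)
        have h3 := Submodule.mem_map_of_mem (f := (M.antisymm ∘ₗ π.toLinearMap).codRestrict
          M.signPart fun _ => M.antisymm_mem _) h2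
        rw [Submodule.map_span, ← Set.range_comp] at h3
        exact h3
      have h4 : (⟨Ideal.Quotient.mk _ f, hv⟩ : M.signPart) = ((m + 1).factorial : ℚ)⁻¹ •
          (⟨M.antisymm (π f), M.antisymm_mem _⟩ : M.signPart) := by
        refine Subtype.ext ?_
        rw [Submodule.coe_smul, Submodule.coe_mk, Submodule.coe_mk]
        refine Eq.trans ?_ (congrArg _ (M.antisymm_of_mem hv).symm)
        rw [inv_smul_smul₀ (Nat.cast_ne_zero.2 (Nat.factorial_ne_zero _))]
      rw [h4]
      exact Submodule.smul_mem _ _ h1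
    · rintro _ ⟨a, rfl⟩
      have hNval : N = ((∑ i : Fin (m + 1), (i : ℕ) : ℕ) : ℚ) -
          c * ((m + 1 : ℕ) * (((m + 1 : ℕ) : ℚ) - 1)) := by
        have h1 := Finset.sum_range_id_mul_two (m + 1)
        rw [← Fin.sum_univ_eq_sum_range fun i => i] at h1
        have h2 : ((∑ i : Fin (m + 1), (i : ℕ) : ℕ) : ℚ) * 2 = (m + 1) * m := by
          exact_mod_cast h1
        rw [hN, hc]
        push_cast at h2 ⊢
        have : (m : ℚ) + 1 ≠ 0 := by positivity
        field_simp
        linear_combination -h2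
      by_cases ha : Function.Injective a
      · obtain ⟨hle, heq⟩ := exists_perm_of_injective ha
        refine ⟨((∑ i, a i : ℕ) : ℚ) - c * ((m + 1 : ℕ) * (((m + 1 : ℕ) : ℚ) - 1)), ?_, ?_, ?_⟩
        · refine Subtype.ext ?_
          have h1 := hEig (isHomogeneous_antisymm (isHomogeneous_expMonomial a)) (P.antisymm_mem _)
          rw [← hanti] at h1
          exact h1
        · rw [hNval]
          exact sub_le_sub_right (Nat.cast_le.2 hle) _
        · intro h
          rw [hNval] at h
          obtain ⟨w, hw⟩ := heq (Nat.cast_injective (sub_left_injective h)).symm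
          obtain ⟨q, hq⟩ := Submodule.mem_span_singleton.1 (antisymm_expMonomial_perm hw)
          refine Submodule.mem_span_singleton.2 ⟨q, Subtype.ext ?_⟩
          have h2 := congrArg π hq
          rw [map_smul, ← hanti, ← hanti] at h2
          exact h2
      · have h0 : (⟨M.antisymm (π (expMonomial a)), M.antisymm_mem _⟩ : M.signPart) = 0 := by
          refine Subtype.ext ?_
          rw [Submodule.coe_mk, hanti, antisymm_expMonomial_eq_zero ha, map_zero]
          rfl
        refine ⟨N, ?_, le_rfl, fun _ => ?_⟩
        · simp only [h0, map_zero, smul_zero]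
        · simp only [h0]
          exact zero_mem _
  have hspan : M.signPart = Submodule.span ℚ {(D : MvPolynomial _ ℚ ⧸ singularIdeal (m + 1))} := by
    have h1 := congrArg (Submodule.map M.signPart.subtype) htop
    rw [Submodule.map_top, Submodule.range_subtype, Submodule.map_span, Set.image_singleton] at h1
    exact h1.symm
  refine ⟨_, _, _, M, D, hfin, fun h0 => ?_, hspan⟩
  have hfr := M.finrank_mul_succ
  rw [hspan, h0, Submodule.span_zero_singleton, finrank_bot, mul_zero,
    Module.finrank_zero_iff] at hfr
  have := Ideal.Quotient.nontrivial_iff.2 (singularIdeal_ne_top (m + 1))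
  exact not_subsingleton _ hfr

section Filtration

variable {ι W : Type*} [AddCommGroup W] [Module ℚ W]

/-- The span of the vectors obtained from `D` by applying fewer than `d` of the operators `Z a`. -/
def wordSpan (Z : ι → Module.End ℚ W) (D : W) (d : ℕ) : Submodule ℚ W :=
  Submodule.span ℚ {v | ∃ l : List ι, l.length < d ∧ (l.map Z).prod D = v}

variable {Z : ι → Module.End ℚ W} {D : W}

theorem wordSpan_mono {d e : ℕ} (h : d ≤ e) : wordSpan Z D d ≤ wordSpan Z D e :=
  Submodule.span_mono fun _ ⟨l, hl, hv⟩ => ⟨l, hl.trans_le h, hv⟩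

theorem word_mem_wordSpan {l : List ι} {d : ℕ} (h : l.length < d) :
    (l.map Z).prod D ∈ wordSpan Z D d :=
  Submodule.subset_span ⟨l, h, rfl⟩

theorem apply_mem_wordSpan (a : ι) {d : ℕ} {v : W} (hv : v ∈ wordSpan Z D d) :
    Z a v ∈ wordSpan Z D (d + 1) := by
  induction hv using Submodule.span_induction with
  | mem v hv =>
    obtain ⟨l, hl, rfl⟩ := hv
    have := word_mem_wordSpan (Z := Z) (D := D) (l := a :: l) (d := d + 1) (by simpa using hl)
    rwa [List.map_cons, List.prod_cons, Module.End.mul_apply] at this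
  | zero => rw [map_zero]; exact zero_mem _
  | add u v _ _ hu hv => rw [map_add]; exact add_mem hu hv
  | smul c v _ hv => rw [map_smul]; exact Submodule.smul_mem _ _ hv

/-- The operators `Z a` commute up to terms of lower filtration. -/
def CommutesFiltered (Z : ι → Module.End ℚ W) (D : W) : Prop :=
  ∀ a b d, ∀ v ∈ wordSpan Z D d, Z a (Z b v) - Z b (Z a v) ∈ wordSpan Z D d

theorem CommutesFiltered.word_sub_mem (hZ : CommutesFiltered Z D) {l l' : List ι}
    (h : l.Perm l') : (l.map Z).prod D - (l'.map Z).prod D ∈ wordSpan Z D l.length := by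
  induction h with
  | nil => rw [sub_self]; exact zero_mem _
  | cons a _ ih =>
    rw [List.map_cons, List.prod_cons, List.map_cons, List.prod_cons, Module.End.mul_apply,
      Module.End.mul_apply, ← map_sub]
    exact apply_mem_wordSpan a ih
  | swap a b l =>
    simp only [List.map_cons, List.prod_cons, Module.End.mul_apply]
    exact wordSpan_mono (by simp) (hZ b a (l.length + 1) _ (word_mem_wordSpan (by simp)))
  | trans h₁ _ ih₁ ih₂ =>
    rw [← h₁.length_eq] at ih₂
    have := add_mem ih₁ ih₂
    rwa [sub_add_sub_cancel] at this

/-- Substitute the operators `Z a` for the variables, in some order in each monomial, and apply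
the result to `D`. -/
def orderedEval (Z : ι → Module.End ℚ W) (D : W) : MvPolynomial ι ℚ →ₗ[ℚ] W :=
  (basisMonomials ι ℚ).constr ℚ fun e => ((Finsupp.toMultiset e).toList.map Z).prod D

theorem orderedEval_monomial (e : ι →₀ ℕ) :
    orderedEval Z D (monomial e 1) = ((Finsupp.toMultiset e).toList.map Z).prod D := by
  rw [orderedEval, show monomial e (1 : ℚ) = basisMonomials ι ℚ e by rw [coe_basisMonomials],
    Module.Basis.constr_basis]

theorem length_toList_toMultiset (e : ι →₀ ℕ) :
    (Finsupp.toMultiset e).toList.length = e.degree := by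
  rw [Multiset.length_toList, Finsupp.card_toMultiset]
  rfl

theorem CommutesFiltered.orderedEval_monomial_sub_mem (hZ : CommutesFiltered Z D) {e : ι →₀ ℕ}
    {l : List ι} (h : (l : Multiset ι) = Finsupp.toMultiset e) :
    orderedEval Z D (monomial e 1) - (l.map Z).prod D ∈ wordSpan Z D l.length := by
  have hp : (Finsupp.toMultiset e).toList.Perm l := by
    rw [← Multiset.coe_eq_coe, Multiset.coe_toList, h]
  rw [orderedEval_monomial, ← hp.length_eq]
  exact hZ.word_sub_mem hp

theorem homogeneous_induction {d : ℕ} {P : MvPolynomial ι ℚ → Prop} {p : MvPolynomial ι ℚ}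
    (hp : p.IsHomogeneous d) (h0 : P 0) (hadd : ∀ p q, P p → P q → P (p + q))
    (hsmul : ∀ (c : ℚ) p, P p → P (c • p))
    (hmon : ∀ e : ι →₀ ℕ, e.degree = d → P (monomial e 1)) : P p := by
  rw [p.as_sum]
  refine Finset.sum_induction _ P hadd h0 fun e he => ?_
  have := hsmul (coeff e p) _ (hmon e (hp.degree_eq_sum_deg_support he).symm)
  rwa [smul_monomial, smul_eq_mul, mul_one] at this

theorem CommutesFiltered.orderedEval_X_mul_sub_mem (hZ : CommutesFiltered Z D) (a : ι) {d : ℕ}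
    {p : MvPolynomial ι ℚ} (hp : p.IsHomogeneous d) :
    orderedEval Z D (X a * p) - Z a (orderedEval Z D p) ∈ wordSpan Z D (d + 1) := by
  refine homogeneous_induction
    (P := fun p => orderedEval Z D (X a * p) - Z a (orderedEval Z D p) ∈ wordSpan Z D (d + 1))
    hp ?_ ?_ ?_ ?_
  · rw [mul_zero, map_zero, map_zero, sub_zero]; exact zero_mem _
  · intro p q hp hq
    rw [mul_add, map_add, map_add, map_add, add_sub_add_comm]
    exact add_mem hp hq
  · intro c p hp
    rw [mul_smul_comm, map_smul, map_smul, map_smul, ← smul_sub]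
    exact Submodule.smul_mem _ _ hp
  · intro e he
    have := hZ.orderedEval_monomial_sub_mem (e := Finsupp.single a 1 + e)
      (l := a :: (Finsupp.toMultiset e).toList) (by
        rw [Finsupp.toMultiset_add, Finsupp.toMultiset_single, one_smul, Multiset.singleton_add,
          ← Multiset.cons_coe, Multiset.coe_toList])
    rw [List.length_cons, length_toList_toMultiset, he, List.map_cons, List.prod_cons,
      Module.End.mul_apply, ← orderedEval_monomial, ← one_mul (1 : ℚ), ← monomial_mul,
      one_mul] at this
    exact this

theorem homogeneousComponent_X_mul (a : ι) (d : ℕ) (q : MvPolynomial ι ℚ) :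
    homogeneousComponent (d + 1) (X a * q) = X a * homogeneousComponent d q := by
  classical
  ext m
  rw [coeff_homogeneousComponent, coeff_X_mul', coeff_X_mul', coeff_homogeneousComponent]
  by_cases ha : a ∈ m.support
  · have h : m.degree = (m - Finsupp.single a 1).degree + 1 := by
      have hle : Finsupp.single a 1 ≤ m := by
        rw [Finsupp.single_le_iff]
        exact Nat.one_le_iff_ne_zero.2 (Finsupp.mem_support_iff.1 ha)
      conv_lhs => rw [← tsub_add_cancel_of_le hle, map_add, Finsupp.degree_single]
    simp only [if_pos ha, h, add_left_inj]
  · simp only [if_neg ha, ite_self]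

theorem CommutesFiltered.orderedEval_homogeneousComponent_mem (hZ : CommutesFiltered Z D)
    {s : Set (MvPolynomial ι ℚ)} (hs : ∀ p ∈ s, ∃ d, p.IsHomogeneous d ∧
      orderedEval Z D p ∈ wordSpan Z D d) {q : MvPolynomial ι ℚ} (hq : q ∈ Ideal.span s) (d : ℕ) :
    orderedEval Z D (homogeneousComponent d q) ∈ wordSpan Z D d := by
  induction hq using Submodule.span_induction generalizing d with
  | mem p hp =>
    obtain ⟨e, he, hp⟩ := hs p hp
    rw [homogeneousComponent_of_mem ((mem_homogeneousSubmodule _ _).2 he)]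
    split_ifs with h
    · rwa [h]
    · rw [map_zero]; exact zero_mem _
  | zero => rw [map_zero, map_zero]; exact zero_mem _
  | add p q _ _ hp hq => rw [map_add, map_add]; exact add_mem (hp d) (hq d)
  | smul a p _ ih =>
    rw [smul_eq_mul]
    induction a using MvPolynomial.induction_on generalizing d with
    | C a =>
      rw [← smul_eq_C_mul, map_smul, map_smul]
      exact Submodule.smul_mem _ _ (ih d)
    | add a b ha hb =>
      rw [add_mul, map_add, map_add]
      exact add_mem (ha d) (hb d)
    | mul_X a j ha =>
      rw [mul_right_comm, mul_comm]
      rcases d with _ | d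
      · have : homogeneousComponent 0 (X j * (a * p)) = 0 := by
          classical
          rw [homogeneousComponent_zero, coeff_X_mul', if_neg (by simp), C_0]
        rw [this, map_zero]
        exact zero_mem _
      · rw [homogeneousComponent_X_mul]
        have := add_mem (hZ.orderedEval_X_mul_sub_mem j
          (homogeneousComponent_isHomogeneous d (a * p))) (apply_mem_wordSpan j (ha d))
        rwa [sub_add_cancel] at this

theorem CommutesFiltered.exists_finrank_le (hZ : CommutesFiltered Z D) {A : Type*} [CommRing A]
    [Algebra ℚ A] [Module.Finite ℚ A] (π : MvPolynomial ι ℚ →ₐ[ℚ] A)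
    (hsurj : Function.Surjective π)
    (hπ : ∀ q, π q = 0 → ∀ d, orderedEval Z D (homogeneousComponent d q) ∈ wordSpan Z D d) :
    ∃ T : Submodule ℚ W, Module.Finite ℚ T ∧ Module.finrank ℚ T ≤ Module.finrank ℚ A ∧
      ∀ d, wordSpan Z D d ≤ T := by
  obtain ⟨b, hb, hspan, hli⟩ := exists_linearIndependent ℚ
    (Set.range fun e : ι →₀ ℕ => π (monomial e 1))
  have htop : Submodule.span ℚ (Set.range fun e : ι →₀ ℕ => π (monomial e 1)) = ⊤ := by
    rw [show (fun e : ι →₀ ℕ => π (monomial e 1)) = π.toLinearMap ∘ basisMonomials ι ℚ from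
      funext fun e => by rw [coe_basisMonomials]; rfl, Set.range_comp, Submodule.span_image,
      Module.Basis.span_eq, Submodule.map_top, LinearMap.range_eq_top]
    exact hsurj
  let B : Module.Basis b ℚ A := Module.Basis.mk hli (by
    rw [Subtype.range_coe, hspan, htop])
  have : Fintype b := FiniteDimensional.fintypeBasisIndex B
  choose e he using fun s : b => hb s.2
  let u : b → W := fun s => orderedEval Z D (monomial (e s) 1)
  refine ⟨Submodule.span ℚ (Set.range u), FiniteDimensional.span_of_finite ℚ (Set.finite_range u),
    (finrank_range_le_card u).trans_eq (Module.finrank_eq_card_basis B).symm, fun d => ?_⟩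
  have hBs : ∀ s : b, B s = π (monomial (e s) 1) := fun s => by
    rw [Module.Basis.mk_apply]
    exact (he s).symm
  induction d with
  | zero =>
    refine Submodule.span_le.2 ?_
    rintro _ ⟨l, hl, -⟩
    exact absurd hl (Nat.not_lt_zero _)
  | succ d ih =>
    refine Submodule.span_le.2 ?_
    rintro _ ⟨l, hl, rfl⟩
    rcases (Nat.lt_succ_iff.1 hl).lt_or_eq with hl | hl
    · exact ih (word_mem_wordSpan hl)
    classical
    set m := Multiset.toFinsupp (l : Multiset ι) with hm
    have hml : (l : Multiset ι) = Finsupp.toMultiset m := by rw [hm, Multiset.toFinsupp_toMultiset]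
    have hdeg : m.degree = d := by
      rw [← length_toList_toMultiset, ← hml, Multiset.length_toList, Multiset.coe_card, hl]
    have h₁ := ih (hl ▸ hZ.orderedEval_monomial_sub_mem hml)
    have h₂ := ih (hπ (monomial m 1 - ∑ s : b, B.repr (π (monomial m 1)) s • monomial (e s) 1) (by
      rw [map_sub, map_sum]
      simp only [map_smul, ← hBs]
      rw [B.sum_repr, sub_self]) d)
    have hc : ∀ k : ι →₀ ℕ, homogeneousComponent d (monomial k (1 : ℚ)) =
        if k.degree = d then monomial k 1 else 0 := fun k => by
      rw [homogeneousComponent_of_mem ((mem_homogeneousSubmodule _ _).2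
        (isHomogeneous_monomial 1 rfl))]
      simp only [eq_comm]
    have h₃ : orderedEval Z D (homogeneousComponent d
        (∑ s : b, B.repr (π (monomial m 1)) s • monomial (e s) 1)) ∈
        Submodule.span ℚ (Set.range u) := by
      rw [map_sum, map_sum]
      refine sum_mem fun s _ => ?_
      rw [map_smul, map_smul, hc]
      refine Submodule.smul_mem _ _ ?_
      split_ifs
      · exact Submodule.subset_span ⟨s, rfl⟩
      · rw [map_zero]; exact zero_mem _
    rw [map_sub, map_sub, hc, if_pos hdeg] at h₂
    have h₄ := sub_mem (add_mem h₂ h₃) h₁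
    rwa [sub_add_cancel, sub_sub_cancel] at h₄

end Filtration

section CherednikFiltration

variable {n : ℕ} {W : Type*} [AddCommGroup W] [Module ℚ W]

namespace CherednikModule

/-- The operators `X i` and `Y i`, indexed by the variables of `PolyXY n`. -/
def ops (M : CherednikModule n W) : Fin n ⊕ Fin n → Module.End ℚ W :=
  Sum.elim M.X M.Y

variable (M : CherednikModule n W) {D : W}

theorem σ_mul_ops (w : Equiv.Perm (Fin n)) (a : Fin n ⊕ Fin n) :
    M.σ w * M.ops a = M.ops (Sum.map w w a) * M.σ w := by
  rcases a with i | i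
  · exact M.σ_mul_X w i
  · exact M.σ_mul_Y w i

theorem σ_word (hD : D ∈ M.signPart) (w : Equiv.Perm (Fin n)) (l : List (Fin n ⊕ Fin n)) :
    M.σ w ((l.map M.ops).prod D) =
      ((Equiv.Perm.sign w : ℤ) : ℚ) • (((l.map (Sum.map w w)).map M.ops).prod D) := by
  induction l with
  | nil => exact M.mem_signPart.1 hD w
  | cons a l ih =>
    rw [List.map_cons, List.prod_cons, Module.End.mul_apply, ← Module.End.mul_apply, M.σ_mul_ops,
      Module.End.mul_apply, ih, map_smul, List.map_cons, List.map_cons, List.prod_cons,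
      Module.End.mul_apply]

theorem σ_mem_wordSpan (hD : D ∈ M.signPart) (w : Equiv.Perm (Fin n)) {d : ℕ} {v : W}
    (hv : v ∈ wordSpan M.ops D d) : M.σ w v ∈ wordSpan M.ops D d := by
  induction hv using Submodule.span_induction with
  | mem v hv =>
    obtain ⟨l, hl, rfl⟩ := hv
    rw [M.σ_word hD]
    exact Submodule.smul_mem _ _ (word_mem_wordSpan (by rwa [List.length_map]))
  | zero => rw [map_zero]; exact zero_mem _
  | add u v _ _ hu hv => rw [map_add]; exact add_mem hu hv
  | smul c v _ hv => rw [map_smul]; exact Submodule.smul_mem _ _ hv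

theorem YX_sub_mem (hD : D ∈ M.signPart) (i j : Fin n) {d : ℕ} {v : W}
    (hv : v ∈ wordSpan M.ops D d) : M.Y i (M.X j v) - M.X j (M.Y i v) ∈ wordSpan M.ops D d := by
  rw [← Module.End.mul_apply, ← Module.End.mul_apply, ← LinearMap.sub_apply]
  rcases eq_or_ne i j with rfl | hij
  · rw [M.YX_self, LinearMap.sub_apply, LinearMap.smul_apply, LinearMap.smul_apply,
      LinearMap.sum_apply]
    exact sub_mem (Submodule.smul_mem _ _ hv) (Submodule.smul_mem _ _
      (sum_mem fun k _ => M.σ_mem_wordSpan hD _ hv))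
  · rw [M.YX_ne i j hij, LinearMap.sub_apply, LinearMap.smul_apply, LinearMap.smul_apply]
    exact sub_mem (Submodule.smul_mem _ _ (M.σ_mem_wordSpan hD _ hv)) (Submodule.smul_mem _ _ hv)

theorem commutesFiltered (hD : D ∈ M.signPart) : CommutesFiltered M.ops D := by
  rintro (i | i) (j | j) d v hv
  · change M.X i (M.X j v) - M.X j (M.X i v) ∈ _
    rw [← Module.End.mul_apply, M.X_comm, Module.End.mul_apply, sub_self]
    exact zero_mem _
  · change M.X i (M.Y j v) - M.Y j (M.X i v) ∈ _
    rw [← neg_sub]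
    exact neg_mem (M.YX_sub_mem hD j i hv)
  · exact M.YX_sub_mem hD i j hv
  · change M.Y i (M.Y j v) - M.Y j (M.Y i v) ∈ _
    rw [← Module.End.mul_apply, M.Y_comm, Module.End.mul_apply, sub_self]
    exact zero_mem _

theorem σ_mul_pow_mul_pow (w : Equiv.Perm (Fin n)) (k : Fin n) (i j : ℕ) :
    M.σ w * (M.X k ^ i * M.Y k ^ j) = M.X (w k) ^ i * M.Y (w k) ^ j * M.σ w := by
  have hX : SemiconjBy (M.σ w) (M.X k) (M.X (w k)) := M.σ_mul_X w k
  have hY : SemiconjBy (M.σ w) (M.Y k) (M.Y (w k)) := M.σ_mul_Y w k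
  exact (hX.pow_right i).mul_right (hY.pow_right j)

theorem sum_pow_mul_pow_mem (hD : D ∈ M.signPart) (i j : ℕ) :
    (∑ k, M.X k ^ i * M.Y k ^ j) D ∈ M.signPart := by
  refine M.mem_signPart_of_comm (fun w => ?_) hD
  rw [Finset.mul_sum, Finset.sum_mul]
  simp only [M.σ_mul_pow_mul_pow]
  exact Equiv.sum_comp w fun k => M.X k ^ i * M.Y k ^ j * M.σ w

theorem polarPow_eq (n i j : ℕ) : polarPow n i j =
    ∑ k, monomial (Finsupp.single (Sum.inl k) i + Finsupp.single (Sum.inr k) j) 1 := by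
  refine Finset.sum_congr rfl fun k _ => ?_
  rw [Xv, Yv, X_pow_eq_monomial, X_pow_eq_monomial, monomial_mul, one_mul]

theorem polarPow_isHomogeneous (n i j : ℕ) : (polarPow n i j).IsHomogeneous (i + j) := by
  rw [polarPow_eq]
  refine IsHomogeneous.sum _ _ _ fun k _ => isHomogeneous_monomial _ ?_
  rw [map_add, Finsupp.degree_single, Finsupp.degree_single]

theorem orderedEval_polarPow_mem (hD : M.signPart = Submodule.span ℚ {D}) {i j : ℕ}
    (hij : ¬(i = 0 ∧ j = 0)) : orderedEval M.ops D (polarPow n i j) ∈ wordSpan M.ops D (i + j) := by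
  have hDm : D ∈ M.signPart := hD ▸ Submodule.mem_span_singleton_self D
  have h₁ : (∑ k, M.X k ^ i * M.Y k ^ j) D ∈ wordSpan M.ops D (i + j) := by
    refine (Submodule.span_singleton_le_iff_mem _ _).2 ?_ (hD ▸ M.sum_pow_mul_pow_mem hDm i j)
    exact word_mem_wordSpan (l := []) (by rw [List.length_nil]; omega)
  have h₂ : ∀ k, orderedEval M.ops D
      (monomial (Finsupp.single (Sum.inl k) i + Finsupp.single (Sum.inr k) j) 1) -
      (M.X k ^ i * M.Y k ^ j) D ∈ wordSpan M.ops D (i + j) := fun k => by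
    have := (M.commutesFiltered hDm).orderedEval_monomial_sub_mem
      (e := Finsupp.single (Sum.inl k) i + Finsupp.single (Sum.inr k) j)
      (l := List.replicate i (Sum.inl k) ++ List.replicate j (Sum.inr k)) (by
        rw [Finsupp.toMultiset_add, Finsupp.toMultiset_single, Finsupp.toMultiset_single,
          Multiset.nsmul_singleton, Multiset.nsmul_singleton, ← Multiset.coe_add,
          Multiset.coe_replicate, Multiset.coe_replicate])
    rw [List.length_append, List.length_replicate, List.length_replicate, List.map_append,
      List.map_replicate, List.map_replicate, List.prod_append, List.prod_replicate,
      List.prod_replicate] at this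
    exact this
  rw [polarPow_eq, map_sum]
  have := add_mem (sum_mem fun k (_ : k ∈ Finset.univ) => h₂ k) h₁
  rwa [Finset.sum_sub_distrib, LinearMap.sum_apply, sub_add_cancel] at this

end CherednikModule

theorem le_finrank_DR (m : ℕ) [Module.Finite ℚ (DR (m + 1))] :
    (m + 2) ^ m ≤ Module.finrank ℚ (DR (m + 1)) := by
  obtain ⟨W, _, _, M, D, _, hD0, hD⟩ := exists_cherednikModule m
  have hDm : D ∈ M.signPart := hD ▸ Submodule.mem_span_singleton_self D
  have hZ := M.commutesFiltered hDm
  obtain ⟨T, _, hT, hle⟩ := hZ.exists_finrank_le (mkDR (m + 1))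
    (Ideal.Quotient.mkₐ_surjective ℚ (Mplus (m + 1))) fun q hq d =>
      hZ.orderedEval_homogeneousComponent_mem (by
        rintro _ ⟨i, j, hij, rfl⟩
        exact ⟨i + j, CherednikModule.polarPow_isHomogeneous _ i j,
          M.orderedEval_polarPow_mem hD hij⟩) (Ideal.Quotient.eq_zero_iff_mem.1 hq) d
  let N : Submodule ℚ W := ⨆ d, wordSpan M.ops D d
  have hmono : Monotone fun d => wordSpan M.ops D d := fun _ _ h => wordSpan_mono h
  have hmem : ∀ v, v ∈ N ↔ ∃ d, v ∈ wordSpan M.ops D d := fun v =>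
    Submodule.mem_iSup_of_directed _ hmono.directed_le
  have hops : ∀ a, ∀ v ∈ N, M.ops a v ∈ N := fun a v hv => by
    obtain ⟨d, hd⟩ := (hmem v).1 hv
    exact (hmem _).2 ⟨d + 1, apply_mem_wordSpan a hd⟩
  obtain ⟨M', -, -, hσ⟩ := M.exists_restrict N (fun i => hops (Sum.inl i))
    (fun i => hops (Sum.inr i)) fun w v hv => by
      obtain ⟨d, hd⟩ := (hmem v).1 hv
      exact (hmem _).2 ⟨d, M.σ_mem_wordSpan hDm w hd⟩
  have hDN : D ∈ N := (hmem D).2 ⟨1, word_mem_wordSpan (l := []) Nat.zero_lt_one⟩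
  have hD' : (⟨D, hDN⟩ : N) ∈ M'.signPart := M'.mem_signPart.2 fun w => Subtype.ext <| by
    rw [hσ]
    exact M.mem_signPart.1 hDm w
  have hpos : 0 < Module.finrank ℚ M'.signPart := by
    have : Nontrivial M'.signPart := ⟨⟨_, hD'⟩, 0, fun h => hD0 <|
      congrArg Subtype.val (congrArg Subtype.val h)⟩
    exact Module.finrank_pos
  calc (m + 2) ^ m ≤ (m + 2) ^ m * Module.finrank ℚ M'.signPart := Nat.le_mul_of_pos_right _ hpos
    _ = Module.finrank ℚ N := M'.finrank_mul_succ.symm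
    _ ≤ Module.finrank ℚ T := Submodule.finrank_mono (iSup_le hle)
    _ ≤ _ := hT

end CherednikFiltration

end DoubleCoinvariants

/-- the double coinvariant algebra `DR n` is a finite-dimensional
`ℚ`-vector space of dimension `(n+1)^(n-1)`. -/
theorem DR_finiteDimensional_and_dim (n : ℕ) (hn : 1 ≤ n) :
    FiniteDimensional ℚ (DR n) ∧ Module.finrank ℚ (DR n) = (n + 1) ^ (n - 1) := by
  obtain ⟨m, rfl⟩ := Nat.exists_eq_add_of_le' hn
  obtain ⟨hfin, hle⟩ := DoubleCoinvariants.DR_finite_and_finrank_le m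
  exact ⟨hfin, hle.antisymm (DoubleCoinvariants.le_finrank_DR m)⟩
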